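/- Let f ∈ ℤ[x₁,…,xₙ] have degree at most d ≥ 3 with leading form f^{[d]} satisfying Height(f^{[d]}) ≤ H, let σ := σ_∞(f^{[d]}), let ω ∈ 𝒮⁺(𝐜), and let α ∈ 𝕋 and q ∈ ℕ be primitive. Then for all P ≥ 2: |S(α, P)/Pⁿ|^{2^{d−1}} ≪ (log P)ⁿ · ( P^{1−d} + ‖qα‖·H + q·P^{−d} + min{ H·q^{−1}, (‖qα‖·P^d)^{−1} } )^{(n−σ)/(d−1)}, with implicit constant depending only on d, n and 𝐜. -/

import Mathlib

noncomputable section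
open scoped Classical
open MvPolynomial MeasureTheory

/-- Distance from a real number to the nearest integer. -/
def nint (x : ℝ) : ℝ := |x - round x|

/-- `α ∈ 𝕋` and `q ∈ ℕ` are *primitive* if there is `a` coprime to `q`
with `‖qα‖ = |qα - a|`. -/
def Primitive (α : ℝ) (q : ℕ) : Prop :=
  ∃ a : ℤ, Int.gcd a q = 1 ∧ nint (q * α) = |q * α - a|

/-- `e(t) = exp(2πit)`. -/
def eC (t : ℝ) : ℂ := Complex.exp (2 * Real.pi * Complex.I * t)

/-- The exponential sum `S(α, P) = Σ_{x ∈ ℤⁿ} ω(x/P) e(α f(x))`. -/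
def expSum (n : ℕ) (f : MvPolynomial (Fin n) ℤ) (ω : (Fin n → ℝ) → ℝ) (α P : ℝ) : ℂ :=
  ∑' x : Fin n → ℤ, (ω (fun i => (x i : ℝ) / P) : ℂ) * eC (α * (MvPolynomial.eval x f : ℝ))

/-- Mixed partial derivative `∂^ε g`. -/
def mpderiv (n : ℕ) (ε : Fin n → ℕ) (g : (Fin n → ℝ) → ℝ) : (Fin n → ℝ) → ℝ :=
  (List.finRange n).foldr
    (fun i h => (fun u : (Fin n → ℝ) → ℝ => fun x => fderiv ℝ u x (Pi.single i 1))^[ε i] h) g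

/-- A super-exponential increasing tuple of positive constants `(c, c₀, c₁, …)`. -/
def SuperSeq (c : ℝ) (cs : ℕ → ℝ) : Prop :=
  0 < c ∧ c ≤ cs 0 ∧ Monotone cs ∧ ∀ i j, cs i * cs j ≤ cs (i + j)

/-- Membership of `ω` in the class `𝒮⁺(𝐜)` of smooth weight functions. -/
def SmoothWeight (n : ℕ) (c : ℝ) (cs : ℕ → ℝ) (ω : (Fin n → ℝ) → ℝ) : Prop :=
  ContDiff ℝ (⊤ : ℕ∞) ω ∧ (∀ x, 0 ≤ ω x) ∧ (∀ x, ω x ≠ 0 → ∀ i, |x i| ≤ c) ∧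
    ∀ (ε : Fin n → ℕ) (x : Fin n → ℝ), |mpderiv n ε ω x| ≤ cs (∑ i, ε i)

/-- Dimension of the singular locus of `g` over `K`, i.e. the Krull dimension
of the coordinate ring of the affine set cut out by `∇g = 0`. -/
def singDim (n : ℕ) (K : Type) [CommRing K] (g : MvPolynomial (Fin n) K) : WithBot (WithTop ℕ) :=
  ringKrullDim (MvPolynomial (Fin n) K ⧸ Ideal.span (Set.range fun i => MvPolynomial.pderiv i g))

/-- `Height f ≤ H`: all coefficients of `f` are at most `H` in absolute value. -/
def HeightLe (n : ℕ) (f : MvPolynomial (Fin n) ℤ) (H : ℝ) : Prop :=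
  ∀ m : Fin n →₀ ℕ, |((f.coeff m : ℤ) : ℝ)| ≤ H

/-- `Height_{P,k} f ≤ H`: the relative height of `f` w.r.t. `P` at scale `k` is at most `H`. -/
def HeightPLe (n k : ℕ) (P : ℝ) (f : MvPolynomial (Fin n) ℤ) (H : ℝ) : Prop :=
  ∀ m : Fin n →₀ ℕ, |((f.coeff m : ℤ) : ℝ)| * P ^ (m.sum fun _ e => e) ≤ H * P ^ k

/-- `b = ∏_{p^e ∥ q, e ≤ 2} p^e`. -/
def bOf (q : ℕ) : ℕ :=
  ∏ p ∈ q.primeFactors, if q.factorization p ≤ 2 then p ^ q.factorization p else 1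

/-- `c₁ = ∏_{p^e ∥ q, e > 2} p^⌊e/2⌋`. -/
def c1Of (q : ℕ) : ℕ :=
  ∏ p ∈ q.primeFactors, if 2 < q.factorization p then p ^ (q.factorization p / 2) else 1

/-- `c₂ = ∏_{p^e ∥ q, e > 2, e odd} p`. -/
def c2Of (q : ℕ) : ℕ :=
  ∏ p ∈ q.primeFactors, if 2 < q.factorization p ∧ Odd (q.factorization p) then p else 1

/-- `η_q = max{(b³c₁c₂²)^{1/(2^d−2)}, (b³c₁²c₂)^{1/(5·2^{d−2}−4)}}`. -/
def etaOf (d q : ℕ) : ℝ :=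
  max (((bOf q : ℝ) ^ 3 * (c1Of q : ℝ) * (c2Of q : ℝ) ^ 2) ^ ((1 : ℝ) / ((2:ℝ) ^ (d : ℝ) - 2)))
      (((bOf q : ℝ) ^ 3 * (c1Of q : ℝ) ^ 2 * (c2Of q : ℝ)) ^
        ((1 : ℝ) / (5 * (2:ℝ) ^ ((d : ℝ) - 2) - 4)))

/-- The `r`-values `r_i = ∏_{p^e ∥ kb, σ_p(g^{[k]}) = i} p^e` of `g` w.r.t. `q`. -/
def rOf (n k q : ℕ) (g : MvPolynomial (Fin n) ℤ) (i : ℕ) : ℕ :=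
  ∏ p ∈ (k * bOf q).primeFactors,
    if singDim n (ZMod p)
        (MvPolynomial.map (Int.castRingHom (ZMod p)) (MvPolynomial.homogeneousComponent k g))
        = (i : WithBot (WithTop ℕ))
    then p ^ ((k * bOf q).factorization p) else 1

/-- `R^{[k]}_ζ(g, q) = ∏_{ζ ≤ i ≤ n} r_i^{i−ζ}`. -/
def ROf (n k q : ℕ) (g : MvPolynomial (Fin n) ℤ) (ζ : ℕ) : ℕ :=
  ∏ i ∈ Finset.Icc ζ n, (rOf n k q g i) ^ (i - ζ)

/-- `ξ = (5 − 2^{4−d})/(3 − 2^{3−d})`. -/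
def xiOf (d : ℕ) : ℝ := (5 - (2:ℝ) ^ ((4 : ℝ) - d)) / (3 - (2:ℝ) ^ ((3 : ℝ) - d))

/-- `γ = 1/(3·2^{d−2} − 2)`. -/
def gamOf (d : ℕ) : ℝ := 1 / (3 * (2:ℝ) ^ ((d : ℝ) - 2) - 2)

/-- `A_d = 7·2^{d−4} − 5/4`. -/
def AdOf (d : ℕ) : ℝ := 7 * (2:ℝ) ^ ((d : ℝ) - 4) - 5 / 4

/-- `B_k = (k−1)·2^{d−1}`. -/
def BkOf (d k : ℕ) : ℝ := ((k : ℝ) - 1) * (2:ℝ) ^ ((d : ℝ) - 1)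

/-- `V_k = 2^{d+1−k} − 2`. -/
def VkOf (d k : ℕ) : ℝ := (2:ℝ) ^ ((d : ℝ) + 1 - (k : ℝ)) - 2

/-- `C(α, q) = (‖qα‖P)^{1/(2^{d−1}−2)} + (qP^{−2})^{1/2^{d−2}} + η_q⁻¹`. -/
def CCof (d : ℕ) (P : ℝ) (q : ℕ) (α : ℝ) : ℝ :=
  (nint (q * α) * P) ^ (1 / ((2:ℝ) ^ ((d : ℝ) - 1) - 2)) +
    ((q : ℝ) * P ^ (-(2 : ℝ))) ^ (1 / (2:ℝ) ^ ((d : ℝ) - 2)) + (etaOf d q)⁻¹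

/-- `W_k(α, q)`; the term `(‖qα‖P^k)^{−1/B_k}` is interpreted as `+∞` when `‖qα‖ = 0`. -/
def WWof (d k : ℕ) (P : ℝ) (q : ℕ) (α : ℝ) : ℝ :=
  P ^ (-((2:ℝ) ^ (1 - (d : ℝ)))) + nint (q * α) ^ (1 / (BkOf d k + VkOf d k)) +
    ((q : ℝ) * P ^ (-(k : ℝ))) ^ (1 / BkOf d k) +
    min ((q : ℝ) ^ (-(1 / (BkOf d k + VkOf d k))))
      (if nint (q * α) = 0 then (q : ℝ) ^ (-(1 / (BkOf d k + VkOf d k)))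
       else (nint (q * α) * P ^ (k : ℝ)) ^ (-(1 / BkOf d k)))

/-- `M(α, q) = min{C(α, q), W₃(α, q), …, W_d(α, q)}`. -/
def MMof (d : ℕ) (P : ℝ) (q : ℕ) (α : ℝ) : ℝ :=
  min (CCof d P q α) (sInf ((fun k => WWof d k P q α) '' Set.Icc 3 d))

/-- `W_k*(α, q)`; the term `(‖qα‖P^k)^{−1/B_k}` is interpreted as `+∞` when `‖qα‖ = 0`. -/
def WSof (d k : ℕ) (P : ℝ) (q : ℕ) (α : ℝ) : ℝ :=
  max (nint (q * α) ^ (1 / (BkOf d k + VkOf d k)))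
    (min ((etaOf d q)⁻¹)
      (if nint (q * α) = 0 then (etaOf d q)⁻¹
       else (nint (q * α) * P ^ (k : ℝ)) ^ (-(1 / BkOf d k))))

/-- `M*(α, q) = min{W₃*(α, q), …, W_d*(α, q)}`. -/
def MSof (d : ℕ) (P : ℝ) (q : ℕ) (α : ℝ) : ℝ :=
  sInf ((fun k => WSof d k P q α) '' Set.Icc 3 d)

/-- The major arcs `𝔐(Δ)`, viewed inside a fundamental domain `[0,1)` for `𝕋 = ℝ/ℤ`. -/
def majorArcs (d : ℕ) (Δ P : ℝ) : Set ℝ :=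
  {α | ∃ q : ℕ, 0 < q ∧ (q : ℝ) ≤ P ^ Δ ∧
    ∃ a : ℕ, a ≤ q ∧ Nat.gcd a q = 1 ∧ nint (α - (a : ℝ) / q) ≤ P ^ (Δ - d)}

/-- The minor arcs `𝔪 = 𝕋 ∖ 𝔐(Δ)`. -/
def minorArcs (d : ℕ) (Δ P : ℝ) : Set ℝ := Set.Ico (0 : ℝ) 1 \ majorArcs d Δ P

section LatticeBalls

variable {G ι : Type*} [AddCommGroup G] [Fintype ι]

/-- The elements of `G` whose image under `lam` has sup norm at most `r`. -/
def latBall (lam : G →+ (ι → ℝ)) (r : ℝ) : Set G := {g | ‖lam g‖ ≤ r}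

theorem latBall_mono (lam : G →+ (ι → ℝ)) {r s : ℝ} (h : r ≤ s) : latBall lam r ⊆ latBall lam s :=
  fun _ hg => le_trans hg h

/-- Ratios of ball cardinalities increase with the scale. -/
theorem latBall_card_mul_le (lam : G →+ (ι → ℝ)) (fin : ∀ r, (latBall lam r).Finite)
    {r s t : ℝ} (L : ℕ) (hL0 : 0 < L) (hs : 0 ≤ s) (hL : 2 * t ≤ L * s) :
    (latBall lam r).ncard * (latBall lam t).ncard ≤
      (latBall lam s).ncard * (latBall lam (L * r + t)).ncard := by
  have hex : ∃ M ∈ (fin r).toFinset.powerset.filter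
      (fun M => ∀ x ∈ M, ∀ y ∈ M, x ≠ y → s < ‖lam (x - y)‖),
      ∀ M' ∈ (fin r).toFinset.powerset.filter
      (fun M => ∀ x ∈ M, ∀ y ∈ M, x ≠ y → s < ‖lam (x - y)‖), M'.card ≤ M.card := by
    apply Finset.exists_max_image
    exact ⟨∅, by simp⟩
  obtain ⟨M, hM, hmax⟩ := hex
  simp only [Finset.mem_filter, Finset.mem_powerset] at hM hmax
  obtain ⟨hMr, hsep⟩ := hM
  have hMr' : ∀ x ∈ M, ‖lam x‖ ≤ r := fun x hx => by simpa [latBall] using hMr hx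
  have hcov : (fin r).toFinset ⊆ M.biUnion fun m => (fin s).toFinset.image (m + ·) := by
    intro x hx
    by_contra hcon
    have hfar : ∀ m ∈ M, s < ‖lam (x - m)‖ := by
      intro m hm
      by_contra hle
      push Not at hle
      apply hcon
      simp only [Finset.mem_biUnion, Finset.mem_image, Set.Finite.mem_toFinset]
      exact ⟨m, hm, x - m, hle, by abel⟩
    have hxM : x ∉ M := fun hxM => by
      have := hfar x hxM
      simp at this; linarith
    have := hmax (insert x M) ⟨Finset.insert_subset hx hMr, by
      intro a ha b hb hab
      rw [Finset.mem_insert] at ha hb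
      rcases ha with rfl | ha <;> rcases hb with rfl | hb
      · exact absurd rfl hab
      · exact hfar b hb
      · have := hfar a ha
        rwa [← norm_neg, ← map_neg, neg_sub] at this
      · exact hsep a ha b hb hab⟩
    rw [Finset.card_insert_of_notMem hxM] at this
    omega
  have h1 : (latBall lam r).ncard ≤ M.card * (latBall lam s).ncard := by
    rw [Set.ncard_eq_toFinset_card _ (fin r), Set.ncard_eq_toFinset_card _ (fin s)]
    refine (Finset.card_le_card hcov).trans (Finset.card_biUnion_le_card_mul _ _ _ ?_)
    intro m _
    exact Finset.card_image_le
  have h2 : M.card * (latBall lam t).ncard ≤ (latBall lam (L * r + t)).ncard := by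
    rw [Set.ncard_eq_toFinset_card _ (fin t), Set.ncard_eq_toFinset_card _ (fin (L * r + t)),
      ← Finset.card_product]
    apply Finset.card_le_card_of_injOn (fun p => L • p.1 + p.2)
    · rintro ⟨x, y⟩ hp
      simp only [Finset.coe_product, Set.mem_prod, Finset.mem_coe, Set.Finite.mem_toFinset] at hp ⊢
      show ‖lam (L • x + y)‖ ≤ _
      rw [map_add, map_nsmul]
      refine (norm_add_le _ _).trans (add_le_add ?_ hp.2)
      rw [← Nat.cast_smul_eq_nsmul ℝ, norm_smul]
      simpa using mul_le_mul_of_nonneg_left (hMr' x hp.1) (Nat.cast_nonneg L)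
    · rintro ⟨x, y⟩ hp ⟨x', y'⟩ hp' heq
      simp only [Finset.coe_product, Set.mem_prod, Finset.mem_coe, Set.Finite.mem_toFinset]
        at hp hp' heq
      have hxx : x = x' := by
        by_contra hne
        have h3 := hsep x hp.1 x' hp'.1 hne
        have h4 : L • (x - x') = y' - y := by
          rw [smul_sub, sub_eq_sub_iff_add_eq_add, heq]; abel
        have h5 : (L : ℝ) * ‖lam (x - x')‖ ≤ 2 * t := by
          have : ‖lam (L • (x - x'))‖ ≤ 2 * t := by
            rw [h4, map_sub]
            refine (norm_sub_le _ _).trans ?_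
            have h6 : ‖lam y'‖ ≤ t := hp'.2
            have h7 : ‖lam y‖ ≤ t := hp.2
            linarith
          rw [map_nsmul, ← Nat.cast_smul_eq_nsmul ℝ, norm_smul] at this
          simpa using this
        have h8 : (0 : ℝ) < L := by exact_mod_cast hL0
        nlinarith
      subst hxx
      simpa using heq
  calc _ ≤ M.card * (latBall lam s).ncard * (latBall lam t).ncard := Nat.mul_le_mul_right _ h1
    _ = (latBall lam s).ncard * (M.card * (latBall lam t).ncard) := by ring
    _ ≤ _ := Nat.mul_le_mul_left _ h2

theorem latBall_scale_card_le (lam : G →+ (ι → ℝ)) (fin : ∀ r, (latBall lam r).Finite)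
    {r : ℝ} (hr : 0 < r) (C : ℕ) :
    (latBall lam (C * r)).ncard ≤ (2 * C + 1) ^ Fintype.card ι * (latBall lam r).ncard := by
  rw [Set.ncard_eq_toFinset_card _ (fin r), Set.ncard_eq_toFinset_card _ (fin (C * r))]
  have hT : (Fintype.piFinset fun _ : ι => Finset.Icc (-(C : ℤ)) C).card
      = (2 * C + 1) ^ Fintype.card ι := by
    rw [Fintype.card_piFinset]
    simp only [Int.card_Icc, Finset.prod_const, Finset.card_univ]
    congr 1; omega
  rw [← hT, mul_comm (Finset.card _)]
  apply Finset.card_le_mul_card_image_of_maps_to (f := fun g i => ⌊lam g i / r⌋)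
  · intro g hg
    have hg' : ‖lam g‖ ≤ C * r := by simpa [latBall] using hg
    simp only [Fintype.mem_piFinset, Finset.mem_Icc]
    intro i
    have h1 : |lam g i| ≤ C * r := (norm_le_pi_norm (lam g) i).trans hg'
    rw [abs_le] at h1
    constructor
    · rw [Int.le_floor, le_div_iff₀ hr]; push_cast; linarith
    · have : ((⌊lam g i / r⌋ : ℤ) : ℝ) ≤ C :=
        (Int.floor_le _).trans (by rw [div_le_iff₀ hr]; linarith)
      exact_mod_cast this
  · intro k _
    rcases Finset.eq_empty_or_nonempty
      {g ∈ (fin (C * r)).toFinset | (fun i => ⌊lam g i / r⌋) = k} with he | ⟨g0, hg0⟩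
    · rw [he]; simp
    apply Finset.card_le_card_of_injOn (fun g => g - g0)
    · intro g hg
      simp only [Finset.coe_filter, Set.mem_ofPred_eq, Finset.mem_filter] at hg hg0
      simp only [Finset.mem_coe, Set.Finite.mem_toFinset]
      show ‖lam (g - g0)‖ ≤ r
      rw [pi_norm_le_iff_of_nonneg hr.le]
      intro i
      have h1 : ⌊lam g i / r⌋ = ⌊lam g0 i / r⌋ := by
        rw [congrFun hg.2 i, congrFun hg0.2 i]
      have h2 := Int.abs_sub_lt_one_of_floor_eq_floor h1
      rw [← sub_div, abs_div, abs_of_pos hr, div_lt_one hr] at h2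
      simpa using h2.le
    · intro a _ b _ hab
      simpa using hab

end LatticeBalls

theorem nint_nonneg (x : ℝ) : 0 ≤ nint x := abs_nonneg _

theorem nint_le_abs_sub (x : ℝ) (m : ℤ) : nint x ≤ |x - m| := round_le x m

section FormCount

variable {n : ℕ}

/-- Integer points `u` with `|u| ≤ X` at which all the linear forms given by the rows of `γ`
are within `δ` of an integer. -/
def formSet (γ : Fin n → Fin n → ℝ) (X δ : ℝ) : Set (Fin n → ℤ) :=
  {u | (∀ i, |(u i : ℝ)| ≤ X) ∧ ∀ j, nint (∑ k, γ j k * u k) ≤ δ}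

theorem finite_box (X : ℝ) : {u : Fin n → ℤ | ∀ i, |(u i : ℝ)| ≤ X}.Finite := by
  apply Set.Finite.subset (Set.Finite.pi' (fun _ : Fin n => Set.finite_Icc (-⌊X⌋) ⌊X⌋))
  intro u hu i
  have h := abs_le.1 (hu i)
  simp only [Set.mem_Icc]
  constructor
  · rw [neg_le, Int.le_floor]; push_cast; linarith
  · rw [Int.le_floor]; exact h.2

theorem formSet_finite (γ : Fin n → Fin n → ℝ) (X δ : ℝ) : (formSet γ X δ).Finite :=
  (finite_box X).subset fun _ h => h.1

theorem formSet_mono (γ : Fin n → Fin n → ℝ) {X δ X' δ' : ℝ} (hX : X ≤ X') (hδ : δ ≤ δ') :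
    formSet γ X δ ⊆ formSet γ X' δ' :=
  fun _ h => ⟨fun i => (h.1 i).trans hX, fun j => (h.2 j).trans hδ⟩

theorem formSet_ncard_mono (γ : Fin n → Fin n → ℝ) {X δ X' δ' : ℝ} (hX : X ≤ X')
    (hδ : δ ≤ δ') : (formSet γ X δ).ncard ≤ (formSet γ X' δ').ncard :=
  Set.ncard_le_ncard (formSet_mono γ hX hδ) (formSet_finite γ X' δ')

/-- The embedding of `ℤⁿ × ℤⁿ` as a lattice in `ℝ²ⁿ` attached to `γ`, normalised by `X` and `δ`. -/
def formLat (γ : Fin n → Fin n → ℝ) (X δ : ℝ) :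
    (Fin n → ℤ) × (Fin n → ℤ) →+ (Fin n ⊕ Fin n → ℝ) where
  toFun p := Sum.elim (fun i => (p.1 i : ℝ) / X) (fun j => (∑ k, γ j k * p.1 k - p.2 j) / δ)
  map_zero' := by ext (i | i) <;> simp
  map_add' p p' := by
    ext (i | i)
    · simp [add_div]
    · simp only [Prod.fst_add, Prod.snd_add, Pi.add_apply, Sum.elim_inr, Int.cast_add, mul_add,
        Finset.sum_add_distrib]
      ring

theorem mem_latBall_formLat (γ : Fin n → Fin n → ℝ) {X δ : ℝ} (hX : 0 < X) (hδ : 0 < δ)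
    {r : ℝ} (hr : 0 ≤ r) (p : (Fin n → ℤ) × (Fin n → ℤ)) :
    p ∈ latBall (formLat γ X δ) r ↔
      (∀ i, |(p.1 i : ℝ)| ≤ r * X) ∧ ∀ j, |∑ k, γ j k * p.1 k - p.2 j| ≤ r * δ := by
  show ‖formLat γ X δ p‖ ≤ r ↔ _
  rw [pi_norm_le_iff_of_nonneg hr]
  simp only [formLat, AddMonoidHom.coe_mk, ZeroHom.coe_mk, Sum.forall, Sum.elim_inl, Sum.elim_inr,
    Real.norm_eq_abs, abs_div, abs_of_pos hX, abs_of_pos hδ, div_le_iff₀ hX, div_le_iff₀ hδ]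

theorem latBall_formLat_finite (γ : Fin n → Fin n → ℝ) {X δ : ℝ} (hX : 0 < X) (hδ : 0 < δ)
    (r : ℝ) : (latBall (formLat γ X δ) r).Finite := by
  rcases lt_or_ge r 0 with hr | hr
  · convert Set.finite_empty
    rw [Set.eq_empty_iff_forall_notMem]
    intro g hg
    have h1 : ‖formLat γ X δ g‖ ≤ r := hg
    linarith [norm_nonneg (formLat γ X δ g)]
  have hfin : ∀ u : Fin n → ℤ, {v : Fin n → ℤ | ∀ j, |∑ k, γ j k * u k - v j| ≤ r * δ}.Finite := by
    intro u
    apply (finite_box (∑ j, |∑ k, γ j k * (u k : ℝ)| + r * δ)).subset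
    intro v hv i
    have h1 : |∑ k, γ i k * (u k : ℝ)| ≤ ∑ j, |∑ k, γ j k * (u k : ℝ)| :=
      Finset.single_le_sum (f := fun j => |∑ k, γ j k * (u k : ℝ)|)
        (fun _ _ => abs_nonneg _) (Finset.mem_univ i)
    have h2 := abs_sub_abs_le_abs_sub (v i : ℝ) (∑ k, γ i k * (u k : ℝ))
    rw [abs_sub_comm] at h2
    linarith [hv i]
  apply ((finite_box (n := n) (r * X)).biUnion fun u _ => (hfin u).image fun v => (u, v)).subset
  rintro ⟨u, v⟩ h
  rw [mem_latBall_formLat γ hX hδ hr] at h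
  simp only [Set.mem_iUnion, Set.mem_image]
  exact ⟨u, h.1, v, h.2, rfl⟩

theorem formSet_ncard_le_latBall (γ : Fin n → Fin n → ℝ) {X δ : ℝ} (hX : 0 < X)
    (hδ : 0 < δ) {r : ℝ} (hr : 0 ≤ r) :
    (formSet γ (r * X) (r * δ)).ncard ≤ (latBall (formLat γ X δ) r).ncard := by
  apply Set.ncard_le_ncard_of_injOn (fun u => (u, fun j => round (∑ k, γ j k * (u k : ℝ))))
    (ht := latBall_formLat_finite γ hX hδ r)
  · intro u hu
    rw [mem_latBall_formLat γ hX hδ hr]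
    exact hu
  · intro u _ u' _ h
    exact (Prod.ext_iff.1 h).1

theorem latBall_ncard_le_formSet (γ : Fin n → Fin n → ℝ) {X δ : ℝ} (hX : 0 < X)
    (hδ : 0 < δ) {r : ℝ} (hr : 0 ≤ r) (h1 : r * δ ≤ 1) :
    (latBall (formLat γ X δ) r).ncard ≤ 3 ^ n * (formSet γ (r * X) (r * δ)).ncard := by
  rw [Set.ncard_eq_toFinset_card _ (latBall_formLat_finite γ hX hδ r),
    Set.ncard_eq_toFinset_card _ (formSet_finite γ _ _)]
  have hT : (Fintype.piFinset fun _ : Fin n => Finset.Icc (-1 : ℤ) 1).card = 3 ^ n := by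
    rw [Fintype.card_piFinset]; simp
  rw [← hT, ← Finset.card_product]
  apply Finset.card_le_card_of_injOn
    (fun p => (fun j => round (∑ k, γ j k * (p.1 k : ℝ)) - p.2 j, p.1))
  · intro p hp
    simp only [Set.Finite.coe_toFinset] at hp
    rw [mem_latBall_formLat γ hX hδ hr] at hp
    simp only [Finset.coe_product, Set.mem_prod, Finset.mem_coe, Fintype.mem_piFinset,
      Set.Finite.mem_toFinset, Finset.mem_Icc]
    refine ⟨fun j => ?_, hp.1, fun j => (nint_le_abs_sub _ _).trans (hp.2 j)⟩
    have h2 := abs_le.1 ((hp.2 j).trans h1)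
    have h3 := abs_le.1 (abs_sub_round (∑ k, γ j k * (p.1 k : ℝ)))
    constructor
    · have : (-2 : ℝ) < ((round (∑ k, γ j k * (p.1 k : ℝ)) - p.2 j : ℤ) : ℝ) := by
        push_cast; linarith
      have : (-2 : ℤ) < round (∑ k, γ j k * (p.1 k : ℝ)) - p.2 j := by exact_mod_cast this
      omega
    · have : ((round (∑ k, γ j k * (p.1 k : ℝ)) - p.2 j : ℤ) : ℝ) < 2 := by
        push_cast; linarith
      have : round (∑ k, γ j k * (p.1 k : ℝ)) - p.2 j < 2 := by exact_mod_cast this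
      omega
  · rintro ⟨u, v⟩ _ ⟨u', v'⟩ _ h
    simp only [Prod.mk.injEq] at h
    obtain ⟨h1, rfl⟩ := h
    ext i
    · rfl
    · simpa using congrFun h1 i

theorem formSet_scale (γ : Fin n → Fin n → ℝ) {X δ : ℝ} (hX : 0 < X) (hδ : 0 < δ)
    (h1 : δ ≤ 1) (C : ℕ) :
    (formSet γ (C * X) (C * δ)).ncard ≤
      (2 * C + 1) ^ (2 * n) * 3 ^ n * (formSet γ X δ).ncard := by
  have a := formSet_ncard_le_latBall γ hX hδ (r := C) (by positivity)
  have b := latBall_scale_card_le _ (latBall_formLat_finite γ hX hδ) one_pos C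
  have c := latBall_ncard_le_formSet γ hX hδ zero_le_one (by simpa using h1)
  rw [mul_one] at b
  rw [one_mul, one_mul] at c
  simp only [Fintype.card_sum, Fintype.card_fin, ← two_mul] at b
  calc _ ≤ _ := a.trans b
    _ ≤ (2 * C + 1) ^ (2 * n) * (3 ^ n * (formSet γ X δ).ncard) := Nat.mul_le_mul_left _ c
    _ = _ := by ring

theorem formSet_ratio (γ : Fin n → Fin n → ℝ) {X δ K : ℝ} (hX : 0 < X) (hδ : 0 < δ)
    (hδ1 : δ ≤ 1) (hXδ : X * δ ≤ 1) (hK : 1 ≤ K) (hKX : K ≤ X) :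
    (formSet γ X δ).ncard * (formSet γ (1 / δ) (1 / X)).ncard ≤
      (5 ^ (2 * n) * 3 ^ n) * (7 ^ (2 * n) * 3 ^ n) *
        ((formSet γ (X / K) (δ / K)).ncard * (formSet γ (K / δ) (K / X)).ncard) := by
  have hK0 : 0 < K := by linarith
  set τ := 1 / (X * δ) with hτ
  have hτ1 : 1 ≤ τ := by rw [hτ, le_div_iff₀ (by positivity)]; linarith
  have fin := latBall_formLat_finite γ hX hδ
  have e1 : τ * X = 1 / δ := by rw [hτ]; field_simp
  have e2 : τ * δ = 1 / X := by rw [hτ]; field_simp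
  have a1 := formSet_ncard_le_latBall γ hX hδ (r := 1) (by positivity)
  have a2 := formSet_ncard_le_latBall γ hX hδ (r := τ) (by positivity)
  rw [e1, e2] at a2
  rw [one_mul, one_mul] at a1
  have hL := Nat.le_ceil (K * τ)
  have hL2 := (Nat.ceil_lt_add_one (a := K * τ) (by positivity)).le
  have hKτ : 1 ≤ K * τ := by nlinarith
  have b := latBall_card_mul_le _ fin (r := 1) (s := ((2 : ℕ) : ℝ) * (1 / K)) (t := τ) ⌈K * τ⌉₊
    (by rw [Nat.ceil_pos]; linarith) (by positivity)
    (by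
      have : (2:ℝ) * τ = (K * τ) * (2 * (1 / K)) := by field_simp
      rw [this]; push_cast; gcongr)
  have c1 := latBall_scale_card_le _ fin (r := 1 / K) (by positivity) 2
  have c2 := latBall_ncard_le_formSet γ hX hδ (r := 1 / K) (by positivity)
    (by rw [one_div_mul_eq_div, div_le_one hK0]; linarith)
  have c3 : (latBall (formLat γ X δ) (⌈K * τ⌉₊ * 1 + τ)).ncard ≤
      (latBall (formLat γ X δ) ((3 : ℕ) * (K * τ))).ncard := by
    apply Set.ncard_le_ncard (latBall_mono _ _) (fin _)
    push_cast
    nlinarith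
  have c4 := latBall_scale_card_le _ fin (r := K * τ) (by positivity) 3
  have e3 : K * τ * X = K / δ := by rw [mul_assoc, e1]; ring
  have e4 : K * τ * δ = K / X := by rw [mul_assoc, e2]; ring
  have c5 := latBall_ncard_le_formSet γ hX hδ (r := K * τ) (by positivity)
    (by rw [e4, div_le_one hX]; exact hKX)
  rw [e3, e4] at c5
  rw [one_div_mul_eq_div, one_div_mul_eq_div] at c2
  simp only [Fintype.card_sum, Fintype.card_fin, ← two_mul] at c1 c4
  calc _ ≤ _ := Nat.mul_le_mul a1 a2
    _ ≤ _ := b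
    _ ≤ (5 ^ (2 * n) * (3 ^ n * (formSet γ (X / K) (δ / K)).ncard)) *
        (7 ^ (2 * n) * (3 ^ n * (formSet γ (K / δ) (K / X)).ncard)) :=
      Nat.mul_le_mul (c1.trans (Nat.mul_le_mul_left _ c2))
        (c3.trans (c4.trans (Nat.mul_le_mul_left _ c5)))
    _ = _ := by ring

end FormCount

/-- A nonnegative kernel concentrated where `θ` is within `1 / M` of an integer. -/
def kap (M θ : ℝ) : ℝ := 1 / (1 + M ^ 2 * nint θ ^ 2)

theorem kap_nonneg (M θ : ℝ) : 0 ≤ kap M θ := by unfold kap; positivity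

theorem kap_anti {M M' : ℝ} (h0 : 0 ≤ M) (h : M ≤ M') (θ : ℝ) : kap M' θ ≤ kap M θ := by
  unfold kap
  gcongr

theorem nint_eq_min (x : ℝ) : nint x = min (Int.fract x) (1 - Int.fract x) :=
  abs_sub_round_eq_min x

theorem sum_range_inv_le (M : ℕ) : ∑ k ∈ Finset.range M, 1 / (1 + (k : ℝ) ^ 2) ≤ 3 := by
  have key : ∀ M : ℕ, ∑ k ∈ Finset.range (M + 1), 1 / (1 + (k : ℝ) ^ 2) ≤ 3 - 2 / ((M : ℝ) + 1) := by
    intro M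
    induction M with
    | zero => norm_num
    | succ M ih =>
      rw [Finset.sum_range_succ]
      have h : 1 / (1 + ((M + 1 : ℕ) : ℝ) ^ 2) ≤ 2 / ((M : ℝ) + 1) - 2 / ((M : ℝ) + 1 + 1) := by
        rw [div_sub_div _ _ (by positivity) (by positivity), div_le_div_iff₀ (by positivity) (by positivity)]
        push_cast
        nlinarith [(Nat.cast_nonneg M : (0:ℝ) ≤ M)]
      push_cast at h ⊢
      linarith
  rcases M with _ | M
  · norm_num
  · refine (key M).trans ?_
    have : 0 ≤ 2 / ((M : ℝ) + 1) := by positivity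
    linarith

theorem kap_le_of_floor {M : ℕ} (hM : 0 < M) {θ : ℝ} {k : ℕ} (hk : k < M)
    (h : ⌊(M : ℝ) * Int.fract θ⌋₊ = k) :
    kap M θ ≤ 1 / (1 + (k : ℝ) ^ 2) + 1 / (1 + ((M - 1 - k : ℕ) : ℝ) ^ 2) := by
  have hM' : (0 : ℝ) < M := by exact_mod_cast hM
  have hf := Int.fract_nonneg θ
  have h1 : (k : ℝ) ≤ M * Int.fract θ := by
    rw [← h]; exact Nat.floor_le (by positivity)
  have h2 : (M : ℝ) * Int.fract θ < k + 1 := by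
    rw [← h]; exact Nat.lt_floor_add_one _
  have h3 : ((M - 1 - k : ℕ) : ℝ) ≤ M * (1 - Int.fract θ) := by
    rw [Nat.cast_sub (by omega), Nat.cast_sub (by omega)]
    push_cast; linarith
  unfold kap
  rw [nint_eq_min, ← mul_pow]
  rcases min_choice (Int.fract θ) (1 - Int.fract θ) with h4 | h4 <;> rw [h4]
  · have : 1 / (1 + ((M : ℝ) * Int.fract θ) ^ 2) ≤ 1 / (1 + (k : ℝ) ^ 2) := by gcongr
    have : 0 ≤ 1 / (1 + ((M - 1 - k : ℕ) : ℝ) ^ 2) := by positivity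
    linarith
  · have : 1 / (1 + ((M : ℝ) * (1 - Int.fract θ)) ^ 2) ≤ 1 / (1 + ((M - 1 - k : ℕ) : ℝ) ^ 2) := by
      gcongr
    have : 0 ≤ 1 / (1 + (k : ℝ) ^ 2) := by positivity
    linarith

theorem nint_sub_le_of_floor {M : ℕ} (hM : 0 < M) {θ θ' : ℝ}
    (h : ⌊(M : ℝ) * Int.fract θ⌋₊ = ⌊(M : ℝ) * Int.fract θ'⌋₊) : nint (θ - θ') ≤ 1 / M := by
  have hM' : (0 : ℝ) < M := by exact_mod_cast hM
  have hf := Int.fract_nonneg θ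
  have hf' := Int.fract_nonneg θ'
  have a1 := Nat.floor_le (mul_nonneg hM'.le hf)
  have a2 := Nat.lt_floor_add_one ((M : ℝ) * Int.fract θ)
  have b1 := Nat.floor_le (mul_nonneg hM'.le hf')
  have b2 := Nat.lt_floor_add_one ((M : ℝ) * Int.fract θ')
  rw [h] at a1 a2
  refine (nint_le_abs_sub _ (⌊θ⌋ - ⌊θ'⌋)).trans ?_
  have e : θ - θ' - ((⌊θ⌋ - ⌊θ'⌋ : ℤ) : ℝ) = Int.fract θ - Int.fract θ' := by
    simp only [Int.fract]; push_cast; ring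
  rw [e, abs_le, le_div_iff₀ hM', ← neg_div, div_le_iff₀ hM']
  constructor <;> nlinarith

theorem kap_sum_le {α : Type*} {n : ℕ} (E : Finset α) (θ : α → Fin n → ℝ) {M : ℕ} (hM : 0 < M)
    (b : ℕ) (hb : ∀ e₀ ∈ E, (E.filter fun e => ∀ j, nint (θ e j - θ e₀ j) ≤ 1 / M).card ≤ b) :
    ∑ e ∈ E, ∏ j, kap M (θ e j) ≤ 6 ^ n * b := by
  set cell : α → Fin n → ℕ := fun e j => ⌊(M : ℝ) * Int.fract (θ e j)⌋₊ with hcell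
  set T : Finset (Fin n → ℕ) := Fintype.piFinset fun _ => Finset.range M with hT
  set w : ℕ → ℝ := fun k => 1 / (1 + (k : ℝ) ^ 2) + 1 / (1 + ((M - 1 - k : ℕ) : ℝ) ^ 2) with hw
  have hw0 : ∀ k, 0 ≤ w k := fun k => by positivity
  have hlt : ∀ e j, cell e j < M := by
    intro e j
    have hM' : (0 : ℝ) < M := by exact_mod_cast hM
    rw [hcell]
    simp only
    rw [Nat.floor_lt (mul_nonneg hM'.le (Int.fract_nonneg _))]
    nlinarith [Int.fract_lt_one (θ e j)]
  have hmap : ∀ e ∈ E, cell e ∈ T := by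
    intro e _
    rw [hT, Fintype.mem_piFinset]
    exact fun j => Finset.mem_range.2 (hlt e j)
  rw [← Finset.sum_fiberwise_of_maps_to hmap]
  have hfib : ∀ k ∈ T, ∑ e ∈ E with cell e = k, ∏ j, kap M (θ e j) ≤ b * ∏ j, w (k j) := by
    intro k _
    have h1 : ∀ e ∈ E.filter (fun e => cell e = k), ∏ j, kap M (θ e j) ≤ ∏ j, w (k j) := by
      intro e he
      have he2 := (Finset.mem_filter.1 he).2
      apply Finset.prod_le_prod (fun _ _ => kap_nonneg _ _)
      intro j _
      rw [← he2]
      exact kap_le_of_floor hM (hlt e j) rfl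
    refine (Finset.sum_le_card_nsmul _ _ _ h1).trans ?_
    rw [nsmul_eq_mul]
    have hc : (E.filter (fun e => cell e = k)).card ≤ b := by
      rcases Finset.eq_empty_or_nonempty (E.filter (fun e => cell e = k)) with he | ⟨e₀, he₀⟩
      · rw [he]; simp
      rw [Finset.mem_filter] at he₀
      refine (Finset.card_le_card ?_).trans (hb e₀ he₀.1)
      intro e he
      rw [Finset.mem_filter] at he ⊢
      refine ⟨he.1, fun j => nint_sub_le_of_floor hM ?_⟩
      exact (congrFun he.2 j).trans (congrFun he₀.2 j).symm
    have : (0:ℝ) ≤ ∏ j, w (k j) := Finset.prod_nonneg fun _ _ => hw0 _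
    gcongr
  refine (Finset.sum_le_sum hfib).trans ?_
  rw [← Finset.mul_sum, hT, ← Finset.prod_univ_sum (fun _ => Finset.range M) (fun _ k => w k),
    Finset.prod_const, Finset.card_univ, Fintype.card_fin, mul_comm]
  have hs : ∑ k ∈ Finset.range M, w k ≤ 6 := by
    rw [hw, Finset.sum_add_distrib, Finset.sum_range_reflect (fun k => 1 / (1 + (k : ℝ) ^ 2)) M]
    linarith [sum_range_inv_le M]
  have : 0 ≤ ∑ k ∈ Finset.range M, w k := Finset.sum_nonneg fun _ _ => hw0 _
  gcongr

theorem eC_zero : eC 0 = 1 := by simp [eC]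

theorem eC_add (s t : ℝ) : eC (s + t) = eC s * eC t := by
  unfold eC; rw [← Complex.exp_add]; push_cast; ring_nf

theorem eC_sum {ι : Type*} (s : Finset ι) (t : ι → ℝ) :
    eC (∑ i ∈ s, t i) = ∏ i ∈ s, eC (t i) := by
  induction s using Finset.induction_on with
  | empty => simp [eC_zero]
  | insert a s ha ih => rw [Finset.sum_insert ha, Finset.prod_insert ha, eC_add, ih]

theorem eC_eq (t : ℝ) : eC t = Complex.exp (((2 * Real.pi * t : ℝ) : ℂ) * Complex.I) := by
  unfold eC; push_cast; ring_nf

theorem norm_eC (t : ℝ) : ‖eC t‖ = 1 := by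
  rw [eC_eq, Complex.norm_exp_ofReal_mul_I]

theorem eC_neg (t : ℝ) : eC (-t) = starRingEnd ℂ (eC t) := by
  rw [eC_eq, eC_eq, ← Complex.exp_conj, map_mul, Complex.conj_ofReal, Complex.conj_I]
  congr 1; push_cast; ring

theorem eC_int (m : ℤ) : eC m = 1 := by
  unfold eC
  rw [Complex.exp_eq_one_iff]
  exact ⟨m, by push_cast; ring⟩

theorem eC_re (t : ℝ) : (eC t).re = Real.cos (2 * Real.pi * t) := by
  rw [eC_eq, Complex.exp_ofReal_mul_I_re]

theorem eC_nat_mul (w : ℕ) (t : ℝ) : eC (w * t) = eC t ^ w := by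
  unfold eC; rw [← Complex.exp_nat_mul]; push_cast; ring_nf

theorem eC_sub_round (t : ℝ) : eC t = eC (t - round t) := by
  have := eC_add (t - round t) (round t : ℤ)
  rw [eC_int, mul_one, sub_add_cancel] at this
  exact this

theorem four_nint_le (t : ℝ) : 4 * nint t ≤ ‖eC t - 1‖ := by
  rw [eC_sub_round, eC_eq, mul_comm _ Complex.I, Complex.norm_exp_I_mul_ofReal_sub_one, Real.norm_eq_abs,
    abs_mul, abs_two]
  set s := t - round t with hs
  have h1 : |s| ≤ 1 / 2 := abs_sub_round t
  have h2 : nint t = |s| := rfl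
  rw [h2]
  have h3 : |Real.sin (2 * Real.pi * s / 2)| = |Real.sin (Real.pi * |s|)| := by
    rcases abs_choice s with h | h <;> rw [h]
    · congr 2; ring
    · rw [mul_neg, Real.sin_neg, abs_neg]; congr 2; ring
  rw [h3]
  have hpi := Real.pi_pos
  have h4 := Real.mul_le_sin (x := Real.pi * |s|) (by positivity) (by nlinarith)
  have h5 : 2 / Real.pi * (Real.pi * |s|) = 2 * |s| := by field_simp
  have := le_abs_self (Real.sin (Real.pi * |s|))
  linarith

/-- The squared modulus of a geometric exponential sum of length `Q`. -/
def dirK (Q : ℕ) (θ : ℝ) : ℝ := ‖∑ w ∈ Finset.range Q, eC (w * θ)‖ ^ 2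

theorem dirK_nonneg (Q : ℕ) (θ : ℝ) : 0 ≤ dirK Q θ := by unfold dirK; positivity

theorem dirK_le (M : ℕ) (θ : ℝ) : dirK M θ ≤ 2 * (M : ℝ) ^ 2 * kap M θ := by
  unfold dirK kap
  set S := ‖∑ w ∈ Finset.range M, eC (w * θ)‖ with hS
  have h0 : 0 ≤ S := norm_nonneg _
  have h1 : S ≤ M := by
    refine (norm_sum_le _ _).trans ?_
    simp [norm_eC]
  have h2 : S * (4 * nint θ) ≤ 2 := by
    have h3 : S * ‖eC θ - 1‖ ≤ 2 := by
      rw [hS, ← norm_mul]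
      simp only [eC_nat_mul]
      rw [geom_sum_mul, ← eC_nat_mul]
      refine (norm_sub_le _ _).trans ?_
      rw [norm_eC, norm_one]; norm_num
    exact (mul_le_mul_of_nonneg_left (four_nint_le θ) h0).trans h3
  have h4 := nint_nonneg θ
  rw [mul_one_div, le_div_iff₀ (by positivity)]
  have h5 : (S * nint θ) ^ 2 ≤ (1 / 2) ^ 2 := by
    apply pow_le_pow_left₀ (by positivity); linarith
  have h6 : S ^ 2 ≤ (M : ℝ) ^ 2 := by gcongr
  have h7 : (0:ℝ) ≤ (M : ℝ) ^ 2 := by positivity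
  nlinarith

theorem le_dirK {Q : ℕ} {θ : ℝ} (hQ : 0 < Q) (h : nint θ ≤ 1 / (8 * Q)) :
    (Q : ℝ) ^ 2 / 4 ≤ dirK Q θ := by
  have hQ' : (0 : ℝ) < Q := by exact_mod_cast hQ
  unfold dirK
  have h1 : (Q : ℝ) / 2 ≤ ‖∑ w ∈ Finset.range Q, eC (w * θ)‖ := by
    refine le_trans ?_ (Complex.re_le_norm _)
    rw [Complex.re_sum]
    have : (Q : ℝ) / 2 = ∑ w ∈ Finset.range Q, (1 / 2 : ℝ) := by simp; ring
    rw [this]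
    apply Finset.sum_le_sum
    intro w hw
    have hwQ : (w : ℝ) ≤ Q := by exact_mod_cast (Finset.mem_range.1 hw).le
    rw [eC_nat_mul, eC_sub_round, ← eC_nat_mul, eC_re]
    refine le_trans ?_ (Real.one_sub_sq_div_two_le_cos)
    have h2 : |2 * Real.pi * (w * (θ - round θ))| ≤ 1 := by
      have h3 : |θ - round θ| ≤ 1 / (8 * Q) := h
      rw [abs_mul (2 * Real.pi), abs_mul (w : ℝ), abs_of_pos (show (0:ℝ) < 2 * Real.pi by positivity),
        Nat.abs_cast]
      calc 2 * Real.pi * (w * |θ - round θ|) ≤ 2 * Real.pi * (Q * (1 / (8 * Q))) := by gcongr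
        _ = Real.pi / 4 := by field_simp; norm_num
        _ ≤ 1 := by linarith [Real.pi_le_four]
    have h4 : (2 * Real.pi * (w * (θ - round θ))) ^ 2 ≤ 1 := by
      rw [← sq_abs]; exact pow_le_one₀ (abs_nonneg _) h2
    linarith
  calc (Q : ℝ) ^ 2 / 4 = (Q / 2) ^ 2 := by ring
    _ ≤ _ := by gcongr

section Duality

variable {n : ℕ}

/-- The box `[0, M)ⁿ`. -/
def natBox (n M : ℕ) : Finset (Fin n → ℕ) := Fintype.piFinset fun _ => Finset.range M

theorem prod_dirK (Q : ℕ) (θ : Fin n → ℝ) :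
    ((∏ j, dirK Q (θ j) : ℝ) : ℂ) =
      ∑ w ∈ natBox n Q, ∑ w' ∈ natBox n Q, eC (∑ j, ((w j : ℝ) - w' j) * θ j) := by
  have h1 : ∏ j, ∑ w ∈ Finset.range Q, eC (w * θ j) =
      ∑ w ∈ natBox n Q, eC (∑ j, (w j : ℝ) * θ j) := by
    rw [Finset.prod_univ_sum]
    exact Finset.sum_congr rfl fun w _ => (eC_sum _ _).symm
  have h2 : ((∏ j, dirK Q (θ j) : ℝ) : ℂ) =
      (∏ j, ∑ w ∈ Finset.range Q, eC (w * θ j)) *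
        starRingEnd ℂ (∏ j, ∑ w ∈ Finset.range Q, eC (w * θ j)) := by
    rw [Complex.mul_conj, Complex.normSq_eq_norm_sq, norm_prod, ← Finset.prod_pow]
    rfl
  rw [h2, h1, map_sum, Finset.sum_mul_sum]
  refine Finset.sum_congr rfl fun w _ => Finset.sum_congr rfl fun w' _ => ?_
  rw [← eC_neg, ← eC_add]
  congr 1
  rw [← sub_eq_add_neg, ← Finset.sum_sub_distrib]
  exact Finset.sum_congr rfl fun j _ => by ring

theorem sum_dirK_swap (γ : Fin n → Fin n → ℝ) (hγ : ∀ j k, γ j k = γ k j) (M Q : ℕ) :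
    ∑ u ∈ natBox n M, ∑ u' ∈ natBox n M, ∏ j, dirK Q (∑ k, γ j k * ((u k : ℝ) - u' k)) =
      ∑ w ∈ natBox n Q, ∑ w' ∈ natBox n Q, ∏ j, dirK M (∑ k, γ j k * ((w k : ℝ) - w' k)) := by
  have h : ((∑ u ∈ natBox n M, ∑ u' ∈ natBox n M,
        ∏ j, dirK Q (∑ k, γ j k * ((u k : ℝ) - u' k)) : ℝ) : ℂ) =
      ((∑ w ∈ natBox n Q, ∑ w' ∈ natBox n Q,
        ∏ j, dirK M (∑ k, γ j k * ((w k : ℝ) - w' k)) : ℝ) : ℂ) := by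
    simp only [Complex.ofReal_sum, prod_dirK]
    have e : ∀ (u u' w w' : Fin n → ℕ),
        ∑ j, ((w j : ℝ) - w' j) * ∑ k, γ j k * ((u k : ℝ) - u' k) =
        ∑ j, ((u j : ℝ) - u' j) * ∑ k, γ j k * ((w k : ℝ) - w' k) := by
      intro u u' w w'
      simp only [Finset.mul_sum]
      rw [Finset.sum_comm]
      refine Finset.sum_congr rfl fun k _ => Finset.sum_congr rfl fun j _ => ?_
      rw [hγ j k]; ring
    have key : ∀ G : (Fin n → ℕ) → (Fin n → ℕ) → (Fin n → ℕ) → (Fin n → ℕ) → ℂ,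
        ∑ u ∈ natBox n M, ∑ u' ∈ natBox n M, ∑ w ∈ natBox n Q, ∑ w' ∈ natBox n Q, G u u' w w' =
        ∑ w ∈ natBox n Q, ∑ w' ∈ natBox n Q, ∑ u ∈ natBox n M, ∑ u' ∈ natBox n M, G u u' w w' := by
      intro G
      calc _ = ∑ u ∈ natBox n M, ∑ w ∈ natBox n Q, ∑ u' ∈ natBox n M, ∑ w' ∈ natBox n Q,
            G u u' w w' := Finset.sum_congr rfl fun _ _ => Finset.sum_comm
        _ = ∑ w ∈ natBox n Q, ∑ u ∈ natBox n M, ∑ u' ∈ natBox n M, ∑ w' ∈ natBox n Q,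
            G u u' w w' := Finset.sum_comm
        _ = ∑ w ∈ natBox n Q, ∑ u ∈ natBox n M, ∑ w' ∈ natBox n Q, ∑ u' ∈ natBox n M,
            G u u' w w' := Finset.sum_congr rfl fun _ _ => Finset.sum_congr rfl fun _ _ =>
              Finset.sum_comm
        _ = _ := Finset.sum_congr rfl fun _ _ => Finset.sum_comm
    refine (key _).trans ?_
    exact Finset.sum_congr rfl fun w _ => Finset.sum_congr rfl fun w' _ =>
      Finset.sum_congr rfl fun u _ => Finset.sum_congr rfl fun u' _ => congrArg eC (e u u' w w')
  exact_mod_cast h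

theorem formSet_pairs_le (γ : Fin n → Fin n → ℝ) (M : ℕ) (δ : ℝ) :
    (formSet γ (M / 2) δ).ncard * ((M + 1) / 2) ^ n ≤
      ((natBox n M ×ˢ natBox n M).filter fun p =>
        ∀ j, nint (∑ k, γ j k * ((p.1 k : ℝ) - p.2 k)) ≤ δ).card := by
  rw [Set.ncard_eq_toFinset_card _ (formSet_finite γ _ _)]
  have hT : (natBox n ((M + 1) / 2)).card = ((M + 1) / 2) ^ n := by
    simp [natBox]
  rw [← hT, ← Finset.card_product]
  apply Finset.card_le_card_of_injOn
    (fun p => ((fun i => p.2 i + (p.1 i).toNat, fun i => p.2 i + (-(p.1 i)).toNat)))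
  · rintro ⟨v, a⟩ hp
    simp only [Finset.coe_product, Set.mem_prod, Finset.mem_coe, Set.Finite.mem_toFinset, natBox,
      Fintype.mem_piFinset, Finset.mem_range] at hp
    obtain ⟨⟨hv, hδ⟩, ha⟩ := hp
    have hv' : ∀ i, 2 * |v i| ≤ M := by
      intro i
      have := hv i
      have h2 : 2 * |(v i : ℝ)| ≤ M := by linarith
      exact_mod_cast h2
    simp only [Finset.coe_filter, Set.mem_ofPred_eq, Finset.mem_product, natBox,
      Fintype.mem_piFinset, Finset.mem_range]
    refine ⟨⟨fun i => ?_, fun i => ?_⟩, fun j => ?_⟩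
    · have := hv' i; have := ha i
      have := neg_abs_le (v i); have := le_abs_self (v i)
      omega
    · have := hv' i; have := ha i
      have := neg_abs_le (v i); have := le_abs_self (v i)
      omega
    · convert hδ j using 4 with k
      have : ((a k + (v k).toNat : ℕ) : ℤ) - ((a k + (-v k).toNat : ℕ) : ℤ) = v k := by
        push_cast
        omega
      exact_mod_cast this
  · rintro ⟨v, a⟩ _ ⟨v', a'⟩ _ h
    simp only [Prod.mk.injEq] at h
    have h1 : ∀ i, a i + (v i).toNat = a' i + (v' i).toNat := fun i => congrFun h.1 i
    have h2 : ∀ i, a i + (-v i).toNat = a' i + (-v' i).toNat := fun i => congrFun h.2 i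
    ext i
    · show v i = v' i
      have := h1 i; have := h2 i; omega
    · show a i = a' i
      have := h1 i; have := h2 i; omega

theorem le_sum_dirK (γ : Fin n → Fin n → ℝ) {M Q : ℕ} (hQ : 0 < Q) : ((formSet γ (M / 2) (1 / (8 * Q))).ncard : ℝ) * ((M : ℝ) / 2) ^ n *
    ((Q : ℝ) ^ 2 / 4) ^ n ≤
    ∑ u ∈ natBox n M, ∑ u' ∈ natBox n M, ∏ j, dirK Q (∑ k, γ j k * ((u k : ℝ) - u' k)) := by
  rw [← Finset.sum_product']
  have h1 : ∀ p ∈ (natBox n M ×ˢ natBox n M).filter (fun p =>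
      ∀ j, nint (∑ k, γ j k * ((p.1 k : ℝ) - p.2 k)) ≤ 1 / (8 * Q)),
      ((Q : ℝ) ^ 2 / 4) ^ n ≤ ∏ j, dirK Q (∑ k, γ j k * ((p.1 k : ℝ) - p.2 k)) := by
    intro p hp
    have h2 := (Finset.mem_filter.1 hp).2
    have h3 : ((Q : ℝ) ^ 2 / 4) ^ n = ∏ _j : Fin n, ((Q : ℝ) ^ 2 / 4) := by
      rw [Finset.prod_const, Finset.card_univ, Fintype.card_fin]
    rw [h3]
    exact Finset.prod_le_prod (fun _ _ => by positivity) fun j _ => le_dirK hQ (h2 j)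
  have h4 := Finset.card_nsmul_le_sum _ _ _ h1
  rw [nsmul_eq_mul] at h4
  refine le_trans ?_ (h4.trans (Finset.sum_le_sum_of_subset_of_nonneg (Finset.filter_subset _ _)
    fun _ _ _ => Finset.prod_nonneg fun _ _ => dirK_nonneg _ _))
  have h5 := formSet_pairs_le γ M (1 / (8 * Q))
  have h6 : (M : ℝ) / 2 ≤ (((M + 1) / 2 : ℕ) : ℝ) := by
    rw [div_le_iff₀ two_pos]
    have : M ≤ (M + 1) / 2 * 2 := by omega
    exact_mod_cast this
  have h7 := (Nat.cast_le (α := ℝ)).2 h5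
  rw [Nat.cast_mul, Nat.cast_pow] at h7
  have h8 : ((formSet γ (M / 2) (1 / (8 * Q))).ncard : ℝ) * ((M : ℝ) / 2) ^ n ≤
    ((formSet γ (M / 2) (1 / (8 * Q))).ncard : ℝ) * (((M + 1) / 2 : ℕ) : ℝ) ^ n := by gcongr
  exact mul_le_mul_of_nonneg_right (h8.trans h7) (by positivity)

theorem sum_dirK_le (γ : Fin n → Fin n → ℝ) {M Q : ℕ} (hM : 0 < M) : ∑ w ∈ natBox n Q, ∑ w' ∈ natBox n Q,
    ∏ j, dirK M (∑ k, γ j k * ((w k : ℝ) - w' k)) ≤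
    (Q : ℝ) ^ n * ((2 * (M : ℝ) ^ 2) ^ n * (6 ^ n * (formSet γ Q (1 / M)).ncard)) := by
  rw [Finset.sum_comm]
  have h1 : ∀ w' ∈ natBox n Q,
      ∑ w ∈ natBox n Q, ∏ j, dirK M (∑ k, γ j k * ((w k : ℝ) - w' k)) ≤
      (2 * (M : ℝ) ^ 2) ^ n * (6 ^ n * (formSet γ Q (1 / M)).ncard) := by
    intro w' _
    have h2 : ∀ w ∈ natBox n Q, ∏ j, dirK M (∑ k, γ j k * ((w k : ℝ) - w' k)) ≤
        (2 * (M : ℝ) ^ 2) ^ n * ∏ j, kap M (∑ k, γ j k * ((w k : ℝ) - w' k)) := by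
      intro w _
      have h3 : (2 * (M : ℝ) ^ 2) ^ n = ∏ _j : Fin n, (2 * (M : ℝ) ^ 2) := by
        rw [Finset.prod_const, Finset.card_univ, Fintype.card_fin]
      rw [h3, ← Finset.prod_mul_distrib]
      exact Finset.prod_le_prod (fun _ _ => dirK_nonneg _ _) fun j _ => dirK_le _ _
    refine (Finset.sum_le_sum h2).trans ?_
    rw [← Finset.mul_sum]
    have hb : ∀ w₀ ∈ natBox n Q, ((natBox n Q).filter fun w => ∀ j,
        nint ((∑ k, γ j k * ((w k : ℝ) - w' k)) - ∑ k, γ j k * ((w₀ k : ℝ) - w' k)) ≤ 1 / M).card ≤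
        (formSet γ Q (1 / M)).ncard := by
      intro w₀ hw₀
      rw [Set.ncard_eq_toFinset_card _ (formSet_finite γ _ _)]
      apply Finset.card_le_card_of_injOn (fun w k => (w k : ℤ) - w₀ k)
      · intro w hw
        simp only [Finset.coe_filter, Set.mem_ofPred_eq, natBox, Fintype.mem_piFinset,
          Finset.mem_range] at hw hw₀
        simp only [Set.Finite.coe_toFinset]
        refine ⟨fun i => ?_, fun j => ?_⟩
        · have := hw.1 i; have := hw₀ i
          have h5 : |(w i : ℤ) - w₀ i| ≤ Q := by rw [abs_le]; omega
          exact_mod_cast h5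
        · convert hw.2 j using 2
          rw [← Finset.sum_sub_distrib]
          refine Finset.sum_congr rfl fun k _ => ?_
          push_cast; ring
      · intro w _ w'' _ h
        ext k
        have := congrFun h k
        simp only at this
        omega
    have h4 := kap_sum_le (natBox n Q) (fun w j => ∑ k, γ j k * ((w k : ℝ) - w' k)) hM _ hb
    exact mul_le_mul_of_nonneg_left h4 (by positivity)
  refine (Finset.sum_le_card_nsmul _ _ _ h1).trans ?_
  rw [nsmul_eq_mul]
  simp [natBox]

theorem formSet_dual_nat (γ : Fin n → Fin n → ℝ) (hγ : ∀ j k, γ j k = γ k j) {M Q : ℕ}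
    (hM : 0 < M) (hQ : 0 < Q) :
    ((formSet γ (M / 2) (1 / (8 * Q))).ncard : ℝ) * (Q : ℝ) ^ n ≤
      96 ^ n * (M : ℝ) ^ n * (formSet γ Q (1 / M)).ncard := by
  have hM' : (0 : ℝ) < M := by exact_mod_cast hM
  have hQ' : (0 : ℝ) < Q := by exact_mod_cast hQ
  have lower := (sum_dirK_swap γ hγ M Q) ▸ le_sum_dirK γ (M := M) hQ
  have h := lower.trans (sum_dirK_le γ (Q := Q) hM)
  have e1 : ((formSet γ (M / 2) (1 / (8 * Q))).ncard : ℝ) * ((M : ℝ) / 2) ^ n *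
      ((Q : ℝ) ^ 2 / 4) ^ n = (((M : ℝ) * Q / 8) ^ n) *
        (((formSet γ (M / 2) (1 / (8 * Q))).ncard : ℝ) * (Q : ℝ) ^ n) := by
    have : ((M : ℝ) / 2) ^ n * ((Q : ℝ) ^ 2 / 4) ^ n = (((M : ℝ) * Q / 8) ^ n) * (Q : ℝ) ^ n := by
      rw [← mul_pow, ← mul_pow]; congr 1; ring
    linear_combination ((formSet γ (M / 2) (1 / (8 * Q))).ncard : ℝ) * this
  have e2 : (Q : ℝ) ^ n * ((2 * (M : ℝ) ^ 2) ^ n * (6 ^ n * (formSet γ Q (1 / M)).ncard)) =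
      (((M : ℝ) * Q / 8) ^ n) * (96 ^ n * (M : ℝ) ^ n * (formSet γ Q (1 / M)).ncard) := by
    have : (Q : ℝ) ^ n * (2 * (M : ℝ) ^ 2) ^ n * 6 ^ n = (((M : ℝ) * Q / 8) ^ n) * 96 ^ n *
        (M : ℝ) ^ n := by
      rw [← mul_pow, ← mul_pow, ← mul_pow, ← mul_pow]; congr 1; ring
    linear_combination ((formSet γ Q (1 / M)).ncard : ℝ) * this
  rw [e1, e2] at h
  exact le_of_mul_le_mul_left h (by positivity)

end Duality

section Shrink

variable {n : ℕ}

/-- The constant in the duality inequality `formSet_dual`. -/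
def dualConst (n : ℕ) : ℝ :=
  33 ^ (2 * n) * 3 ^ n * (96 ^ n * 2 ^ n) * (5 ^ (2 * n) * 3 ^ n)

theorem formSet_dual (γ : Fin n → Fin n → ℝ) (hγ : ∀ j k, γ j k = γ k j) {X Y : ℝ}
    (hX : 1 ≤ X) (hY : 1 ≤ Y) :
    ((formSet γ X (1 / Y)).ncard : ℝ) * Y ^ n ≤
      dualConst n * X ^ n * (formSet γ Y (1 / X)).ncard := by
  have hX0 : 0 < X := by linarith
  have hY0 : 0 < Y := by linarith
  set M := ⌈X⌉₊ with hM
  set Q := ⌈Y⌉₊ with hQ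
  have hM0 : 0 < M := Nat.ceil_pos.2 hX0
  have hQ0 : 0 < Q := Nat.ceil_pos.2 hY0
  have hM1 : X ≤ M := Nat.le_ceil X
  have hQ1 : Y ≤ Q := Nat.le_ceil Y
  have hM2 : (M : ℝ) ≤ 2 * X := by have := (Nat.ceil_lt_add_one hX0.le).le; linarith
  have hQ2 : (Q : ℝ) ≤ 2 * Y := by have := (Nat.ceil_lt_add_one hY0.le).le; linarith
  have hM0' : (0 : ℝ) < M := by exact_mod_cast hM0
  have hQ0' : (0 : ℝ) < Q := by exact_mod_cast hQ0
  have s1 := formSet_scale γ (X := X / 16) (δ := 1 / (16 * Y)) (by positivity) (by positivity)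
    (by rw [div_le_one (by positivity)]; linarith) 16
  have s2 : (formSet γ (X / 16) (1 / (16 * Y))).ncard ≤
      (formSet γ (M / 2) (1 / (8 * Q))).ncard := by
    apply formSet_ncard_mono
    · linarith
    · apply one_div_le_one_div_of_le (by positivity); linarith
  have s3 := formSet_dual_nat γ hγ hM0 hQ0
  have s4 : (formSet γ Q (1 / M)).ncard ≤ (formSet γ ((2 : ℕ) * Y) ((2 : ℕ) * (1 / X))).ncard := by
    apply formSet_ncard_mono
    · exact_mod_cast hQ2
    · have h1 : 1 / (M : ℝ) ≤ 1 / X := one_div_le_one_div_of_le hX0 hM1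
      have h2 : 0 ≤ 1 / X := by positivity
      push_cast; linarith
  have s5 := formSet_scale γ (X := Y) (δ := 1 / X) hY0 (by positivity)
    (by rw [div_le_one hX0]; exact hX) 2
  have e1 : ((16 : ℕ) : ℝ) * (X / 16) = X := by push_cast; ring
  have e2 : ((16 : ℕ) : ℝ) * (1 / (16 * Y)) = 1 / Y := by push_cast; field_simp
  rw [e1, e2] at s1
  have t1 : ((formSet γ X (1 / Y)).ncard : ℝ) ≤
      33 ^ (2 * n) * 3 ^ n * (formSet γ (M / 2) (1 / (8 * Q))).ncard := by
    have := s1.trans (Nat.mul_le_mul_left _ s2)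
    exact_mod_cast this
  have t2 : ((formSet γ Q (1 / M)).ncard : ℝ) ≤
      5 ^ (2 * n) * 3 ^ n * (formSet γ Y (1 / X)).ncard := by
    have := s4.trans s5
    exact_mod_cast this
  calc ((formSet γ X (1 / Y)).ncard : ℝ) * Y ^ n
      ≤ (33 ^ (2 * n) * 3 ^ n * (formSet γ (M / 2) (1 / (8 * Q))).ncard) * (Q : ℝ) ^ n := by gcongr
    _ = 33 ^ (2 * n) * 3 ^ n * ((formSet γ (M / 2) (1 / (8 * Q))).ncard * (Q : ℝ) ^ n) := by ring
    _ ≤ 33 ^ (2 * n) * 3 ^ n * (96 ^ n * (M : ℝ) ^ n * (formSet γ Q (1 / M)).ncard) := by gcongr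
    _ ≤ 33 ^ (2 * n) * 3 ^ n * (96 ^ n * (2 * X) ^ n *
          (5 ^ (2 * n) * 3 ^ n * (formSet γ Y (1 / X)).ncard)) := by gcongr
    _ = _ := by unfold dualConst; rw [mul_pow]; ring

/-- The constant in the shrinking inequality `formSet_shrink`. -/
def shrinkConst (n : ℕ) : ℝ :=
  dualConst n * ((5 ^ (2 * n) * 3 ^ n) * (7 ^ (2 * n) * 3 ^ n))

theorem dualConst_pos (n : ℕ) : 0 < dualConst n := by unfold dualConst; positivity

theorem shrinkConst_pos (n : ℕ) : 0 < shrinkConst n := by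
  have := dualConst_pos n
  unfold shrinkConst; positivity

/-- Davenport's shrinking lemma for symmetric systems of linear forms. -/
theorem formSet_shrink (γ : Fin n → Fin n → ℝ) (hγ : ∀ j k, γ j k = γ k j) {X δ K : ℝ}
    (hδ : 0 < δ) (hδ1 : δ ≤ 1) (hXδ : X * δ ≤ 1) (hK : 1 ≤ K) (hKX : K ≤ X) :
    ((formSet γ X δ).ncard : ℝ) ≤ shrinkConst n * K ^ n * (formSet γ (X / K) (δ / K)).ncard := by
  have hK0 : 0 < K := by linarith
  have hX0 : 0 < X := by linarith
  have r := formSet_ratio γ hX0 hδ hδ1 hXδ hK hKX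
  have d1 := formSet_dual γ hγ (X := X) (Y := 1 / δ) (hK.trans hKX)
    (by rw [le_div_iff₀ hδ]; linarith)
  have d2 := formSet_dual γ hγ (X := K / δ) (Y := X / K)
    (by rw [le_div_iff₀ hδ]; linarith) (by rw [le_div_iff₀ hK0]; linarith)
  rw [one_div_one_div] at d1
  rw [one_div_div, one_div_div] at d2
  set a : ℝ := ((formSet γ X δ).ncard : ℝ) with ha
  set b : ℝ := ((formSet γ (1 / δ) (1 / X)).ncard : ℝ) with hb
  set a' : ℝ := ((formSet γ (X / K) (δ / K)).ncard : ℝ) with ha'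
  set b' : ℝ := ((formSet γ (K / δ) (K / X)).ncard : ℝ) with hb'
  set c := ((5 ^ (2 * n) * 3 ^ n) * (7 ^ (2 * n) * 3 ^ n) : ℝ) with hc
  have hc1 : 1 ≤ c := by
    rw [hc]
    have h3 : (1 : ℝ) ≤ 3 ^ n := one_le_pow₀ (by norm_num)
    have h5 : (1 : ℝ) ≤ 5 ^ (2 * n) := one_le_pow₀ (by norm_num)
    have h7 : (1 : ℝ) ≤ 7 ^ (2 * n) := one_le_pow₀ (by norm_num)
    exact one_le_mul_of_one_le_of_one_le (one_le_mul_of_one_le_of_one_le h5 h3)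
      (one_le_mul_of_one_le_of_one_le h7 h3)
  have r' : a * b ≤ c * (a' * b') := by
    rw [ha, hb, ha', hb', hc]; exact_mod_cast r
  have hD := dualConst_pos n
  set D := dualConst n with hDdef
  have ha0 : 0 ≤ a := Nat.cast_nonneg _
  have ha0' : 0 ≤ a' := Nat.cast_nonneg _
  have hb0' : 0 ≤ b' := Nat.cast_nonneg _
  have key : a ^ 2 ≤ (D * c * K ^ n * a') ^ 2 := by
    have h1 : a ^ 2 * (1 / δ) ^ n * (X / K) ^ n ≤ D ^ 2 * c * X ^ n * (K / δ) ^ n * a' ^ 2 := by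
      calc a ^ 2 * (1 / δ) ^ n * (X / K) ^ n = a * (a * (1 / δ) ^ n) * (X / K) ^ n := by ring
        _ ≤ a * (D * X ^ n * b) * (X / K) ^ n := by gcongr
        _ = (a * b) * (D * X ^ n * (X / K) ^ n) := by ring
        _ ≤ (c * (a' * b')) * (D * X ^ n * (X / K) ^ n) := by gcongr
        _ = c * a' * D * X ^ n * (b' * (X / K) ^ n) := by ring
        _ ≤ c * a' * D * X ^ n * (D * (K / δ) ^ n * a') := by gcongr
        _ = _ := by ring
    have h2 : D ^ 2 * c * X ^ n * (K / δ) ^ n * a' ^ 2 =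
        ((1 / δ) ^ n * (X / K) ^ n) * (D ^ 2 * c * (K ^ n) ^ 2 * a' ^ 2) := by
      rw [div_pow, div_pow, div_pow, one_pow]; field_simp
    rw [h2, mul_assoc, mul_comm (a ^ 2)] at h1
    have h3 := le_of_mul_le_mul_left h1 (by positivity)
    refine h3.trans ?_
    have h4 : D ^ 2 * c * (K ^ n) ^ 2 * a' ^ 2 ≤ D ^ 2 * (c * c) * (K ^ n) ^ 2 * a' ^ 2 := by
      gcongr; nlinarith
    refine h4.trans (le_of_eq (by ring))
  have := abs_le_of_sq_le_sq key (by positivity)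
  exact (le_abs_self a).trans this
end Shrink

section DiscreteSmooth

variable {n : ℕ}

/-- The forward difference in the `i`-th coordinate, scaled by `P`. -/
def fdiff (P : ℝ) (i : Fin n) (F : (Fin n → ℤ) → ℝ) : (Fin n → ℤ) → ℝ :=
  fun x => P * (F (x + Pi.single i 1) - F x)

/-- All iterated scaled differences of `F` of order at most `M` are bounded by `C`. -/
def DiffBd (P : ℝ) : ℕ → ℝ → ((Fin n → ℤ) → ℝ) → Prop
  | 0, C, F => ∀ x, |F x| ≤ C
  | M + 1, C, F => (∀ x, |F x| ≤ C) ∧ ∀ i, DiffBd P M C (fdiff P i F)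

theorem DiffBd.abs_le {P : ℝ} {M : ℕ} {C : ℝ} {F : (Fin n → ℤ) → ℝ} (h : DiffBd P M C F)
    (x : Fin n → ℤ) : |F x| ≤ C := by
  cases M with
  | zero => exact h x
  | succ M => exact h.1 x

theorem DiffBd.mono_right {P : ℝ} {M : ℕ} {C C' : ℝ} {F : (Fin n → ℤ) → ℝ} (h : DiffBd P M C F)
    (hC : C ≤ C') : DiffBd P M C' F := by
  induction M generalizing F with
  | zero => exact fun x => (h x).trans hC
  | succ M ih => exact ⟨fun x => (h.1 x).trans hC, fun i => ih (h.2 i)⟩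

theorem DiffBd.of_succ {P : ℝ} {M : ℕ} {C : ℝ} {F : (Fin n → ℤ) → ℝ} (h : DiffBd P (M + 1) C F) :
    DiffBd P M C F := by
  induction M generalizing F with
  | zero => exact h.1
  | succ M ih => exact ⟨h.1, fun i => ih (h.2 i)⟩

theorem DiffBd.add {P : ℝ} {M : ℕ} {C C' : ℝ} {F G : (Fin n → ℤ) → ℝ} (hF : DiffBd P M C F)
    (hG : DiffBd P M C' G) : DiffBd P M (C + C') (F + G) := by
  induction M generalizing F G with
  | zero => exact fun x => (abs_add_le _ _).trans (add_le_add (hF x) (hG x))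
  | succ M ih =>
    refine ⟨fun x => (abs_add_le _ _).trans (add_le_add (hF.1 x) (hG.1 x)), fun i => ?_⟩
    have : fdiff P i (F + G) = fdiff P i F + fdiff P i G := by
      ext x; simp only [fdiff, Pi.add_apply]; ring
    rw [this]
    exact ih (hF.2 i) (hG.2 i)

theorem DiffBd.shift {P : ℝ} {M : ℕ} {C : ℝ} {F : (Fin n → ℤ) → ℝ} (hF : DiffBd P M C F)
    (h : Fin n → ℤ) : DiffBd P M C (fun x => F (x + h)) := by
  induction M generalizing F with
  | zero => exact fun x => hF _
  | succ M ih =>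
    refine ⟨fun x => hF.1 _, fun i => ?_⟩
    have : fdiff P i (fun x => F (x + h)) = fun x => fdiff P i F (x + h) := by
      ext x; simp only [fdiff]; rw [add_right_comm]
    rw [this]
    exact ih (hF.2 i)

theorem DiffBd.mul {P : ℝ} {M : ℕ} {C C' : ℝ} {F G : (Fin n → ℤ) → ℝ} (hF : DiffBd P M C F)
    (hG : DiffBd P M C' G) : DiffBd P M (2 ^ M * (C * C')) (F * G) := by
  have hC : 0 ≤ C := (abs_nonneg _).trans (hF.abs_le 0)
  have hC' : 0 ≤ C' := (abs_nonneg _).trans (hG.abs_le 0)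
  have bd : ∀ x, |(F * G) x| ≤ C * C' := fun x => by
    rw [Pi.mul_apply, abs_mul]
    exact mul_le_mul (hF.abs_le x) (hG.abs_le x) (abs_nonneg _) hC
  induction M generalizing F G with
  | zero => intro x; rw [pow_zero, one_mul]; exact bd x
  | succ M ih =>
    refine ⟨fun x => (bd x).trans (le_mul_of_one_le_left (by positivity)
      (one_le_pow₀ one_le_two)), fun i => ?_⟩
    have e : fdiff P i (F * G) = fdiff P i F * G + (fun x => F (x + Pi.single i 1)) * fdiff P i G := by
      ext x; simp only [fdiff, Pi.add_apply, Pi.mul_apply]; ring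
    have mulbd : ∀ {F' G' : (Fin n → ℤ) → ℝ}, DiffBd P M C F' → DiffBd P M C' G' →
        ∀ x, |(F' * G') x| ≤ C * C' := fun hF' hG' x => by
      rw [Pi.mul_apply, abs_mul]
      exact mul_le_mul (hF'.abs_le x) (hG'.abs_le x) (abs_nonneg _) hC
    have hs := (hF.shift (Pi.single i 1)).of_succ
    rw [e]
    have := (ih (hF.2 i) hG.of_succ (mulbd (hF.2 i) hG.of_succ)).add
      (ih hs (hG.2 i) (mulbd hs (hG.2 i)))
    refine this.mono_right (le_of_eq ?_)
    rw [pow_succ]; ring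

/-- The exponential sum with weight `F` and linear phase `θ`. -/
def linSum (F : (Fin n → ℤ) → ℝ) (θ : Fin n → ℝ) : ℂ :=
  ∑' x : Fin n → ℤ, (F x : ℂ) * eC (∑ j, θ j * x j)

/-- `F` vanishes outside `[-A, A]ⁿ`. -/
def BoxSupp (A : ℝ) (F : (Fin n → ℤ) → ℝ) : Prop := ∀ x, F x ≠ 0 → ∀ i, |(x i : ℝ)| ≤ A

theorem BoxSupp.fdiff {A : ℝ} {F : (Fin n → ℤ) → ℝ} (hF : BoxSupp A F) (P : ℝ) (i : Fin n) :
    BoxSupp (A + 1) (fdiff P i F) := by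
  intro x hx k
  by_cases h : F x = 0
  · have h2 : F (x + Pi.single i 1) ≠ 0 := by
      intro h2; exact hx (by simp [_root_.fdiff, h, h2])
    have h3 := hF _ h2 k
    rw [Pi.add_apply] at h3
    have h4 : |((Pi.single i 1 : Fin n → ℤ) k : ℝ)| ≤ 1 := by
      by_cases hk : k = i
      · subst hk; simp
      · simp [Pi.single_eq_of_ne hk]
    have h5 : (x k : ℝ) = ((x k + (Pi.single i 1 : Fin n → ℤ) k : ℤ) : ℝ) -
        ((Pi.single i 1 : Fin n → ℤ) k : ℝ) := by push_cast; ring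
    rw [h5]
    exact (abs_sub _ _).trans (add_le_add h3 h4)
  · exact (hF x h k).trans (by linarith)

/-- The integer points of `[-A, A]ⁿ`. -/
def intBox (n : ℕ) (A : ℝ) : Finset (Fin n → ℤ) := (finite_box (n := n) A).toFinset

theorem mem_intBox {A : ℝ} {x : Fin n → ℤ} : x ∈ intBox n A ↔ ∀ i, |(x i : ℝ)| ≤ A := by
  simp [intBox]

theorem intBox_card_le {A : ℝ} (hA : 0 ≤ A) : ((intBox n A).card : ℝ) ≤ (2 * A + 1) ^ n := by
  have h : intBox n A ⊆ Fintype.piFinset fun _ => Finset.Icc (-⌊A⌋) ⌊A⌋ := by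
    intro x hx
    rw [mem_intBox] at hx
    rw [Fintype.mem_piFinset]
    intro i
    have h := abs_le.1 (hx i)
    rw [Finset.mem_Icc]
    constructor
    · rw [neg_le, Int.le_floor]; push_cast; linarith
    · rw [Int.le_floor]; exact h.2
  have h1 := Finset.card_le_card h
  rw [Fintype.card_piFinset] at h1
  simp only [Int.card_Icc, Finset.prod_const, Finset.card_univ, Fintype.card_fin] at h1
  have h2 : ((⌊A⌋ + 1 - -⌊A⌋).toNat : ℝ) ≤ 2 * A + 1 := by
    have h0 : 0 ≤ ⌊A⌋ := Int.floor_nonneg.2 hA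
    have h3 : (((⌊A⌋ + 1 - -⌊A⌋).toNat : ℤ) : ℝ) = ((⌊A⌋ + 1 - -⌊A⌋ : ℤ) : ℝ) := by
      rw [Int.toNat_of_nonneg (by omega)]
    have h4 := Int.floor_le A
    push_cast at h3
    rw [h3]; linarith
  calc ((intBox n A).card : ℝ) ≤ ((⌊A⌋ + 1 - -⌊A⌋).toNat : ℝ) ^ n := by exact_mod_cast h1
    _ ≤ _ := by gcongr

theorem BoxSupp.summable {A : ℝ} {F : (Fin n → ℤ) → ℝ} (hF : BoxSupp A F)
    (g : (Fin n → ℤ) → ℂ) : Summable fun x => (F x : ℂ) * g x := by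
  apply summable_of_ne_finset_zero (s := intBox n A)
  intro x hx
  by_contra h
  apply hx
  rw [mem_intBox]
  apply hF
  intro h0
  exact h (by simp [h0])

theorem BoxSupp.tsum_eq {A : ℝ} {F : (Fin n → ℤ) → ℝ} (hF : BoxSupp A F)
    (g : (Fin n → ℤ) → ℂ) : ∑' x, (F x : ℂ) * g x = ∑ x ∈ intBox n A, (F x : ℂ) * g x := by
  apply tsum_eq_sum
  intro x hx
  by_contra h
  apply hx
  rw [mem_intBox]
  apply hF
  intro h0
  exact h (by simp [h0])

theorem norm_tsum_mul_eC_le {A C : ℝ} (hA : 0 ≤ A) {F : (Fin n → ℤ) → ℝ} (hF : BoxSupp A F)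
    (hC : ∀ x, |F x| ≤ C) (ψ : (Fin n → ℤ) → ℝ) :
    ‖∑' x, (F x : ℂ) * eC (ψ x)‖ ≤ C * (2 * A + 1) ^ n := by
  have hC0 : 0 ≤ C := (abs_nonneg _).trans (hC 0)
  rw [hF.tsum_eq]
  refine (norm_sum_le _ _).trans ?_
  have : ∀ x ∈ intBox n A, ‖(F x : ℂ) * eC (ψ x)‖ ≤ C := by
    intro x _
    rw [norm_mul, norm_eC, mul_one, Complex.norm_real]
    exact hC x
  refine (Finset.sum_le_card_nsmul _ _ _ this).trans ?_
  rw [nsmul_eq_mul, mul_comm]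
  exact mul_le_mul_of_nonneg_left (intBox_card_le hA) hC0

theorem norm_linSum_le {A C : ℝ} (hA : 0 ≤ A) {F : (Fin n → ℤ) → ℝ} (hF : BoxSupp A F)
    (hC : ∀ x, |F x| ≤ C) (θ : Fin n → ℝ) : ‖linSum F θ‖ ≤ C * (2 * A + 1) ^ n :=
  norm_tsum_mul_eC_le hA hF hC fun x => ∑ j, θ j * x j

theorem linSum_fdiff {A : ℝ} {F : (Fin n → ℤ) → ℝ} (hF : BoxSupp A F) (P : ℝ) (i : Fin n)
    (θ : Fin n → ℝ) : linSum (fdiff P i F) θ = P * (eC (-θ i) - 1) * linSum F θ := by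
  have h1 : eC (-θ i) * linSum F θ =
      ∑' x : Fin n → ℤ, (F (x + Pi.single i 1) : ℂ) * eC (∑ j, θ j * x j) := by
    unfold linSum
    rw [← (Equiv.addRight (Pi.single i (1 : ℤ))).tsum_eq, ← tsum_mul_left]
    congr 1
    ext x
    rw [mul_left_comm, ← eC_add]
    congr 2
    simp only [Equiv.coe_addRight, Pi.add_apply, Int.cast_add, mul_add, Finset.sum_add_distrib]
    have : ∑ j, θ j * (((Pi.single i (1 : ℤ) : Fin n → ℤ) j : ℤ) : ℝ) = θ i := by
      rw [Finset.sum_eq_single i]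
      · simp
      · intro j _ hj; simp [Pi.single_eq_of_ne hj]
      · simp
    rw [this]; ring
  have hs : Summable fun x : Fin n → ℤ => (F (x + Pi.single i 1) : ℂ) * eC (∑ j, θ j * x j) := by
    have hF' : BoxSupp (A + 1) (fun x : Fin n → ℤ => F (x + Pi.single i 1)) := by
      intro x hx
      by_cases h0 : F x = 0
      · refine hF.fdiff 1 i x ?_
        simp [fdiff, h0]; exact hx
      · intro k; exact (hF x h0 k).trans (by linarith)
    exact hF'.summable _
  rw [mul_assoc, sub_mul, one_mul, h1]
  unfold linSum
  rw [← hs.tsum_sub (hF.summable _), ← tsum_mul_left]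
  congr 1
  ext x
  simp only [fdiff]
  push_cast; ring

theorem prod_mul_norm_linSum_le {P C : ℝ} (hP : 0 ≤ P) (θ : Fin n → ℝ) (I : Finset (Fin n)) :
    ∀ {A : ℝ}, 0 ≤ A → ∀ {F : (Fin n → ℤ) → ℝ}, BoxSupp A F → DiffBd P (2 * I.card) C F →
    (∏ j ∈ I, (1 + P ^ 2 * nint (θ j) ^ 2)) * ‖linSum F θ‖ ≤
      2 ^ I.card * (C * (2 * (A + 2 * I.card) + 1) ^ n) := by
  induction I using Finset.induction_on with
  | empty =>
    intro A hA F hF hD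
    simpa using norm_linSum_le hA hF hD.abs_le θ
  | insert a J ha ih =>
    intro A hA F hF hD
    rw [Finset.card_insert_of_notMem ha, Nat.mul_add] at hD
    rw [Finset.prod_insert ha, Finset.card_insert_of_notMem ha]
    have hC0 : 0 ≤ C := (abs_nonneg _).trans (hD.abs_le 0)
    have h1 := ih hA hF hD.of_succ.of_succ
    have h2 := ih (by linarith) ((hF.fdiff P a).fdiff P a) ((hD.2 a).2 a)
    rw [linSum_fdiff (hF.fdiff P a), linSum_fdiff hF] at h2
    have h3 : P ^ 2 * nint (θ a) ^ 2 * ‖linSum F θ‖ ≤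
        ‖(P : ℂ) * (eC (-θ a) - 1) * (P * (eC (-θ a) - 1) * linSum F θ)‖ := by
      rw [← mul_assoc, norm_mul]
      apply mul_le_mul_of_nonneg_right _ (norm_nonneg _)
      have h4 : ‖eC (-θ a) - 1‖ = ‖eC (θ a) - 1‖ := by
        rw [eC_neg, ← Complex.norm_conj, map_sub, Complex.conj_conj, map_one]
      rw [norm_mul, norm_mul, Complex.norm_real, h4, Real.norm_of_nonneg hP]
      have h5 := four_nint_le (θ a)
      have h6 := nint_nonneg (θ a)
      have h7 : nint (θ a) ≤ ‖eC (θ a) - 1‖ := by linarith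
      have h8 : nint (θ a) ^ 2 ≤ ‖eC (θ a) - 1‖ ^ 2 := by gcongr
      nlinarith [sq_nonneg P]
    have hprod : 0 ≤ ∏ j ∈ J, (1 + P ^ 2 * nint (θ j) ^ 2) :=
      Finset.prod_nonneg fun _ _ => by positivity
    have h9 := (mul_le_mul_of_nonneg_left h3 hprod).trans h2
    have h10 : C * (2 * (A + 2 * J.card) + 1) ^ n ≤
        C * (2 * (A + 2 * (J.card + 1 : ℕ)) + 1) ^ n := by
      gcongr; linarith
    have h11 : C * (2 * (A + 1 + 1 + 2 * J.card) + 1) ^ n =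
        C * (2 * (A + 2 * (J.card + 1 : ℕ)) + 1) ^ n := by
      push_cast; ring_nf
    rw [h11] at h9
    have h12 : (2 : ℝ) ^ J.card * (C * (2 * (A + 2 * J.card) + 1) ^ n) ≤
      2 ^ J.card * (C * (2 * (A + 2 * (J.card + 1 : ℕ)) + 1) ^ n) := by gcongr
    rw [pow_succ (2 : ℝ) J.card]
    linarith

theorem norm_linSum_le_kap {P C A : ℝ} (hP : 0 ≤ P) (hA : 0 ≤ A) {F : (Fin n → ℤ) → ℝ}
    (hF : BoxSupp A F) (hD : DiffBd P (2 * n) C F) (θ : Fin n → ℝ) :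
    ‖linSum F θ‖ ≤ 2 ^ n * (C * (2 * (A + 2 * n) + 1) ^ n) * ∏ j, kap P (θ j) := by
  have h := prod_mul_norm_linSum_le hP θ Finset.univ hA hF
    (by rwa [Finset.card_univ, Fintype.card_fin])
  rw [Finset.card_univ, Fintype.card_fin] at h
  have h1 : (∏ j, kap P (θ j)) * ∏ j, (1 + P ^ 2 * nint (θ j) ^ 2) = 1 := by
    rw [← Finset.prod_mul_distrib]
    apply Finset.prod_eq_one
    intro j _
    unfold kap
    rw [one_div, inv_mul_cancel₀ (by positivity)]
  calc ‖linSum F θ‖ = (∏ j, kap P (θ j)) *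
        ((∏ j, (1 + P ^ 2 * nint (θ j) ^ 2)) * ‖linSum F θ‖) := by rw [← mul_assoc, h1, one_mul]
    _ ≤ (∏ j, kap P (θ j)) * (2 ^ n * (C * (2 * (A + 2 * n) + 1) ^ n)) :=
      mul_le_mul_of_nonneg_left h (Finset.prod_nonneg fun _ _ => kap_nonneg _ _)
    _ = _ := mul_comm _ _

end DiscreteSmooth

section SmoothWeights

variable {n : ℕ}

/-- The `i`-th partial derivative. -/
def pder (i : Fin n) (u : (Fin n → ℝ) → ℝ) : (Fin n → ℝ) → ℝ :=
  fun x => fderiv ℝ u x (Pi.single i 1)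

theorem contDiff_pder {u : (Fin n → ℝ) → ℝ} (hu : ContDiff ℝ (⊤ : ℕ∞) u) (i : Fin n) :
    ContDiff ℝ (⊤ : ℕ∞) (pder i u) :=
  (hu.fderiv_right (m := (⊤ : ℕ∞)) le_rfl).clm_apply contDiff_const

theorem pder_comm {u : (Fin n → ℝ) → ℝ} (hu : ContDiff ℝ (⊤ : ℕ∞) u) (i j : Fin n) :
    pder i (pder j u) = pder j (pder i u) := by
  ext x
  have h2 : DifferentiableAt ℝ (fderiv ℝ u) x :=
    (hu.fderiv_right (m := (⊤ : ℕ∞)) le_rfl).differentiable (by simp) x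
  have hs : IsSymmSndFDerivAt ℝ u x := by
    apply hu.contDiffAt.isSymmSndFDerivAt
    rw [minSmoothness_of_isRCLikeNormedField]
    exact WithTop.coe_le_coe.2 (le_top (a := (2 : ℕ∞)))
  have e : ∀ v w : Fin n → ℝ, fderiv ℝ (fun y => fderiv ℝ u y v) x w =
      fderiv ℝ (fderiv ℝ u) x w v := by
    intro v w
    rw [fderiv_clm_apply h2 (differentiableAt_const v)]
    simp
  show fderiv ℝ (fun y => fderiv ℝ u y (Pi.single j 1)) x (Pi.single i 1) =
    fderiv ℝ (fun y => fderiv ℝ u y (Pi.single i 1)) x (Pi.single j 1)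
  rw [e, e]
  exact hs _ _

theorem contDiff_iterate_pder {u : (Fin n → ℝ) → ℝ} (hu : ContDiff ℝ (⊤ : ℕ∞) u) (i : Fin n)
    (k : ℕ) : ContDiff ℝ (⊤ : ℕ∞) ((pder i)^[k] u) := by
  induction k with
  | zero => exact hu
  | succ k ih => rw [Function.iterate_succ_apply']; exact contDiff_pder ih i

theorem pder_iterate_comm {u : (Fin n → ℝ) → ℝ} (hu : ContDiff ℝ (⊤ : ℕ∞) u) (i j : Fin n)
    (k : ℕ) : pder i ((pder j)^[k] u) = (pder j)^[k] (pder i u) := by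
  induction k with
  | zero => rfl
  | succ k ih =>
    rw [Function.iterate_succ_apply', pder_comm (contDiff_iterate_pder hu j k), ih,
      ← Function.iterate_succ_apply' (pder j)]

/-- Mixed partial derivatives along a list of coordinates. -/
def listDer (l : List (Fin n)) (ε : Fin n → ℕ) (u : (Fin n → ℝ) → ℝ) : (Fin n → ℝ) → ℝ :=
  l.foldr (fun i h => (pder i)^[ε i] h) u

theorem contDiff_listDer {u : (Fin n → ℝ) → ℝ} (hu : ContDiff ℝ (⊤ : ℕ∞) u) (l : List (Fin n))
    (ε : Fin n → ℕ) : ContDiff ℝ (⊤ : ℕ∞) (listDer l ε u) := by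
  induction l with
  | nil => exact hu
  | cons a t ih => exact contDiff_iterate_pder ih a _

theorem listDer_congr (l : List (Fin n)) {ε ε' : Fin n → ℕ} (h : ∀ i ∈ l, ε i = ε' i)
    (u : (Fin n → ℝ) → ℝ) : listDer l ε u = listDer l ε' u := by
  induction l with
  | nil => rfl
  | cons a t ih =>
    show (pder a)^[ε a] (listDer t ε u) = (pder a)^[ε' a] (listDer t ε' u)
    rw [h a List.mem_cons_self, ih fun i hi => h i (List.mem_cons_of_mem _ hi)]

theorem pder_listDer {u : (Fin n → ℝ) → ℝ} (hu : ContDiff ℝ (⊤ : ℕ∞) u) (l : List (Fin n))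
    (hl : l.Nodup) (ε : Fin n → ℕ) (i : Fin n) (hi : i ∈ l) :
    pder i (listDer l ε u) = listDer l (ε + Pi.single i 1) u := by
  induction l with
  | nil => simp at hi
  | cons a t ih =>
    show pder i ((pder a)^[ε a] (listDer t ε u)) =
      (pder a)^[(ε + Pi.single i 1 : Fin n → ℕ) a] (listDer t (ε + Pi.single i 1) u)
    rw [List.nodup_cons] at hl
    by_cases h : a = i
    · subst h
      rw [listDer_congr t (ε' := ε + Pi.single a 1) (ε := ε)]
      · rw [← Function.iterate_succ_apply' (pder a)]
        simp
      · intro j hj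
        have : j ≠ a := fun e => hl.1 (e ▸ hj)
        simp [Pi.single_eq_of_ne this]
    · rw [pder_iterate_comm (contDiff_listDer hu _ _), ih hl.2]
      · simp [Pi.single_eq_of_ne h]
      · rcases List.mem_cons.1 hi with h1 | h1
        · exact absurd h1.symm h
        · exact h1

/-- All iterated partial derivatives of `g` of order at most `M` are bounded by `C`. -/
def DerBd : ℕ → ℝ → ((Fin n → ℝ) → ℝ) → Prop
  | 0, C, g => ∀ x, |g x| ≤ C
  | M + 1, C, g => (∀ x, |g x| ≤ C) ∧ ∀ i, DerBd M C (pder i g)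

theorem DerBd.abs_le {M : ℕ} {C : ℝ} {g : (Fin n → ℝ) → ℝ} (h : DerBd M C g)
    (x : Fin n → ℝ) : |g x| ≤ C := by
  cases M with
  | zero => exact h x
  | succ M => exact h.1 x

theorem derBd_listDer {c : ℝ} {cs : ℕ → ℝ} {ω : (Fin n → ℝ) → ℝ} (hc : SuperSeq c cs)
    (hω : SmoothWeight n c cs ω) (M : ℕ) (ε : Fin n → ℕ) (R : ℕ) (hR : ∑ i, ε i + M ≤ R) :
    DerBd M (cs R) (listDer (List.finRange n) ε ω) := by
  have bd : ∀ x, |listDer (List.finRange n) ε ω x| ≤ cs R := fun x =>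
    (hω.2.2.2 ε x).trans (hc.2.2.1 (by omega))
  induction M generalizing ε with
  | zero => exact bd
  | succ M ih =>
    refine ⟨bd, fun i => ?_⟩
    rw [pder_listDer hω.1 _ (List.nodup_finRange n) ε i (List.mem_finRange i)]
    have hsum : ∑ j, (ε + Pi.single i 1 : Fin n → ℕ) j = ∑ j, ε j + 1 := by
      simp [Finset.sum_add_distrib]
    exact ih _ (by omega) fun x => (hω.2.2.2 _ x).trans (hc.2.2.1 (by omega))

theorem DerBd.sub {P : ℝ} (hP : 0 < P) {M : ℕ} {C : ℝ} {g : (Fin n → ℝ) → ℝ}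
    (hg : ContDiff ℝ (⊤ : ℕ∞) g) (h : DerBd (M + 1) C g) (i : Fin n) :
    DerBd M C (fun x => P * (g (x + Pi.single i (1 / P)) - g x)) := by
  have bd : ∀ {u : (Fin n → ℝ) → ℝ}, ContDiff ℝ (⊤ : ℕ∞) u → (∀ x, |pder i u x| ≤ C) →
      ∀ x, |P * (u (x + Pi.single i (1 / P)) - u x)| ≤ C := by
    intro u hu hb x
    have hd : ∀ t : ℝ, HasDerivAt (fun t : ℝ => u (x + t • Pi.single i 1))
        (pder i u (x + t • Pi.single i 1)) t := by
      intro t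
      have h1 : HasDerivAt (fun t : ℝ => x + t • (Pi.single i 1 : Fin n → ℝ)) (Pi.single i 1) t := by
        simpa using ((hasDerivAt_id t).smul_const (Pi.single i (1 : ℝ) : Fin n → ℝ)).const_add x
      exact ((hu.differentiable (by simp) _).hasFDerivAt).comp_hasDerivAt t h1
    have h2 := Convex.norm_image_sub_le_of_norm_hasDerivWithin_le (s := Set.univ)
      (f := fun t : ℝ => u (x + t • Pi.single i 1)) (C := C) (x := 0) (y := 1 / P)
      (fun t _ => (hd t).hasDerivWithinAt) (fun t _ => hb _) convex_univ trivial trivial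
    have e1 : (1 / P) • (Pi.single i (1 : ℝ) : Fin n → ℝ) = Pi.single i (1 / P) := by
      rw [← Pi.single_smul, smul_eq_mul, mul_one]
    simp only [zero_smul, add_zero, sub_zero, e1, Real.norm_eq_abs] at h2
    rw [abs_mul, abs_of_pos hP]
    rw [abs_of_pos (show 0 < 1 / P by positivity)] at h2
    calc P * |u (x + Pi.single i (1 / P)) - u x| ≤ P * (C * (1 / P)) := by gcongr
      _ = C := by field_simp
  have hb : ∀ x, |pder i g x| ≤ C := (h.2 i).abs_le
  induction M generalizing g with
  | zero => exact bd hg hb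
  | succ M ih =>
    refine ⟨bd hg hb, fun j => ?_⟩
    have e : pder j (fun x => P * (g (x + Pi.single i (1 / P)) - g x)) =
        fun x => P * (pder j g (x + Pi.single i (1 / P)) - pder j g x) := by
      ext x
      have hdiff := hg.differentiable (by simp)
      have h1 : DifferentiableAt ℝ (fun y : Fin n → ℝ => g (y + Pi.single i (1 / P))) x :=
        (hdiff _).comp x (differentiableAt_id.add_const _)
      show fderiv ℝ (fun x => P * (g (x + Pi.single i (1 / P)) - g x)) x (Pi.single j 1) = _
      rw [fderiv_const_mul (h1.fun_sub (hdiff x)), fderiv_fun_sub h1 (hdiff x), fderiv_comp_add_right]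
      rfl
    rw [e]
    refine ih (contDiff_pder hg j) (h.2 j) ?_
    exact ((h.2 j).2 i).abs_le

theorem DerBd.diffBd {P : ℝ} (hP : 0 < P) {M : ℕ} {C : ℝ} {g : (Fin n → ℝ) → ℝ}
    (hg : ContDiff ℝ (⊤ : ℕ∞) g) (h : DerBd M C g) :
    DiffBd P M C (fun x => g (fun i => (x i : ℝ) / P)) := by
  induction M generalizing g with
  | zero => exact fun x => h _
  | succ M ih =>
    refine ⟨fun x => h.1 _, fun i => ?_⟩
    have hg' : ContDiff ℝ (⊤ : ℕ∞) (fun x => P * (g (x + Pi.single i (1 / P)) - g x)) :=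
      contDiff_const.mul ((hg.comp (contDiff_id.add contDiff_const)).sub hg)
    have := ih hg' (h.sub hP hg i)
    convert this using 1
    ext x
    simp only [fdiff]
    congr 3
    ext k
    by_cases hk : k = i
    · subst hk; simp [add_div]
    · simp [Pi.single_eq_of_ne hk]

theorem SmoothWeight.diffBd {c : ℝ} {cs : ℕ → ℝ} {ω : (Fin n → ℝ) → ℝ} (hc : SuperSeq c cs)
    (hω : SmoothWeight n c cs ω) {P : ℝ} (hP : 0 < P) (M : ℕ) :
    DiffBd P M (cs M) (fun x => ω (fun i => (x i : ℝ) / P)) := by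
  have h := derBd_listDer hc hω M 0 M (by simp)
  have e : listDer (List.finRange n) 0 ω = ω := by
    generalize List.finRange n = l
    induction l with
    | nil => rfl
    | cons a t ih => exact ih
  rw [e] at h
  exact h.diffBd hP hω.1

end SmoothWeights

section Differencing

variable {n : ℕ}

/-- The exponential sum with weight `F` and phase `ψ`. -/
def phaseSum (F : (Fin n → ℤ) → ℝ) (ψ : (Fin n → ℤ) → ℝ) : ℂ :=
  ∑' x : Fin n → ℤ, (F x : ℂ) * eC (ψ x)

/-- The weight `F(x + h) F(x)` of a differenced sum. -/
def shiftMul (h : Fin n → ℤ) (F : (Fin n → ℤ) → ℝ) : (Fin n → ℤ) → ℝ :=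
  (fun x => F (x + h)) * F

/-- The phase `ψ(x + h) - ψ(x)` of a differenced sum. -/
def shiftSub (h : Fin n → ℤ) (ψ : (Fin n → ℤ) → ℝ) : (Fin n → ℤ) → ℝ := fun x => ψ (x + h) - ψ x

theorem BoxSupp.shiftMul {A : ℝ} {F : (Fin n → ℤ) → ℝ} (hF : BoxSupp A F) (h : Fin n → ℤ) :
    BoxSupp A (shiftMul h F) := fun x hx => hF x (right_ne_zero_of_mul hx)

theorem sq_norm_phaseSum_le {A : ℝ} {F : (Fin n → ℤ) → ℝ} (hF : BoxSupp A F)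
    (ψ : (Fin n → ℤ) → ℝ) : ‖phaseSum F ψ‖ ^ 2 ≤
      ∑ h ∈ intBox n (2 * A), ‖phaseSum (shiftMul h F) (shiftSub h ψ)‖ := by
  have h1 : starRingEnd ℂ (phaseSum F ψ) * phaseSum F ψ =
      ∑ h ∈ intBox n (2 * A), phaseSum (shiftMul h F) (shiftSub h ψ) := by
    have h2 : ∀ x ∈ intBox n A, ∑ y ∈ intBox n A, (F y : ℂ) * eC (ψ y) =
        ∑ h ∈ intBox n (2 * A), (F (x + h) : ℂ) * eC (ψ (x + h)) := by
      intro x hx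
      have e1 : ∑ y ∈ intBox n A, (F y : ℂ) * eC (ψ y) =
          ∑ h ∈ (intBox n A).image (fun y => y - x), (F (x + h) : ℂ) * eC (ψ (x + h)) := by
        rw [Finset.sum_image fun a _ b _ hab => sub_left_injective hab]
        exact Finset.sum_congr rfl fun y _ => by rw [add_sub_cancel]
      rw [e1]
      apply Finset.sum_subset
      · intro h hh
        obtain ⟨y, hy, rfl⟩ := Finset.mem_image.1 hh
        rw [mem_intBox] at hx hy ⊢
        intro i
        rw [Pi.sub_apply, Int.cast_sub]
        have := abs_sub (y i : ℝ) (x i)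
        have := hx i
        have := hy i
        linarith
      · intro h _ hh
        by_contra h0
        apply hh
        rw [Finset.mem_image]
        refine ⟨x + h, ?_, by rw [add_sub_cancel_left]⟩
        rw [mem_intBox]
        apply hF
        intro h3
        exact h0 (by rw [h3]; simp)
    unfold phaseSum
    rw [hF.tsum_eq, map_sum, Finset.sum_mul]
    have h3 : ∀ x ∈ intBox n A, starRingEnd ℂ ((F x : ℂ) * eC (ψ x)) *
        ∑ y ∈ intBox n A, (F y : ℂ) * eC (ψ y) =
        ∑ h ∈ intBox n (2 * A), (shiftMul h F x : ℂ) * eC (shiftSub h ψ x) := by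
      intro x hx
      rw [h2 x hx, Finset.mul_sum]
      refine Finset.sum_congr rfl fun h _ => ?_
      rw [map_mul, ← eC_neg, Complex.conj_ofReal, shiftSub, sub_eq_add_neg, eC_add]
      simp only [shiftMul, Pi.mul_apply]
      push_cast; ring
    rw [Finset.sum_congr rfl h3, Finset.sum_comm]
    exact Finset.sum_congr rfl fun h _ => ((hF.shiftMul h).tsum_eq _).symm
  have h4 : ‖phaseSum F ψ‖ ^ 2 = ‖starRingEnd ℂ (phaseSum F ψ) * phaseSum F ψ‖ := by
    rw [norm_mul, Complex.norm_conj, sq]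
  rw [h4, h1]
  exact norm_sum_le _ _

/-- Iterated differenced weight. -/
def iterMul : (k : ℕ) → (Fin k → Fin n → ℤ) → ((Fin n → ℤ) → ℝ) → ((Fin n → ℤ) → ℝ)
  | 0, _, F => F
  | k + 1, h, F => iterMul k (Fin.tail h) (shiftMul (h 0) F)

/-- Iterated differenced phase. -/
def iterSub : (k : ℕ) → (Fin k → Fin n → ℤ) → ((Fin n → ℤ) → ℝ) → ((Fin n → ℤ) → ℝ)
  | 0, _, ψ => ψ
  | k + 1, h, ψ => iterSub k (Fin.tail h) (shiftSub (h 0) ψ)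

theorem BoxSupp.iterMul {A : ℝ} {F : (Fin n → ℤ) → ℝ} (hF : BoxSupp A F) (k : ℕ)
    (h : Fin k → Fin n → ℤ) : BoxSupp A (iterMul k h F) := by
  induction k generalizing F with
  | zero => exact hF
  | succ k ih => exact ih (hF.shiftMul (h 0)) (Fin.tail h)

/-- The bound for the differences of iterated differenced weights. -/
def iterConst (M : ℕ) : ℕ → ℝ → ℝ
  | 0, C => C
  | k + 1, C => iterConst M k (2 ^ M * (C * C))

theorem iterConst_pos (M k : ℕ) {C : ℝ} (hC : 0 < C) : 0 < iterConst M k C := by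
  induction k generalizing C with
  | zero => exact hC
  | succ k ih => exact ih (by positivity)

theorem DiffBd.iterMul {P C : ℝ} {M : ℕ} {F : (Fin n → ℤ) → ℝ} (hF : DiffBd P M C F) (k : ℕ)
    (h : Fin k → Fin n → ℤ) : DiffBd P M (iterConst M k C) (iterMul k h F) := by
  induction k generalizing F C with
  | zero => exact hF
  | succ k ih => exact ih ((hF.shift (h 0)).mul hF) (Fin.tail h)

theorem sum_piFinset_cons {β : Type*} {N : Type*} [AddCommMonoid N] (s : Finset β) (k : ℕ)
    (g : (Fin (k + 1) → β) → N) :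
    ∑ h ∈ Fintype.piFinset (fun _ : Fin (k + 1) => s), g h =
      ∑ a ∈ s, ∑ h ∈ Fintype.piFinset (fun _ : Fin k => s), g (Fin.cons a h) := by
  rw [← Finset.sum_product']
  refine Finset.sum_nbij' (fun h => (h 0, Fin.tail h)) (fun p => Fin.cons p.1 p.2) ?_ ?_ ?_ ?_ ?_
  · intro h hh
    rw [Fintype.mem_piFinset] at hh
    rw [Finset.mem_product, Fintype.mem_piFinset]
    exact ⟨hh 0, fun i => hh i.succ⟩
  · intro p hp
    rw [Finset.mem_product, Fintype.mem_piFinset] at hp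
    rw [Fintype.mem_piFinset]
    intro i
    refine Fin.cases ?_ (fun j => ?_) i
    · simpa using hp.1
    · simpa using hp.2 j
  · intro h _; exact Fin.cons_self_tail h
  · intro p _; simp
  · intro h _; simp only [Fin.cons_self_tail]

theorem weyl_differencing {A : ℝ} {F : (Fin n → ℤ) → ℝ} (hF : BoxSupp A F)
    (ψ : (Fin n → ℤ) → ℝ) (k : ℕ) : ‖phaseSum F ψ‖ ^ (2 ^ k) ≤
      ((intBox n (2 * A)).card : ℝ) ^ (2 ^ k - k - 1) *
        ∑ h ∈ Fintype.piFinset (fun _ : Fin k => intBox n (2 * A)),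
          ‖phaseSum (iterMul k h F) (iterSub k h ψ)‖ := by
  induction k generalizing F ψ with
  | zero => simp [iterMul, iterSub]
  | succ k ih =>
    set B : ℝ := ((intBox n (2 * A)).card : ℝ) with hB
    have hB0 : 0 ≤ B := Nat.cast_nonneg _
    have hk : k + 1 ≤ 2 ^ k := Nat.lt_two_pow_self
    rw [sum_piFinset_cons]
    have h1 := pow_sum_le_card_mul_sum_pow (s := intBox n (2 * A))
      (f := fun h => ‖phaseSum (shiftMul h F) (shiftSub h ψ)‖) (fun _ _ => norm_nonneg _) (2 ^ k - 1)
    rw [show 2 ^ k - 1 + 1 = 2 ^ k by omega] at h1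
    calc ‖phaseSum F ψ‖ ^ (2 ^ (k + 1)) = (‖phaseSum F ψ‖ ^ 2) ^ (2 ^ k) := by
          rw [← pow_mul, pow_succ']
      _ ≤ (∑ h ∈ intBox n (2 * A), ‖phaseSum (shiftMul h F) (shiftSub h ψ)‖) ^ (2 ^ k) :=
          pow_le_pow_left₀ (by positivity) (sq_norm_phaseSum_le hF ψ) _
      _ ≤ B ^ (2 ^ k - 1) *
          ∑ h ∈ intBox n (2 * A), ‖phaseSum (shiftMul h F) (shiftSub h ψ)‖ ^ 2 ^ k := h1
      _ ≤ B ^ (2 ^ k - 1) * ∑ h₀ ∈ intBox n (2 * A), (B ^ (2 ^ k - k - 1) *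
          ∑ h ∈ Fintype.piFinset (fun _ : Fin k => intBox n (2 * A)),
            ‖phaseSum (iterMul k h (shiftMul h₀ F)) (iterSub k h (shiftSub h₀ ψ))‖) :=
          mul_le_mul_of_nonneg_left
            (Finset.sum_le_sum fun h₀ _ => ih (hF.shiftMul h₀) _) (by positivity)
      _ = _ := by
          rw [← Finset.mul_sum, ← mul_assoc, ← pow_add]
          congr 2
          rw [pow_succ]; omega

end Differencing

section Polarization

variable {n : ℕ} {R : Type*} [CommRing R]

/-- Polynomials all of whose monomials `m` satisfy `deg m + j ≤ k`. -/
def lowDeg (n : ℕ) (R : Type*) [CommRing R] (j k : ℕ) : Submodule R (MvPolynomial (Fin n) R) :=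
  restrictSupport R {m | m.degree + j ≤ k}

theorem mem_lowDeg {j k : ℕ} {p : MvPolynomial (Fin n) R} :
    p ∈ lowDeg n R j k ↔ ∀ m, coeff m p ≠ 0 → m.degree + j ≤ k := by
  unfold lowDeg
  rw [mem_restrictSupport_iff]
  constructor
  · intro h m hm
    exact h (mem_support_iff.2 hm)
  · intro h m hm
    exact h m (mem_support_iff.1 hm)

theorem lowDeg_mono {j j' k : ℕ} (h : j ≤ j') : lowDeg n R j' k ≤ lowDeg n R j k := by
  intro p hp
  rw [mem_lowDeg] at hp ⊢
  intro m hm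
  have := hp m hm
  omega

theorem mul_X_mem_lowDeg {j k : ℕ} {p : MvPolynomial (Fin n) R} (hp : p ∈ lowDeg n R j k)
    (i : Fin n) : p * X i ∈ lowDeg n R j (k + 1) := by
  rw [mem_lowDeg] at hp ⊢
  intro m hm
  rw [coeff_mul_X'] at hm
  split_ifs at hm with h
  · have h1 := hp _ hm
    have h2 : (m - Finsupp.single i 1).degree + 1 = m.degree := by
      conv_rhs => rw [← Finsupp.sub_add_single_one_cancel (Finsupp.mem_support_iff.1 h)]
      rw [map_add, Finsupp.degree_single]
    omega
  · exact absurd rfl hm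

theorem mul_C_mem_lowDeg {j k : ℕ} {p : MvPolynomial (Fin n) R} (hp : p ∈ lowDeg n R j k)
    (a : R) : p * C a ∈ lowDeg n R j k := by
  rw [mul_comm, C_mul']
  exact Submodule.smul_mem _ _ hp

theorem pderiv_mem_lowDeg {j k : ℕ} {p : MvPolynomial (Fin n) R} (hp : p ∈ lowDeg n R j k)
    (i : Fin n) : pderiv i p ∈ lowDeg n R (j + 1) k := by
  rw [mem_lowDeg] at hp ⊢
  intro m hm
  rw [coeff_pderiv] at hm
  have h1 := hp _ (left_ne_zero_of_mul hm)
  rw [map_add, Finsupp.degree_single] at h1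
  omega

/-- The directional derivative `∑ hᵢ ∂ᵢ`. -/
def dirDer (h : Fin n → R) : MvPolynomial (Fin n) R →ₗ[R] MvPolynomial (Fin n) R :=
  ∑ i, h i • (pderiv i : Derivation R (MvPolynomial (Fin n) R) _).toLinearMap

theorem dirDer_apply (h : Fin n → R) (p : MvPolynomial (Fin n) R) :
    dirDer h p = ∑ i, h i • pderiv i p := by
  simp [dirDer]

theorem dirDer_mem_lowDeg {j k : ℕ} {p : MvPolynomial (Fin n) R} (hp : p ∈ lowDeg n R j k)
    (h : Fin n → R) : dirDer h p ∈ lowDeg n R (j + 1) k := by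
  rw [dirDer_apply]
  exact Submodule.sum_mem _ fun i _ => Submodule.smul_mem _ _ (pderiv_mem_lowDeg hp i)

/-- The second-order Taylor remainder of `p(x + h)`. -/
def taylorRem (h : Fin n → R) : MvPolynomial (Fin n) R →ₗ[R] MvPolynomial (Fin n) R :=
  (aeval fun i => (X i + C (h i) : MvPolynomial (Fin n) R)).toLinearMap - LinearMap.id - dirDer h

theorem taylorRem_apply (h : Fin n → R) (p : MvPolynomial (Fin n) R) :
    taylorRem h p = aeval (fun i => (X i + C (h i) : MvPolynomial (Fin n) R)) p - p - dirDer h p := by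
  simp [taylorRem]

theorem dirDer_mul_X (h : Fin n → R) (p : MvPolynomial (Fin n) R) (i : Fin n) :
    dirDer h (p * X i) = dirDer h p * X i + p * C (h i) := by
  rw [dirDer_apply, dirDer_apply]
  simp only [Derivation.leibniz, smul_add, Finset.sum_add_distrib, pderiv_X, smul_eq_mul]
  rw [add_comm]
  congr 1
  · rw [Finset.sum_mul]
    refine Finset.sum_congr rfl fun j _ => ?_
    rw [smul_mul_assoc, mul_comm]
  · rw [Finset.sum_eq_single i]
    · rw [Pi.single_eq_same, mul_one, mul_comm, C_mul']
    · intro j _ hj; rw [Pi.single_eq_of_ne hj.symm]; simp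
    · simp

theorem taylorRem_mul_X (h : Fin n → R) (p : MvPolynomial (Fin n) R) (i : Fin n) :
    taylorRem h (p * X i) =
      taylorRem h p * X i + taylorRem h p * C (h i) + dirDer h p * C (h i) := by
  rw [taylorRem_apply, taylorRem_apply, dirDer_mul_X, map_mul, aeval_X]
  ring

theorem taylorRem_monomial_mem (h : Fin n → R) (e : ℕ) (m : Fin n →₀ ℕ) (hm : m.degree = e) :
    taylorRem h (monomial m (1 : R)) ∈ lowDeg n R 2 e := by
  induction e generalizing m with
  | zero =>
    rw [Finsupp.degree_eq_zero_iff] at hm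
    subst hm
    have : taylorRem h (monomial 0 (1 : R)) = 0 := by
      rw [taylorRem_apply, dirDer_apply]
      simp
    rw [this]; exact Submodule.zero_mem _
  | succ e ih =>
    obtain ⟨i, hi⟩ : ∃ i, m i ≠ 0 := by
      by_contra! h0
      have : m = 0 := Finsupp.ext h0
      subst this
      simp at hm
    have h2 := Finsupp.sub_add_single_one_cancel hi
    have h3 : (m - Finsupp.single i 1).degree = e := by
      rw [← h2, map_add, Finsupp.degree_single] at hm
      omega
    have h4 : monomial m (1 : R) = monomial (m - Finsupp.single i 1) 1 * X i := by
      conv_lhs => rw [← h2]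
      rw [X, monomial_mul, one_mul]
    have h5 := ih _ h3
    rw [h4, taylorRem_mul_X]
    have h6 : monomial (m - Finsupp.single i 1) (1 : R) ∈ lowDeg n R 0 e := by
      rw [mem_lowDeg]
      intro m' hm'
      rw [coeff_monomial] at hm'
      split_ifs at hm' with h7
      · rw [← h7, h3, add_zero]
      · exact absurd rfl hm'
    have up : ∀ {p : MvPolynomial (Fin n) R}, p ∈ lowDeg n R 2 e → p ∈ lowDeg n R 2 (e + 1) := by
      intro p hp
      rw [mem_lowDeg] at hp ⊢
      exact fun m hm => (hp m hm).trans (Nat.le_succ e)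
    have up' : ∀ {p : MvPolynomial (Fin n) R}, p ∈ lowDeg n R 1 e → p ∈ lowDeg n R 2 (e + 1) := by
      intro p hp
      rw [mem_lowDeg] at hp ⊢
      intro m hm
      have := hp m hm
      omega
    exact Submodule.add_mem _ (Submodule.add_mem _ (mul_X_mem_lowDeg h5 i)
      (up (mul_C_mem_lowDeg h5 _))) (up' (mul_C_mem_lowDeg (dirDer_mem_lowDeg h6 h) _))

theorem taylorRem_mem (h : Fin n → R) {j k : ℕ} {p : MvPolynomial (Fin n) R}
    (hp : p ∈ lowDeg n R j k) : taylorRem h p ∈ lowDeg n R (j + 2) k := by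
  rw [mem_lowDeg] at hp
  rw [p.as_sum, map_sum]
  refine Submodule.sum_mem _ fun m hm => ?_
  have h1 : monomial m (coeff m p) = coeff m p • monomial m (1 : R) := by
    rw [smul_monomial, smul_eq_mul, mul_one]
  rw [h1, map_smul]
  refine Submodule.smul_mem _ _ ?_
  have h2 := taylorRem_monomial_mem h _ m rfl
  have h3 := hp m (mem_support_iff.1 hm)
  rw [mem_lowDeg] at h2 ⊢
  intro m' hm'
  have := h2 m' hm'
  omega

/-- Iterated directional derivative. -/
def iterDer : (k : ℕ) → (Fin k → Fin n → R) → MvPolynomial (Fin n) R → MvPolynomial (Fin n) R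
  | 0, _, F => F
  | k + 1, h, F => iterDer k (Fin.tail h) (dirDer (h 0) F)

theorem iterDer_mem_lowDeg {k : ℕ} (h : Fin k → Fin n → R) {j d : ℕ}
    {p : MvPolynomial (Fin n) R} (hp : p ∈ lowDeg n R j d) : iterDer k h p ∈ lowDeg n R (j + k) d := by
  induction k generalizing j p with
  | zero => exact hp
  | succ k ih =>
    have := ih (Fin.tail h) (dirDer_mem_lowDeg hp (h 0))
    rwa [add_right_comm] at this

theorem eval_aeval_shift (h x : Fin n → R) (p : MvPolynomial (Fin n) R) :
    eval x (aeval (fun i => (X i + C (h i) : MvPolynomial (Fin n) R)) p) = eval (x + h) p := by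
  induction p using MvPolynomial.induction_on with
  | C a => simp
  | add p q hp hq => rw [map_add, map_add, map_add, hp, hq]
  | mul_X p i hp => rw [map_mul, map_mul, map_mul, hp, aeval_X]; simp

theorem eval_add_sub_eval (h x : Fin n → R) (p : MvPolynomial (Fin n) R) :
    eval (x + h) p - eval x p = eval x (dirDer h p + taylorRem h p) := by
  rw [taylorRem_apply, map_add, map_sub, map_sub, eval_aeval_shift]; ring

theorem iterSub_eval (α : ℝ) (d : ℕ) (k : ℕ) (h : Fin k → Fin n → ℤ) (i : ℕ)
    (F g : MvPolynomial (Fin n) ℤ) (hF : F ∈ lowDeg n ℤ i d) (hg : g ∈ lowDeg n ℤ (i + 1) d) :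
    ∃ g' ∈ lowDeg n ℤ (i + k + 1) d, iterSub k h (fun x => α * (eval x (F + g) : ℝ)) =
      fun x => α * ((eval x (iterDer k h F + g') : ℤ) : ℝ) := by
  induction k generalizing i F g with
  | zero => exact ⟨g, hg, rfl⟩
  | succ k ih =>
    have hFg : F + g ∈ lowDeg n ℤ i d := Submodule.add_mem _ hF (lowDeg_mono (Nat.le_succ i) hg)
    obtain ⟨g', hg', e⟩ := ih (Fin.tail h) (i + 1) (dirDer (h 0) F)
      (dirDer (h 0) g + taylorRem (h 0) (F + g)) (dirDer_mem_lowDeg hF _)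
      (Submodule.add_mem _ (dirDer_mem_lowDeg hg _) (taylorRem_mem _ hFg))
    refine ⟨g', by rwa [add_right_comm i 1 k] at hg', ?_⟩
    refine Eq.trans ?_ e
    show iterSub k (Fin.tail h) _ = _
    congr 1
    ext x
    have h1 := eval_add_sub_eval (h 0) x (F + g)
    rw [map_add (dirDer (h 0)), add_assoc] at h1
    rw [← h1]
    simp only [shiftSub]
    push_cast; ring

theorem eval_eq_of_mem_lowDeg {d : ℕ} {p : MvPolynomial (Fin n) R} (hp : p ∈ lowDeg n R d (d + 1))
    (x : Fin n → R) : eval x p = coeff 0 p + ∑ j, coeff (Finsupp.single j 1) p * x j := by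
  have h1 := eval_add_sub_eval x 0 p
  have h2 : taylorRem x p = 0 := by
    ext m
    by_contra h0
    have := mem_lowDeg.1 (taylorRem_mem x hp) m (by simpa using h0)
    omega
  rw [h2, add_zero, zero_add, sub_eq_iff_eq_add, dirDer_apply, map_sum] at h1
  have e0 : ∀ q : MvPolynomial (Fin n) R, eval 0 q = coeff 0 q := by
    intro q
    rw [← constantCoeff_eq, constantCoeff_eq, eval_zero]; rfl
  rw [h1, e0, add_comm]
  congr 1
  refine Finset.sum_congr rfl fun j _ => ?_
  rw [smul_eval, e0, coeff_pderiv]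
  simp [mul_comm]

end Polarization

section Polarization

variable {n : ℕ} {R : Type*} [CommRing R]

/-- The coefficient of `m` in `F`, multiplied by `m!`. -/
def facCoeff (F : MvPolynomial (Fin n) R) (m : Fin n →₀ ℕ) : R :=
  ((∏ i, (m i).factorial : ℕ) : R) * coeff m F

theorem facCoeff_pderiv (F : MvPolynomial (Fin n) R) (i : Fin n) (m : Fin n →₀ ℕ) :
    facCoeff (pderiv i F) m = facCoeff F (m + Finsupp.single i 1) := by
  unfold facCoeff
  rw [coeff_pderiv]
  have : ∏ a, ((m + Finsupp.single i 1 : Fin n →₀ ℕ) a).factorial =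
      (∏ a, (m a).factorial) * (m i + 1) := by
    have h1 : ∏ a, (if a = i then m i + 1 else 1) = m i + 1 := by simp
    rw [← h1, ← Finset.prod_mul_distrib]
    refine Finset.prod_congr rfl fun a _ => ?_
    by_cases h : a = i
    · subst h; simp [Nat.factorial_succ, mul_comm]
    · simp [h]
  rw [this]
  push_cast
  ring

/-- The exponent vector with `l` listing its indices with multiplicity. -/
def idxSum {k : ℕ} (l : Fin k → Fin n) : Fin n →₀ ℕ := ∑ i, Finsupp.single (l i) 1

theorem idxSum_insertNth {k : ℕ} (s : Fin (k + 1)) (a : Fin n) (l : Fin k → Fin n) :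
    idxSum (s.insertNth a l : Fin (k + 1) → Fin n) = Finsupp.single a 1 + idxSum l := by
  simp [idxSum, Fin.sum_univ_succAbove _ s]

/-- The multilinear form `∑ ∏ hᵢ(lᵢ) · c(m + e_{l₁} + ⋯ + e_{l_k})`. -/
def polarForm (k : ℕ) (c : (Fin n →₀ ℕ) → R) (h : Fin k → Fin n → R) (m : Fin n →₀ ℕ) : R :=
  ∑ l : Fin k → Fin n, (∏ i, h i (l i)) * c (m + idxSum l)

theorem polarForm_insertNth {k : ℕ} (c : (Fin n →₀ ℕ) → R) (s : Fin (k + 1)) (u : Fin n → R)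
    (h : Fin k → Fin n → R) (m : Fin n →₀ ℕ) :
    polarForm (k + 1) c (s.insertNth u h : Fin (k + 1) → Fin n → R) m =
      ∑ a, polarForm k c h (m + Finsupp.single a 1) * u a := by
  unfold polarForm
  rw [← (Fin.insertNthEquiv (fun _ => Fin n) s).sum_comp, Fintype.sum_prod_type]
  refine Finset.sum_congr rfl fun a _ => ?_
  rw [Finset.sum_mul]
  refine Finset.sum_congr rfl fun l _ => ?_
  have e : (Fin.insertNthEquiv (fun _ => Fin n) s) (a, l) = s.insertNth a l := rfl
  rw [e, idxSum_insertNth, Fin.prod_univ_succAbove _ s]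
  simp only [Fin.insertNth_apply_same, Fin.insertNth_apply_succAbove]
  rw [add_assoc]
  ring

theorem facCoeff_iterDer {k : ℕ} (h : Fin k → Fin n → R) (F : MvPolynomial (Fin n) R)
    (m : Fin n →₀ ℕ) : facCoeff (iterDer k h F) m = polarForm k (facCoeff F) h m := by
  induction k generalizing F with
  | zero => simp [iterDer, polarForm, idxSum]
  | succ k ih =>
    have e : h = (Fin.insertNth 0 (h 0) (Fin.tail h) : Fin (k + 1) → Fin n → R) := by
      rw [Fin.insertNth_zero', Fin.cons_self_tail]
    conv_rhs => rw [e]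
    rw [polarForm_insertNth]
    show facCoeff (iterDer k (Fin.tail h) (dirDer (h 0) F)) m = _
    rw [ih]
    unfold polarForm
    simp_rw [Finset.sum_mul]
    rw [Finset.sum_comm]
    refine Finset.sum_congr rfl fun l _ => ?_
    have : facCoeff (dirDer (h 0) F) (m + idxSum l) =
        ∑ a, h 0 a * facCoeff F (m + Finsupp.single a 1 + idxSum l) := by
      simp_rw [add_right_comm m _ (idxSum l), ← facCoeff_pderiv]
      simp only [facCoeff, dirDer_apply, coeff_sum, Finset.mul_sum, coeff_smul, smul_eq_mul]
      refine Finset.sum_congr rfl fun a _ => by ring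
    rw [this, Finset.mul_sum]
    refine Finset.sum_congr rfl fun a _ => by ring

theorem coeff_iterDer_single {k : ℕ} (h : Fin k → Fin n → R) (F : MvPolynomial (Fin n) R)
    (j : Fin n) : coeff (Finsupp.single j 1) (iterDer k h F) =
      polarForm k (facCoeff F) h (Finsupp.single j 1) := by
  rw [← facCoeff_iterDer, facCoeff]
  have : ∏ i, ((Finsupp.single j 1 : Fin n →₀ ℕ) i).factorial = 1 := by
    refine Finset.prod_eq_one fun i _ => ?_
    by_cases h : j = i
    · subst h; simp
    · simp [h]
  rw [this]; simp

/-- Euler's identity for a form in terms of its polarization. -/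
theorem polarForm_diag {k : ℕ} {G : MvPolynomial (Fin n) R} (hG : G.IsHomogeneous k) :
    polarForm k (fun m => C (facCoeff G m)) (fun _ => (X : Fin n → MvPolynomial (Fin n) R)) 0 =
      (k.factorial : MvPolynomial (Fin n) R) * G := by
  induction k generalizing G with
  | zero =>
    have h1 : G = C (coeff 0 G) := by
      rw [← totalDegree_eq_zero_iff_eq_C]
      exact Nat.le_zero.1 hG.totalDegree_le
    simp only [polarForm, Finset.univ_unique, Finset.sum_singleton, Finset.univ_eq_empty,
      Finset.prod_empty, one_mul, idxSum, Finset.sum_empty, facCoeff, Nat.factorial_zero,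
      Nat.cast_one]
    simp [← h1]
  | succ k ih =>
    have e : (fun _ => X : Fin (k + 1) → Fin n → MvPolynomial (Fin n) R) =
        (Fin.insertNth 0 X (fun _ => X) : Fin (k + 1) → Fin n → MvPolynomial (Fin n) R) := by
      rw [Fin.insertNth_zero']
      ext i
      refine Fin.cases ?_ (fun i => ?_) i <;> rfl
    rw [e, polarForm_insertNth]
    have h1 : ∀ a, polarForm k (fun m => C (facCoeff G m))
        (fun _ => (X : Fin n → MvPolynomial (Fin n) R)) (0 + Finsupp.single a 1) =
        (k.factorial : MvPolynomial (Fin n) R) * pderiv a G := by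
      intro a
      rw [← ih (hG.pderiv (i := a))]
      unfold polarForm
      refine Finset.sum_congr rfl fun l _ => ?_
      simp only [facCoeff_pderiv, zero_add]
      rw [add_comm]
    simp_rw [h1]
    have h2 := hG.sum_X_mul_pderiv
    rw [Nat.factorial_succ]
    push_cast
    calc _ = (k.factorial : MvPolynomial (Fin n) R) * ∑ a, X a * pderiv a G := by
            rw [Finset.mul_sum]; exact Finset.sum_congr rfl fun a _ => by ring
      _ = _ := by rw [h2, nsmul_eq_mul]; push_cast; ring

end Polarization

section LinearSections

theorem ringKrullDim_sup_span_le {A : Type*} [CommRing A] {J m : Ideal A} (hm : m.IsMaximal)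
    {l : A} (hl : ∀ Q ∈ J.minimalPrimes, l ∈ Q → Q = m) {s : ℕ}
    (hJ : ringKrullDim (A ⧸ J) ≤ ((s + 1 : ℕ) : WithBot ℕ∞)) :
    ringKrullDim (A ⧸ (J ⊔ Ideal.span {l})) ≤ ((s : ℕ) : WithBot ℕ∞) := by
  rw [ringKrullDim_quotient] at hJ ⊢
  refine iSup_le fun p => ?_
  have hp : J ⊔ Ideal.span {l} ≤ p.head.1.asIdeal := p.head.2
  obtain ⟨Q, hQ, hQp⟩ := Ideal.exists_minimalPrimes_le (J := p.head.1.asIdeal)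
    (le_sup_left.trans hp)
  have hlp : l ∈ p.head.1.asIdeal :=
    hp (Ideal.mem_sup_right (Ideal.mem_span_singleton_self l))
  by_cases hlQ : l ∈ Q
  · have h1 := hl Q hQ hlQ
    rw [h1] at hQp
    rcases Nat.eq_zero_or_pos p.length with h0 | h0
    · rw [h0]; exact_mod_cast Nat.zero_le s
    · exfalso
      have h2 : p.head < p.last := p.strictMono (Fin.lt_def.2 h0)
      have h3 : p.head.1.asIdeal < p.last.1.asIdeal := h2
      exact p.last.1.2.ne_top (hm.1.2 _ (hQp.trans_lt h3))
  · have hQm : (⟨Q, hQ.1.1⟩ : PrimeSpectrum A) ∈ PrimeSpectrum.zeroLocus (J : Set A) := hQ.1.2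
    let Q' : PrimeSpectrum.zeroLocus (J : Set A) := ⟨⟨Q, hQ.1.1⟩, hQm⟩
    let f : PrimeSpectrum.zeroLocus ((J ⊔ Ideal.span {l} : Ideal A) : Set A) →
        PrimeSpectrum.zeroLocus (J : Set A) :=
      fun x => ⟨x.1, le_trans (le_sup_left : J ≤ J ⊔ Ideal.span {l}) x.2⟩
    have hf : StrictMono f := fun _ _ h => h
    have hlt : Q' < (p.map f hf).head :=
      lt_of_le_of_ne hQp fun h => hlQ (by
        have h4 : Q = p.head.1.asIdeal :=
          congrArg (fun x : PrimeSpectrum.zeroLocus (J : Set A) => x.1.asIdeal) h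
        rw [h4]; exact hlp)
    have h5 := (Order.LTSeries.length_le_krullDim (RelSeries.cons (p.map f hf) Q' hlt)).trans hJ
    have h6 : (RelSeries.cons (p.map f hf) Q' hlt).length = p.length + 1 := by simp
    rw [h6] at h5
    have h7 : p.length + 1 ≤ s + 1 := by exact_mod_cast h5
    exact_mod_cast Nat.le_of_succ_le_succ h7

variable {k : Type*} [Field k] {V : Type*}

attribute [local instance] MvPolynomial.gradedAlgebra

theorem isMaximal_idealOfVars : (idealOfVars V k).IsMaximal := by
  have h : idealOfVars V k = RingHom.ker (constantCoeff : MvPolynomial V k →+* k) := by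
    ext p
    rw [← pow_one (idealOfVars V k), mem_pow_idealOfVars_iff', RingHom.mem_ker, constantCoeff_eq]
    constructor
    · intro h; exact h 0 (by simp)
    · intro h x hx
      have : x = 0 := by rw [← Finsupp.degree_eq_zero_iff]; omega
      rw [this, h]
  rw [h]
  exact RingHom.ker_isMaximal_of_surjective _ fun a => ⟨C a, constantCoeff_C _ a⟩

theorem homogeneous_le_idealOfVars {I : Ideal (MvPolynomial V k)}
    (hI : I.IsHomogeneous (homogeneousSubmodule V k)) (h : I ≠ ⊤) : I ≤ idealOfVars V k := by
  intro p hp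
  rw [← pow_one (idealOfVars V k), mem_pow_idealOfVars_iff']
  intro x hx
  have : x = 0 := by rw [← Finsupp.degree_eq_zero_iff]; omega
  subst this
  by_contra h0
  have h1 := homogeneousComponent_mem_of_mem hI hp 0
  rw [homogeneousComponent_zero] at h1
  exact h (Ideal.eq_top_of_isUnit_mem _ h1 ((isUnit_iff_ne_zero.2 h0).map C))

theorem exists_pow_idealOfVars_le_of_dim_zero [Finite V] {J : Ideal (MvPolynomial V k)}
    (hJ : J.IsHomogeneous (homogeneousSubmodule V k))
    (h0 : ringKrullDim (MvPolynomial V k ⧸ J) ≤ 0) : ∃ N, idealOfVars V k ^ N ≤ J := by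
  have := Fintype.ofFinite V
  refine Ideal.exists_pow_le_of_le_radical_of_fg ?_ (idealOfVars_fg V k)
  rw [hJ.radical_eq]
  refine le_sInf ?_
  rintro P ⟨hP1, hP2, hP3⟩
  have h1 := homogeneous_le_idealOfVars hP1 hP3.ne_top
  rw [ringKrullDim_quotient, Order.krullDim_nonpos_iff_forall_isMax] at h0
  exact h0 ⟨⟨P, hP3⟩, hP2⟩ (b := ⟨⟨_, isMaximal_idealOfVars.isPrime⟩, hP2.trans h1⟩) h1

theorem exists_linear_section [Infinite k] [Finite V] (J : Ideal (MvPolynomial V k))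
    (hJ : J.IsHomogeneous (homogeneousSubmodule V k)) (s : ℕ)
    (hs : ringKrullDim (MvPolynomial V k ⧸ J) ≤ ((s : ℕ) : WithBot ℕ∞)) :
    ∃ (l : Fin s → MvPolynomial V k), (∀ i, (l i).IsHomogeneous 1) ∧
      ∃ N, idealOfVars V k ^ N ≤ J ⊔ Ideal.span (Set.range l) := by
  have := Fintype.ofFinite V
  induction s generalizing J with
  | zero =>
    obtain ⟨N, hN⟩ := exists_pow_idealOfVars_le_of_dim_zero hJ (by simpa using hs)
    exact ⟨Fin.elim0, fun i => i.elim0, N, hN.trans le_sup_left⟩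
  | succ s ih =>
    obtain ⟨l, hl1, hl⟩ : ∃ l : MvPolynomial V k, l.IsHomogeneous 1 ∧
        ∀ Q ∈ J.minimalPrimes, l ∈ Q → Q = idealOfVars V k := by
      let L : (V → k) →ₗ[k] MvPolynomial V k := Fintype.linearCombination k X
      have hL : ∀ a, L a = ∑ i, a i • X i := fun a => rfl
      have hfin := J.finite_minimalPrimes_of_isNoetherianRing
      let S : Finset (Submodule k (V → k)) := (hfin.toFinset.filter fun Q =>
        Q ≠ idealOfVars V k).image fun Q => (Q.restrictScalars k).comap L
      have hS : ⊤ ∉ S := by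
        intro h
        obtain ⟨Q, hQ, e⟩ := Finset.mem_image.1 h
        rw [Finset.mem_filter, Set.Finite.mem_toFinset] at hQ
        refine hQ.2 (isMaximal_idealOfVars.eq_of_le hQ.1.1.1.ne_top ?_).symm
        refine Ideal.span_le.2 ?_
        rintro _ ⟨i, rfl⟩
        have h1 : (Pi.single i 1 : V → k) ∈ (Q.restrictScalars k).comap L := by
          rw [e]; trivial
        have h2 : L (Pi.single i 1) = X i := by
          rw [hL, Finset.sum_eq_single i]
          · simp
          · intro j _ hj; simp [hj]
          · simp
        rw [Submodule.mem_comap, h2] at h1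
        exact h1
      have h3 := Subspace.biUnion_ne_univ_of_top_notMem hS
      obtain ⟨a, ha⟩ := (Set.ne_univ_iff_exists_notMem _).1 h3
      refine ⟨L a, ?_, ?_⟩
      · rw [hL]
        refine IsHomogeneous.sum _ _ _ fun i _ => ?_
        rw [← C_mul']
        exact isHomogeneous_C_mul_X _ _
      · intro Q hQ hlQ
        by_contra hne
        refine ha (Set.mem_biUnion (x := (Q.restrictScalars k).comap L) ?_ hlQ)
        exact Finset.mem_coe.2 (Finset.mem_image.2 ⟨Q, Finset.mem_filter.2
          ⟨hfin.mem_toFinset.2 hQ, hne⟩, rfl⟩)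
    have h1 := ringKrullDim_sup_span_le isMaximal_idealOfVars hl hs
    have h2 : (J ⊔ Ideal.span {l}).IsHomogeneous (homogeneousSubmodule V k) := by
      refine hJ.sup (Ideal.homogeneous_span _ _ ?_)
      rintro _ rfl
      exact ⟨1, hl1⟩
    obtain ⟨l', hl', N, hN⟩ := ih _ h2 h1
    refine ⟨Fin.cons l l', ?_, N, hN.trans ?_⟩
    · intro i
      refine Fin.cases hl1 hl' i
    · rw [Fin.range_cons, Set.insert_eq, Ideal.span_union, sup_assoc]

end LinearSections

section UniformExponent

variable {k : Type*} [Field k] {V : Type*}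

attribute [local instance] MvPolynomial.gradedAlgebra

theorem pow_idealOfVars_le_iff {A : Type*} [CommRing A] {N : ℕ} {I : Ideal (MvPolynomial V A)} :
    idealOfVars V A ^ N ≤ I ↔ ∀ m : V →₀ ℕ, m.degree = N → monomial m 1 ∈ I := by
  rw [pow_idealOfVars_eq_span, Ideal.span_le]
  constructor
  · intro h m hm; exact h ⟨m, hm, rfl⟩
  · rintro h _ ⟨m, hm, rfl⟩; exact h m hm

/-- The scalars multiplying all monomials of degree `N` into `I`. -/
def scalarColon {A : Type*} [CommRing A] (I : Ideal (MvPolynomial V A)) (N : ℕ) : Ideal A where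
  carrier := {a | ∀ m : V →₀ ℕ, m.degree = N → monomial m a ∈ I}
  add_mem' {a b} ha hb m hm := by
    rw [map_add]; exact I.add_mem (ha m hm) (hb m hm)
  zero_mem' m _ := by rw [map_zero]; exact I.zero_mem
  smul_mem' a b hb m hm := by
    rw [smul_eq_mul, ← C_mul_monomial]; exact I.mul_mem_left _ (hb m hm)

theorem scalarColon_mono {A : Type*} [CommRing A] (I : Ideal (MvPolynomial V A)) :
    Monotone (scalarColon I) := by
  refine monotone_nat_of_le_succ fun N a ha m hm => ?_
  obtain ⟨i, hi⟩ : ∃ i, m i ≠ 0 := by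
    by_contra! h0
    have : m = 0 := Finsupp.ext h0
    subst this
    simp at hm
  have h2 := Finsupp.sub_add_single_one_cancel hi
  have h3 : (m - Finsupp.single i 1).degree = N := by
    rw [← h2, map_add, Finsupp.degree_single] at hm
    omega
  have h4 : monomial m a = monomial (m - Finsupp.single i 1) a * X i := by
    conv_lhs => rw [← h2]
    rw [X, monomial_mul, mul_one]
  rw [h4]
  exact I.mul_mem_right _ (ha _ h3)

theorem exists_uniform_pow [Finite V] {ι : Type*} [Fintype ι] (deg : ι → ℕ) :
    ∃ N, ∀ G : ι → MvPolynomial V k, (∀ i, (G i).IsHomogeneous (deg i)) →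
      (∃ N', idealOfVars V k ^ N' ≤ Ideal.span (Set.range G)) →
        idealOfVars V k ^ N ≤ Ideal.span (Set.range G) := by
  have hft : ∀ e : ℕ, Fintype {m : V →₀ ℕ // m.degree = e} := fun e =>
    (Finsupp.finite_of_degree_eq (σ := V) e).fintype
  let T := Σ i : ι, {m : V →₀ ℕ // m.degree = deg i}
  let A := MvPolynomial T k
  let GG : ι → MvPolynomial V A := fun i =>
    ∑ m : {m : V →₀ ℕ // m.degree = deg i}, monomial m.1 (X ⟨i, m⟩ : A)
  have hGG : ∀ i, (GG i).IsHomogeneous (deg i) := fun i =>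
    IsHomogeneous.sum _ _ _ fun m _ => isHomogeneous_monomial _ m.2
  let I : Ideal (MvPolynomial V A) := Ideal.span (Set.range GG)
  have hI : I.IsHomogeneous (homogeneousSubmodule V A) := by
    refine Ideal.homogeneous_span _ _ ?_
    rintro _ ⟨i, rfl⟩
    exact ⟨deg i, hGG i⟩
  obtain ⟨N, hN⟩ := monotone_stabilizes_iff_noetherian.2 (inferInstance : IsNoetherian A A)
    ⟨scalarColon I, scalarColon_mono I⟩
  refine ⟨N, fun G hG => ?_⟩
  rintro ⟨N', hN'⟩
  wlog hle : N ≤ N' generalizing N'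
  · exact this N ((Ideal.pow_le_pow_right (by omega)).trans hN') le_rfl
  let φ : A →+* k := eval fun t : T => coeff t.2.1 (G t.1)
  have hφ : ∀ i, map φ (GG i) = G i := by
    intro i
    ext m
    simp only [GG, map_sum, map_monomial, coeff_sum, coeff_monomial, φ]
    by_cases hm : m.degree = deg i
    · rw [Finset.sum_eq_single ⟨m, hm⟩]
      · rw [if_pos rfl]
        exact eval_X (f := fun t : T => coeff t.2.1 (G t.1)) _
      · intro b _ hb
        rw [if_neg]
        intro h; exact hb (Subtype.ext h)
      · simp
    · rw [(hG i).coeff_eq_zero hm]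
      refine Finset.sum_eq_zero fun b _ => ?_
      rw [if_neg]
      rintro rfl; exact hm b.2
  have hφC : ∀ p : MvPolynomial V k, map φ (map (C : k →+* A) p) = p := by
    intro p
    rw [map_map]
    have : φ.comp C = RingHom.id k := RingHom.ext fun a =>
      eval_C (f := fun t : T => coeff t.2.1 (G t.1)) a
    rw [this, map_id]
  rw [pow_idealOfVars_le_iff] at hN'
  have hr : ∀ m : {m : V →₀ ℕ // m.degree = N'}, ∃ r ∈ I, r.IsHomogeneous N' ∧
      map φ r = monomial m.1 1 := by
    intro m
    obtain ⟨c, hc⟩ := Ideal.mem_span_range_iff_exists_fun.1 (hN' m.1 m.2)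
    have h1 : ∑ i, map (C : k →+* A) (c i) * GG i ∈ I :=
      I.sum_mem fun i _ => I.mul_mem_left _ (Ideal.subset_span ⟨i, rfl⟩)
    refine ⟨_, homogeneousComponent_mem_of_mem hI h1 N', homogeneousComponent_isHomogeneous _ _, ?_⟩
    have h2 : map φ (∑ i, map (C : k →+* A) (c i) * GG i) = monomial m.1 1 := by
      rw [map_sum, ← hc]
      refine Finset.sum_congr rfl fun i _ => ?_
      rw [map_mul, hφC, hφ]
    ext m'
    rw [coeff_map, coeff_homogeneousComponent]
    split_ifs with h
    · rw [← coeff_map, h2]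
    · rw [map_zero, coeff_monomial, if_neg]
      rintro rfl; exact h m.2
  choose r hrI hrh hrφ using hr
  let M : Matrix {m : V →₀ ℕ // m.degree = N'} {m : V →₀ ℕ // m.degree = N'} A :=
    Matrix.of fun m m' => coeff m'.1 (r m)
  have hdet : M.det ∈ scalarColon I N' := by
    intro m0 hm0
    have h1 : ∑ m, C (M.adjugate ⟨m0, hm0⟩ m) * r m = monomial m0 M.det := by
      refine MvPolynomial.ext _ _ fun m' => ?_
      simp only [coeff_sum, coeff_C_mul, coeff_monomial]
      by_cases hm' : m'.degree = N'
      · have h2 := congrFun (congrFun (Matrix.adjugate_mul M) ⟨m0, hm0⟩) ⟨m', hm'⟩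
        rw [Matrix.mul_apply, Matrix.smul_apply, Matrix.one_apply] at h2
        simp only [Subtype.mk.injEq, smul_eq_mul, mul_ite, mul_one, mul_zero] at h2
        exact h2
      · rw [if_neg (by rintro rfl; exact hm' hm0)]
        refine Finset.sum_eq_zero fun m _ => ?_
        rw [(hrh m).coeff_eq_zero hm', mul_zero]
    rw [← h1]
    exact I.sum_mem fun m _ => I.mul_mem_left _ (hrI m)
  have hdet1 : φ M.det = 1 := by
    rw [RingHom.map_det]
    have : φ.mapMatrix M = 1 := by
      ext m m'
      rw [RingHom.mapMatrix_apply, Matrix.map_apply, Matrix.one_apply]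
      show φ (coeff m'.1 (r m)) = _
      rw [← coeff_map, hrφ, coeff_monomial]
      simp only [Subtype.ext_iff]
    rw [this, Matrix.det_one]
  have h3 : scalarColon I N = scalarColon I N' := hN N' hle
  rw [← h3] at hdet
  rw [pow_idealOfVars_le_iff]
  intro m hm
  have h4 := Ideal.mem_map_of_mem (map φ) (hdet m hm)
  rw [map_monomial, hdet1] at h4
  have h5 : I.map (map φ) = Ideal.span (Set.range G) := by
    rw [Ideal.map_span, ← Set.range_comp]
    congr 2
    ext1 i
    exact hφ i
  rwa [h5] at h4

end UniformExponent

section ZeroCount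

variable {V : Type*}

attribute [local instance] MvPolynomial.gradedAlgebra

theorem homogeneousComponent_mul_linear {R : Type*} [CommRing R] {l : MvPolynomial V R}
    (hl : l.IsHomogeneous 1) (p : MvPolynomial V R) (e : ℕ) :
    homogeneousComponent (e + 1) (p * l) = homogeneousComponent e p * l := by
  conv_lhs => rw [← sum_homogeneousComponent p, Finset.sum_mul, map_sum]
  have h1 : ∀ i, homogeneousComponent (e + 1) (homogeneousComponent i p * l) =
      if i = e then homogeneousComponent i p * l else 0 := by
    intro i
    have h2 : homogeneousComponent i p * l ∈ homogeneousSubmodule V R (i + 1) :=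
      (homogeneousComponent_isHomogeneous i p).mul hl
    rw [homogeneousComponent_of_mem h2]
    by_cases h : i = e
    · simp [h]
    · rw [if_neg h, if_neg (by omega)]
  simp_rw [h1]
  rw [Finset.sum_ite_eq']
  split_ifs with h
  · rfl
  · rw [homogeneousComponent_eq_zero, zero_mul]
    simpa using h

/-- Restriction of polynomial functions to a finite set. -/
def restrEval (Y : Finset (V → ℚ)) : MvPolynomial V ℚ →ₐ[ℚ] (Y → ℚ) :=
  aeval fun v y => y.1 v

theorem restrEval_apply (Y : Finset (V → ℚ)) (p : MvPolynomial V ℚ) (y : Y) :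
    restrEval Y p y = eval y.1 p := by
  have h : (Pi.evalAlgHom ℚ (fun _ : Y => ℚ) y).comp (restrEval Y) =
      (aeval y.1 : MvPolynomial V ℚ →ₐ[ℚ] ℚ) := by
    ext v; simp [restrEval]
  have := DFunLike.congr_fun h p
  exact this.trans (congrFun (congrArg DFunLike.coe (coe_aeval_eq_eval y.1)) p)

/-- The functions on `Y` spanned by `x^β ∏ ℓ^δ` with `|β| < N` and `|δ| ≤ e`. -/
def mixedSpan (Y : Finset (V → ℚ)) {κ : Type*} [Fintype κ] (l : κ → MvPolynomial V ℚ) (N e : ℕ) :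
    Submodule ℚ (Y → ℚ) :=
  Submodule.span ℚ {w | ∃ (β : V →₀ ℕ) (δ : κ → ℕ), β.degree < N ∧ ∑ j, δ j ≤ e ∧
    w = restrEval Y (monomial β 1 * ∏ j, l j ^ δ j)}

theorem mixedSpan_mono (Y : Finset (V → ℚ)) {κ : Type*} [Fintype κ] (l : κ → MvPolynomial V ℚ)
    (N : ℕ) {e e' : ℕ} (h : e ≤ e') : mixedSpan Y l N e ≤ mixedSpan Y l N e' := by
  refine Submodule.span_mono ?_
  rintro w ⟨β, δ, h1, h2, h3⟩
  exact ⟨β, δ, h1, h2.trans h, h3⟩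

theorem mul_mem_mixedSpan (Y : Finset (V → ℚ)) {κ : Type*} [Fintype κ]
    (l : κ → MvPolynomial V ℚ) (N e : ℕ) (j : κ) {w : Y → ℚ} (hw : w ∈ mixedSpan Y l N e) :
    w * restrEval Y (l j) ∈ mixedSpan Y l N (e + 1) := by
  unfold mixedSpan at hw
  induction hw using Submodule.span_induction with
  | mem w hw =>
    obtain ⟨β, δ, h1, h2, rfl⟩ := hw
    refine Submodule.subset_span ⟨β, δ + Pi.single j 1, h1, ?_, ?_⟩
    · simp only [Pi.add_apply, Finset.sum_add_distrib]
      simp; omega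
    · rw [← map_mul, mul_assoc]
      congr 2
      simp only [Pi.add_apply, pow_add, Finset.prod_mul_distrib]
      congr 1
      rw [Finset.prod_eq_single j]
      · simp
      · intro b _ hb; simp [hb]
      · simp
  | zero => rw [zero_mul]; exact Submodule.zero_mem _
  | add x y _ _ hx hy => rw [add_mul]; exact Submodule.add_mem _ hx hy
  | smul a x _ hx => rw [smul_mul_assoc]; exact Submodule.smul_mem _ _ hx

theorem restrEval_mem_mixedSpan (Y : Finset (V → ℚ)) {ι κ : Type*} [Fintype κ]
    {G : ι → MvPolynomial V ℚ} {deg : ι → ℕ} (hG : ∀ i, (G i).IsHomogeneous (deg i))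
    {l : κ → MvPolynomial V ℚ} (hl : ∀ j, (l j).IsHomogeneous 1) {N : ℕ}
    (hN : idealOfVars V ℚ ^ (N + 1) ≤ Ideal.span (Set.range G) ⊔ Ideal.span (Set.range l))
    (hY : ∀ y ∈ Y, ∀ i, eval y (G i) = 0) (e : ℕ) (p : MvPolynomial V ℚ)
    (hp : p.totalDegree ≤ e) : restrEval Y p ∈ mixedSpan Y l (N + 1) e := by
  have hI : (Ideal.span (Set.range G)).IsHomogeneous (homogeneousSubmodule V ℚ) := by
    refine Ideal.homogeneous_span _ _ ?_
    rintro _ ⟨i, rfl⟩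
    exact ⟨deg i, hG i⟩
  have hker : ∀ g ∈ Ideal.span (Set.range G), restrEval Y g = 0 := by
    intro g hg
    have : Ideal.span (Set.range G) ≤ RingHom.ker (restrEval Y) := by
      refine Ideal.span_le.2 ?_
      rintro _ ⟨i, rfl⟩
      refine (RingHom.mem_ker).2 (funext fun y => ?_)
      rw [restrEval_apply, hY _ y.2]; rfl
    exact this hg
  induction e using Nat.strong_induction_on generalizing p with
  | _ e ih =>
  rw [p.as_sum, map_sum]
  refine Submodule.sum_mem _ fun m hm => ?_
  have hme : m.degree ≤ e := (le_totalDegree hm).trans hp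
  have h1 : monomial m (coeff m p) = coeff m p • monomial m (1 : ℚ) := by
    rw [smul_monomial, smul_eq_mul, mul_one]
  rw [h1, map_smul]
  refine Submodule.smul_mem _ _ ?_
  by_cases hmN : m.degree < N + 1
  · refine Submodule.subset_span ⟨m, 0, hmN, by simp, by simp⟩
  obtain ⟨a, ha⟩ : ∃ a, m.degree = a + 1 := ⟨m.degree - 1, by omega⟩
  have h2 : monomial m (1 : ℚ) ∈ Ideal.span (Set.range G) ⊔ Ideal.span (Set.range l) :=
    hN ((monomial_mem_pow_idealOfVars_iff _ _ one_ne_zero).2 (by omega))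
  obtain ⟨g, hg, b, hb, hgb⟩ := Submodule.mem_sup.1 h2
  obtain ⟨c, hc⟩ := Ideal.mem_span_range_iff_exists_fun.1 hb
  have h3 := congrArg (homogeneousComponent (a + 1)) hgb
  rw [map_add, ← hc, map_sum, homogeneousComponent_eq_self (n := a + 1)
    (isHomogeneous_monomial _ ha)] at h3
  simp_rw [homogeneousComponent_mul_linear (hl _)] at h3
  rw [← h3, map_add, hker _ (homogeneousComponent_mem_of_mem hI hg _), zero_add, map_sum]
  refine Submodule.sum_mem _ fun j _ => ?_
  rw [map_mul]
  exact mixedSpan_mono Y l _ (by omega : a + 1 ≤ e) (mul_mem_mixedSpan Y l _ a j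
    (ih a (by omega) _ (homogeneousComponent_isHomogeneous a (c j)).totalDegree_le))

theorem card_zeros_le [Fintype V] (Y : Finset (V → ℚ)) {ι κ : Type*} [Fintype κ]
    {G : ι → MvPolynomial V ℚ} {deg : ι → ℕ} (hG : ∀ i, (G i).IsHomogeneous (deg i))
    {l : κ → MvPolynomial V ℚ} (hl : ∀ j, (l j).IsHomogeneous 1) {N : ℕ}
    (hN : idealOfVars V ℚ ^ (N + 1) ≤ Ideal.span (Set.range G) ⊔ Ideal.span (Set.range l))
    (hY : ∀ y ∈ Y, ∀ i, eval y (G i) = 0) (Z : Finset ℚ) (hZ : ∀ y ∈ Y, ∀ v, y v ∈ Z) :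
    Y.card ≤ Nat.card {m : V →₀ ℕ // m.degree < N + 1} *
      (Fintype.card V * Z.card + 1) ^ Fintype.card κ := by
  set t := Fintype.card V * Z.card with ht
  have : Fintype {m : V →₀ ℕ // m.degree < N + 1} :=
    (Finsupp.finite_of_degree_lt (σ := V) (N + 1)).fintype
  have htop : mixedSpan Y l (N + 1) t = ⊤ := by
    rw [eq_top_iff]
    intro w _
    rw [pi_eq_sum_univ' w]
    refine Submodule.sum_mem _ fun y0 _ => Submodule.smul_mem _ _ ?_
    let p : MvPolynomial V ℚ := ∏ v, ∏ a ∈ Z.erase (y0.1 v), (X v - C a)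
    have hp : p.totalDegree ≤ t := by
      refine (totalDegree_finsetProd _ _).trans ?_
      have : ∀ v ∈ (Finset.univ : Finset V), (∏ a ∈ Z.erase (y0.1 v),
          (X v - C a : MvPolynomial V ℚ)).totalDegree ≤ Z.card := by
        intro v _
        refine (totalDegree_finsetProd _ _).trans ?_
        refine (Finset.sum_le_card_nsmul _ _ 1 fun a _ => ?_).trans ?_
        · refine (totalDegree_sub _ _).trans ?_
          simp
        · simpa using Finset.card_le_card (Finset.erase_subset _ _)
      simpa using Finset.sum_le_card_nsmul _ _ _ this
    have h1 := restrEval_mem_mixedSpan Y hG hl hN hY t p hp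
    have hp0 : eval y0.1 p ≠ 0 := by
      simp only [p, map_prod, map_sub, eval_X, eval_C]
      refine Finset.prod_ne_zero_iff.2 fun v _ => Finset.prod_ne_zero_iff.2 fun a ha => ?_
      exact sub_ne_zero.2 (Finset.ne_of_mem_erase ha).symm
    have h2 : (Pi.single y0 1 : Y → ℚ) = (eval y0.1 p)⁻¹ • restrEval Y p := by
      ext y
      rw [Pi.smul_apply, restrEval_apply, smul_eq_mul, Pi.single_apply]
      split_ifs with h
      · rw [h, inv_mul_cancel₀ hp0]
      · have : eval y.1 p = 0 := by
          obtain ⟨v, hv⟩ : ∃ v, y.1 v ≠ y0.1 v := by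
            by_contra! h0
            exact h (Subtype.ext (funext h0))
          simp only [p, map_prod, map_sub, eval_X, eval_C]
          refine Finset.prod_eq_zero (Finset.mem_univ v) (Finset.prod_eq_zero
            (Finset.mem_erase.2 ⟨hv, hZ _ y.2 v⟩) (sub_self _))
        rw [this, mul_zero]
    rw [h2]
    exact Submodule.smul_mem _ _ h1
  let b : {m : V →₀ ℕ // m.degree < N + 1} × (κ → Fin (t + 1)) → (Y → ℚ) := fun x =>
    restrEval Y (monomial x.1.1 1 * ∏ j, l j ^ (x.2 j : ℕ))
  have hle : mixedSpan Y l (N + 1) t ≤ Submodule.span ℚ (Set.range b) := by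
    refine Submodule.span_mono ?_
    rintro w ⟨β, δ, h1, h2, rfl⟩
    refine ⟨⟨⟨β, h1⟩, fun j => ⟨δ j, ?_⟩⟩, rfl⟩
    have := Finset.single_le_sum (fun i _ => Nat.zero_le (δ i)) (Finset.mem_univ j)
    omega
  rw [htop, top_le_iff] at hle
  have h1 := finrank_range_le_card (R := ℚ) b
  rw [Set.finrank, hle, finrank_top, Module.finrank_fintype_fun_eq_card] at h1
  rw [Nat.card_eq_fintype_card]
  simpa only [Fintype.card_coe, Fintype.card_prod, Fintype.card_fun, Fintype.card_fin] using h1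

end ZeroCount

section PolarCount

variable {n : ℕ}

attribute [local instance] MvPolynomial.gradedAlgebra

theorem map_polarForm {R S : Type*} [CommRing R] [CommRing S] (f : R →+* S) {k : ℕ}
    (c : (Fin n →₀ ℕ) → R) (h : Fin k → Fin n → R) (m : Fin n →₀ ℕ) :
    f (polarForm k c h m) = polarForm k (fun m => f (c m)) (fun i l => f (h i l)) m := by
  simp [polarForm]

theorem map_facCoeff {R S : Type*} [CommRing R] [CommRing S] (f : R →+* S)
    (F : MvPolynomial (Fin n) R) (m : Fin n →₀ ℕ) :
    facCoeff (map f F) m = f (facCoeff F m) := by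
  simp [facCoeff, coeff_map]

/-- The polarizations of the partial derivatives, as forms in the coordinates of all slots. -/
def polarPoly (k : ℕ) (F : MvPolynomial (Fin n) ℚ) (j : Fin n) :
    MvPolynomial (Fin k × Fin n) ℚ :=
  polarForm k (fun m => C (facCoeff F m)) (fun i l => X (i, l)) (Finsupp.single j 1)

theorem polarForm_isHomogeneous {V : Type*} {k : ℕ} (c : (Fin n →₀ ℕ) → ℚ)
    (h : Fin k → Fin n → V) (m : Fin n →₀ ℕ) :
    (polarForm k (fun m => C (c m)) (fun i l => (X (h i l) : MvPolynomial V ℚ)) m).IsHomogeneous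
      k := by
  refine IsHomogeneous.sum _ _ _ fun l _ => ?_
  rw [mul_comm]
  refine IsHomogeneous.C_mul ?_ _
  have := IsHomogeneous.prod Finset.univ (fun i => (X (h i (l i)) : MvPolynomial V ℚ))
    (fun _ => 1) fun i _ => isHomogeneous_X _ _
  simpa using this

/-- The linear forms cutting out the diagonal, together with `l` on the first slot. -/
def diagForms (k : ℕ) {s : ℕ} (l : Fin s → MvPolynomial (Fin n) ℚ) :
    (Fin k × Fin n) ⊕ Fin s → MvPolynomial (Fin (k + 1) × Fin n) ℚ :=
  Sum.elim (fun x => X (x.1.succ, x.2) - X (0, x.2)) fun t => rename (fun a => (0, a)) (l t)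

theorem diagForms_isHomogeneous (k : ℕ) {s : ℕ} {l : Fin s → MvPolynomial (Fin n) ℚ}
    (hl : ∀ t, (l t).IsHomogeneous 1) (x : (Fin k × Fin n) ⊕ Fin s) :
    (diagForms k l x).IsHomogeneous 1 := by
  rcases x with x | t
  · exact (isHomogeneous_X _ _).sub (isHomogeneous_X _ _)
  · exact (hl t).rename_isHomogeneous

theorem pow_idealOfVars_le_polar {k : ℕ} {F : MvPolynomial (Fin n) ℚ}
    (hF : F.IsHomogeneous (k + 2)) {s : ℕ} {l : Fin s → MvPolynomial (Fin n) ℚ} {N : ℕ}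
    (hN : idealOfVars (Fin n) ℚ ^ N ≤
      Ideal.span (Set.range fun i => pderiv i F) ⊔ Ideal.span (Set.range l)) :
    idealOfVars (Fin (k + 1) × Fin n) ℚ ^ N ≤
      Ideal.span (Set.range (polarPoly (k + 1) F)) ⊔ Ideal.span (Set.range (diagForms k l)) := by
  set D := Ideal.span (Set.range (diagForms k l)) with hD
  set L := Ideal.span (Set.range (polarPoly (k + 1) F)) ⊔ D with hL
  have hX : ∀ (i : Fin (k + 1)) (a : Fin n),
      Ideal.Quotient.mk D (X (i, a)) = Ideal.Quotient.mk D (X (0, a)) := by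
    intro i a
    refine Fin.cases rfl (fun i => ?_) i
    rw [Ideal.Quotient.mk_eq_mk_iff_sub_mem]
    exact Ideal.subset_span ⟨Sum.inl (i, a), rfl⟩
  let φ : MvPolynomial (Fin n) ℚ →ₐ[ℚ] MvPolynomial (Fin (k + 1) × Fin n) ℚ :=
    rename fun a => (0, a)
  let ψ : MvPolynomial (Fin (k + 1) × Fin n) ℚ →ₐ[ℚ] MvPolynomial (Fin n) ℚ := rename Prod.snd
  have hφψ : ∀ p, p - φ (ψ p) ∈ D := by
    intro p
    rw [← Ideal.Quotient.mk_eq_mk_iff_sub_mem]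
    have : (Ideal.Quotient.mk D) = (Ideal.Quotient.mk D).comp ((φ.comp ψ : _ →ₐ[ℚ] _) : _ →+* _) := by
      refine MvPolynomial.ringHom_ext (fun r => ?_) fun v => ?_
      · simp [φ, ψ]
      · simp [φ, ψ, ← hX v.1 v.2]
    exact congrArg (fun f : _ →+* _ => f p) this
  have hpd : ∀ j, φ (pderiv j F) ∈ L := by
    intro j
    have h1 : polarForm (k + 1) (fun m => C (facCoeff (pderiv j F) m)) (fun _ => X) 0 =
        ((k + 1).factorial : MvPolynomial (Fin n) ℚ) * pderiv j F :=
      polarForm_diag (hF.pderiv (i := j))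
    have h2 := congrArg φ h1
    rw [map_mul, map_natCast] at h2
    have h3 := map_polarForm φ.toRingHom (k := k + 1)
      (fun m => C (facCoeff (pderiv j F) m)) (fun _ => X) 0
    have h4 : φ (polarForm (k + 1) (fun m => C (facCoeff (pderiv j F) m)) (fun _ => X) 0) -
        polarPoly (k + 1) F j ∈ D := by
      rw [← Ideal.Quotient.mk_eq_mk_iff_sub_mem]
      refine (congrArg (Ideal.Quotient.mk D) h3).trans ?_
      rw [polarPoly, map_polarForm, map_polarForm]
      unfold polarForm
      refine Finset.sum_congr rfl fun l _ => ?_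
      congr 1
      · refine Finset.prod_congr rfl fun i _ => ?_
        simp [φ, ← hX i]
      · simp [φ, facCoeff_pderiv, add_comm]
    rw [h2] at h4
    have h5 : ((k + 1).factorial : MvPolynomial (Fin (k + 1) × Fin n) ℚ) * φ (pderiv j F) ∈ L := by
      have := L.add_mem (Ideal.mem_sup_right h4 : _ ∈ L)
        (Ideal.mem_sup_left (Ideal.subset_span ⟨j, rfl⟩) : polarPoly (k + 1) F j ∈ L)
      rwa [sub_add_cancel] at this
    have h6 := L.mul_mem_left (C ((((k + 1).factorial : ℕ) : ℚ)⁻¹)) h5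
    have h7 : (C ((((k + 1).factorial : ℕ) : ℚ)⁻¹) *
        (((k + 1).factorial : MvPolynomial (Fin (k + 1) × Fin n) ℚ) * φ (pderiv j F))) =
        φ (pderiv j F) := by
      rw [← mul_assoc, ← C_eq_coe_nat, ← C_mul, inv_mul_cancel₀, C_1, one_mul]
      exact_mod_cast Nat.factorial_ne_zero _
    rwa [h7] at h6
  intro p hp
  have h1 : ψ p ∈ idealOfVars (Fin n) ℚ ^ N := by
    have h2 : Ideal.map ψ (idealOfVars (Fin (k + 1) × Fin n) ℚ) ≤ idealOfVars (Fin n) ℚ := by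
      rw [idealOfVars, Ideal.map_span, Ideal.span_le]
      rintro _ ⟨_, ⟨v, rfl⟩, rfl⟩
      refine Ideal.subset_span ⟨v.2, ?_⟩
      simp [ψ]
    have h3 := Ideal.mem_map_of_mem ψ hp
    rw [Ideal.map_pow] at h3
    exact Ideal.pow_right_mono h2 N h3
  have h2 : φ (ψ p) ∈ L := by
    have h3 : Ideal.span (Set.range fun i => pderiv i F) ⊔ Ideal.span (Set.range l) ≤
        L.comap φ := by
      refine sup_le (Ideal.span_le.2 ?_) (Ideal.span_le.2 ?_)
      · rintro _ ⟨j, rfl⟩; exact hpd j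
      · rintro _ ⟨t, rfl⟩
        exact Ideal.mem_sup_right (Ideal.subset_span ⟨Sum.inr t, rfl⟩)
    exact h3 (hN h1)
  have h3 := L.add_mem (Ideal.mem_sup_right (hφψ p) : _ ∈ L) h2
  rwa [sub_add_cancel] at h3

end PolarCount

section PolarCountBound

variable {n : ℕ}

attribute [local instance] MvPolynomial.gradedAlgebra

theorem singDim_le {F : MvPolynomial (Fin n) ℚ} {σ : ℕ}
    (h : singDim n ℚ F = (σ : WithBot (WithTop ℕ))) : σ ≤ n := by
  have h1 : ringKrullDim (MvPolynomial (Fin n) ℚ ⧸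
      Ideal.span (Set.range fun i => pderiv i F)) ≤ ringKrullDim (MvPolynomial (Fin n) ℚ) :=
    ringKrullDim_quotient_le _
  have h2 : ringKrullDim (MvPolynomial (Fin n) ℚ) = ((n : ℕ) : WithBot ℕ∞) := by
    rw [MvPolynomial.ringKrullDim_of_isNoetherianRing, ringKrullDim_eq_zero_of_field]; simp
  have h3 : ((σ : ℕ) : WithBot ℕ∞) ≤ ((n : ℕ) : WithBot ℕ∞) := by
    rw [← h2]; exact h.symm.le.trans h1
  exact_mod_cast h3

theorem isHomogeneous_span_pderiv {F : MvPolynomial (Fin n) ℚ} {d : ℕ} (hF : F.IsHomogeneous d) :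
    (Ideal.span (Set.range fun i => pderiv i F)).IsHomogeneous
      (homogeneousSubmodule (Fin n) ℚ) := by
  refine Ideal.homogeneous_span _ _ ?_
  rintro _ ⟨i, rfl⟩
  exact ⟨d - 1, hF.pderiv⟩

theorem exists_uniform_section (d : ℕ) (s : ℕ) : ∃ N : ℕ, ∀ F : MvPolynomial (Fin n) ℚ,
    F.IsHomogeneous d → singDim n ℚ F = (s : WithBot (WithTop ℕ)) →
    ∃ l : Fin s → MvPolynomial (Fin n) ℚ, (∀ t, (l t).IsHomogeneous 1) ∧
      idealOfVars (Fin n) ℚ ^ N ≤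
        Ideal.span (Set.range fun i => pderiv i F) ⊔ Ideal.span (Set.range l) := by
  obtain ⟨N, hN⟩ := exists_uniform_pow (k := ℚ) (V := Fin n) (ι := Fin n ⊕ Fin s)
    (Sum.elim (fun _ => d - 1) fun _ => 1)
  refine ⟨N, fun F hF hs => ?_⟩
  obtain ⟨l, hl, N', hN'⟩ := exists_linear_section _ (isHomogeneous_span_pderiv hF) s hs.le
  refine ⟨l, hl, ?_⟩
  rw [← Ideal.span_union, ← Set.Sum.elim_range] at hN' ⊢
  refine hN _ ?_ ⟨N', hN'⟩
  rintro (i | t)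
  · exact hF.pderiv
  · exact hl t

/-- Integral zeros in a box of the multilinear forms attached to the gradient of `F`. -/
def polarZeros (k : ℕ) (F : MvPolynomial (Fin n) ℤ) (R : ℝ) : Set (Fin k → Fin n → ℤ) :=
  {h | (∀ i l, |(h i l : ℝ)| ≤ R) ∧ ∀ j, polarForm k (facCoeff F) h (Finsupp.single j 1) = 0}

theorem polarZeros_finite (k : ℕ) (F : MvPolynomial (Fin n) ℤ) (R : ℝ) :
    (polarZeros k F R).Finite := by
  refine (Fintype.piFinset fun _ : Fin k => intBox n R).finite_toSet.subset fun h hh => ?_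
  rw [Finset.mem_coe, Fintype.mem_piFinset]
  exact fun i => mem_intBox.2 (hh.1 i)

theorem exists_ncard_polarZeros_le_of_dim (k : ℕ) (s : ℕ) : ∃ C : ℝ, 0 < C ∧
    ∀ F : MvPolynomial (Fin n) ℤ, F.IsHomogeneous (k + 2) →
    singDim n ℚ (map (Int.castRingHom ℚ) F) = (s : WithBot (WithTop ℕ)) →
    ∀ R : ℝ, 1 ≤ R → ((polarZeros (k + 1) F R).ncard : ℝ) ≤ C * R ^ (k * n + s) := by
  obtain ⟨N, hN⟩ := exists_uniform_section (n := n) (k + 2) s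
  set V := Fin (k + 1) × Fin n with hV
  set B := Nat.card {m : V →₀ ℕ // m.degree < N + 1} with hB
  refine ⟨(B + 1) * (3 * Fintype.card V + 1) ^ (k * n + s), by positivity, fun F hF hs R hR => ?_⟩
  have hFQ : (map (Int.castRingHom ℚ) F).IsHomogeneous (k + 2) := hF.map _
  obtain ⟨l, hl, hle⟩ := hN _ hFQ hs
  have h1 := pow_idealOfVars_le_polar hFQ hle
  have h2 := (Ideal.pow_le_pow_right (I := idealOfVars V ℚ) N.le_succ).trans h1
  let e : (Fin (k + 1) → Fin n → ℤ) → V → ℚ := fun h v => h v.1 v.2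
  have he : Function.Injective e := by
    intro h h' hh
    ext i a
    have : (h i a : ℚ) = h' i a := congrFun hh (i, a)
    exact_mod_cast this
  let Y : Finset (V → ℚ) := (polarZeros_finite (k + 1) F R).toFinset.image e
  let Z : Finset ℚ := (Finset.Icc (-⌊R⌋) ⌊R⌋).image fun z : ℤ => (z : ℚ)
  have h3 := card_zeros_le Y (fun j => polarForm_isHomogeneous (k := k + 1) _ _ _)
    (diagForms_isHomogeneous k hl) h2 ?_ Z ?_
  · have h4 : Y.card = (polarZeros (k + 1) F R).ncard := by
      rw [Finset.card_image_of_injective _ he, Set.ncard_eq_toFinset_card _ (polarZeros_finite _ F R)]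
    have h5 : (Z.card : ℝ) ≤ 3 * R := by
      have h6 : Z.card ≤ (Finset.Icc (-⌊R⌋) ⌊R⌋).card := Finset.card_image_le
      have h7 : 0 ≤ ⌊R⌋ := Int.floor_nonneg.2 (by linarith)
      rw [Int.card_Icc] at h6
      have h8 : (Z.card : ℤ) ≤ ⌊R⌋ + 1 - -⌊R⌋ := by omega
      have h9 : (Z.card : ℝ) ≤ ⌊R⌋ + 1 - -⌊R⌋ := by exact_mod_cast h8
      have := Int.floor_le R
      linarith
    have h6 : Fintype.card ((Fin k × Fin n) ⊕ Fin s) = k * n + s := by simp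
    rw [h6, h4] at h3
    calc ((polarZeros (k + 1) F R).ncard : ℝ) ≤ B * (Fintype.card V * Z.card + 1) ^ (k * n + s) := by
          exact_mod_cast h3
      _ ≤ (B + 1) * (Fintype.card V * (3 * R) + R) ^ (k * n + s) := by
          gcongr
          linarith
      _ = _ := by rw [mul_assoc, ← mul_pow]; ring
  · intro y hy j
    obtain ⟨h, hh, rfl⟩ := Finset.mem_image.1 hy
    have h4 := ((Set.Finite.mem_toFinset _).1 hh).2 j
    have h5 := congrArg (Int.castRingHom ℚ) h4
    rw [map_polarForm, map_zero] at h5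
    refine (map_polarForm (eval (e h)) _ _ _).trans (Eq.trans ?_ h5)
    simp [polarForm, map_facCoeff, e]
  · intro y hy v
    obtain ⟨h, hh, rfl⟩ := Finset.mem_image.1 hy
    have h4 := ((Set.Finite.mem_toFinset _).1 hh).1 v.1 v.2
    refine Finset.mem_image.2 ⟨h v.1 v.2, ?_, rfl⟩
    rw [abs_le] at h4
    rw [Finset.mem_Icc]
    refine ⟨?_, Int.le_floor.2 h4.2⟩
    rw [neg_le]
    refine Int.le_floor.2 ?_
    push_cast; linarith

theorem exists_ncard_polarZeros_le (n k : ℕ) : ∃ C : ℝ, 0 < C ∧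
    ∀ F : MvPolynomial (Fin n) ℤ, F.IsHomogeneous (k + 2) → ∀ σ : ℕ,
    singDim n ℚ (map (Int.castRingHom ℚ) F) = (σ : WithBot (WithTop ℕ)) →
    ∀ R : ℝ, 1 ≤ R → ((polarZeros (k + 1) F R).ncard : ℝ) ≤ C * R ^ (k * n + σ) := by
  choose C hC0 hC using exists_ncard_polarZeros_le_of_dim (n := n) k
  refine ⟨∑ s ∈ Finset.range (n + 1), C s,
    Finset.sum_pos (fun s _ => hC0 s) ⟨0, by simp⟩, fun F hF σ hσ R hR => ?_⟩
  refine (hC σ F hF hσ R hR).trans ?_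
  gcongr
  exact Finset.single_le_sum (f := C) (fun s _ => (hC0 s).le)
    (Finset.mem_range.2 (Nat.lt_succ_of_le (singDim_le hσ)))

end PolarCountBound

section Slots

variable {n : ℕ}

theorem sum_piFinset_insertNth {β N : Type*} [AddCommMonoid N] {k : ℕ} (s : Fin (k + 1))
    (T : Fin (k + 1) → Finset β) (g : (Fin (k + 1) → β) → N) :
    ∑ h ∈ Fintype.piFinset T, g h =
      ∑ h ∈ Fintype.piFinset (fun i => T (s.succAbove i)), ∑ u ∈ T s,
        g (s.insertNth u h : Fin (k + 1) → β) := by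
  rw [← Finset.sum_product']
  refine Finset.sum_nbij' (fun h => (s.removeNth h, h s)) (fun p => s.insertNth p.2 p.1)
    ?_ ?_ ?_ ?_ ?_
  · intro h hh
    rw [Fintype.mem_piFinset] at hh
    exact Finset.mem_product.2 ⟨Fintype.mem_piFinset.2 fun i => hh _, hh s⟩
  · intro p hp
    obtain ⟨h1, h2⟩ := Finset.mem_product.1 hp
    rw [Fintype.mem_piFinset] at h1 ⊢
    intro i
    refine Fin.succAboveCases s ?_ (fun j => ?_) i
    · simpa using h2
    · simpa using h1 j
  · intro h _; simp
  · intro p _; simp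
  · intro h _; simp

/-- The matrix of the linear forms obtained by fixing all slots but one. -/
def slotMatrix (k : ℕ) (c : (Fin n →₀ ℕ) → ℤ) (α : ℝ) (h : Fin k → Fin n → ℤ)
    (j a : Fin n) : ℝ :=
  α * (polarForm k c h (Finsupp.single j 1 + Finsupp.single a 1) : ℤ)

theorem slotMatrix_symm (k : ℕ) (c : (Fin n →₀ ℕ) → ℤ) (α : ℝ) (h : Fin k → Fin n → ℤ)
    (j a : Fin n) : slotMatrix k c α h j a = slotMatrix k c α h a j := by
  simp only [slotMatrix, add_comm]

theorem mul_polarForm_insertNth (k : ℕ) (c : (Fin n →₀ ℕ) → ℤ) (α : ℝ) (s : Fin (k + 1))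
    (u : Fin n → ℤ) (h : Fin k → Fin n → ℤ) (j : Fin n) :
    α * (polarForm (k + 1) c (s.insertNth u h : Fin (k + 1) → Fin n → ℤ)
      (Finsupp.single j 1) : ℤ) = ∑ a, slotMatrix k c α h j a * u a := by
  rw [polarForm_insertNth, Int.cast_sum, Finset.mul_sum]
  refine Finset.sum_congr rfl fun a _ => ?_
  rw [slotMatrix, Int.cast_mul, mul_assoc]

/-- Integral tuples in a box at which the multilinear forms are close to integers. -/
def slotSet (k : ℕ) (c : (Fin n →₀ ℕ) → ℤ) (α : ℝ) (X : Fin k → ℝ) (δ : ℝ) :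
    Finset (Fin k → Fin n → ℤ) :=
  (Fintype.piFinset fun i => intBox n (X i)).filter fun h =>
    ∀ j, nint (α * (polarForm k c h (Finsupp.single j 1) : ℤ)) ≤ δ

theorem formSet_ncard_eq (γ : Fin n → Fin n → ℝ) (X δ : ℝ) :
    (formSet γ X δ).ncard =
      ((intBox n X).filter fun u => ∀ j, nint (∑ a, γ j a * u a) ≤ δ).card := by
  rw [← Set.ncard_coe_finset]
  congr 1
  ext u
  simp [formSet, mem_intBox]

theorem slotSet_card_eq {k : ℕ} (c : (Fin n →₀ ℕ) → ℤ) (α : ℝ) (s : Fin (k + 1))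
    (X : Fin (k + 1) → ℝ) (δ : ℝ) :
    (slotSet (k + 1) c α X δ).card =
      ∑ h ∈ Fintype.piFinset (fun i => intBox n (X (s.succAbove i))),
        (formSet (slotMatrix k c α h) (X s) δ).ncard := by
  rw [slotSet, Finset.card_filter, sum_piFinset_insertNth s]
  refine Finset.sum_congr rfl fun h _ => ?_
  rw [formSet_ncard_eq, Finset.card_filter]
  simp only [mul_polarForm_insertNth]

theorem slotSet_card_le_of_slot {k : ℕ} (c : (Fin n →₀ ℕ) → ℤ) (α : ℝ) (s : Fin (k + 1))
    {X Y : Fin (k + 1) → ℝ} {δ δ' K : ℝ} (hXY : ∀ i, i ≠ s → X i = Y i)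
    (hK : ∀ γ : Fin n → Fin n → ℝ, (∀ j a, γ j a = γ a j) →
      ((formSet γ (X s) δ).ncard : ℝ) ≤ K * (formSet γ (Y s) δ').ncard) :
    ((slotSet (k + 1) c α X δ).card : ℝ) ≤ K * (slotSet (k + 1) c α Y δ').card := by
  rw [slotSet_card_eq c α s, slotSet_card_eq c α s, Nat.cast_sum, Nat.cast_sum, Finset.mul_sum]
  have h1 : (fun i => intBox n (X (s.succAbove i))) = fun i => intBox n (Y (s.succAbove i)) := by
    funext i
    rw [hXY _ (Fin.succAbove_ne s i)]
  rw [h1]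
  exact Finset.sum_le_sum fun h _ => hK _ (slotMatrix_symm k c α h)

theorem formSet_scale_real (γ : Fin n → Fin n → ℝ) {X δ X' δ' : ℝ} (hX : 0 < X) (hδ : 0 < δ)
    (h1 : δ ≤ 1) (C : ℕ) (hX' : X' ≤ C * X) (hδ' : δ' ≤ C * δ) :
    ((formSet γ X' δ').ncard : ℝ) ≤
      (2 * C + 1) ^ (2 * n) * 3 ^ n * (formSet γ X δ).ncard := by
  have h := (formSet_ncard_mono γ hX' hδ').trans (formSet_scale γ hX hδ h1 C)
  exact_mod_cast h

theorem slotSet_shrink {k : ℕ} (c : (Fin n →₀ ℕ) → ℤ) (α : ℝ) {P Z : ℝ} (hP : 1 ≤ P)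
    (hZ1 : Z ≤ 1) (hZP : 1 ≤ Z * P) {C : ℕ} (hC : 1 ≤ C) :
    ((slotSet (k + 1) c α (fun _ => C * P) (1 / P)).card : ℝ) ≤
      ((2 * C + 1) ^ (2 * n) * 3 ^ n * shrinkConst n * (1 / Z) ^ n) ^ (k + 1) *
        (slotSet (k + 1) c α (fun _ => Z * P) (Z ^ (k + 1) / P)).card := by
  have hP0 : 0 < P := by linarith
  have hZ0 : 0 < Z := by
    by_contra h
    have := mul_nonpos_of_nonpos_of_nonneg (not_lt.1 h) hP0.le
    linarith
  have hC' : (1 : ℝ) ≤ C := by exact_mod_cast hC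
  set K := (2 * C + 1 : ℝ) ^ (2 * n) * 3 ^ n * shrinkConst n * (1 / Z) ^ n with hK
  have hK0 : 0 ≤ K := by have := shrinkConst_pos n; positivity
  have main : ∀ i : ℕ, i ≤ k + 1 →
      ((slotSet (k + 1) c α (fun _ => C * P) (1 / P)).card : ℝ) ≤ K ^ i *
        (slotSet (k + 1) c α (fun j : Fin (k + 1) => if (j : ℕ) < i then Z * P else C * P)
          (Z ^ i / P)).card := by
    intro i
    induction i with
    | zero => intro _; simp
    | succ i ih =>
      intro hi
      refine (ih (by omega)).trans ?_
      rw [pow_succ K, mul_assoc]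
      refine mul_le_mul_of_nonneg_left ?_ (pow_nonneg hK0 _)
      refine slotSet_card_le_of_slot c α ⟨i, by omega⟩ ?_ ?_
      · intro j hj
        have : (j : ℕ) ≠ i := fun h => hj (Fin.ext h)
        have h2 : (j : ℕ) < i ↔ (j : ℕ) < i + 1 := by omega
        simp only [h2]
      · intro γ hγ
        have hZi : Z ^ i ≤ 1 := pow_le_one₀ hZ0.le hZ1
        have hδ0 : 0 < Z ^ i / P := by positivity
        have hδ1 : Z ^ i / P ≤ 1 := by rw [div_le_one hP0]; linarith
        have h1 := formSet_scale_real γ (X := P) (δ := Z ^ i / P) (X' := C * P) (δ' := Z ^ i / P)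
          hP0 hδ0 hδ1 C le_rfl (le_mul_of_one_le_left hδ0.le hC')
        have h2 := formSet_shrink γ hγ (X := P) (δ := Z ^ i / P) (K := 1 / Z) hδ0 hδ1
          (by rw [mul_div_cancel₀ _ hP0.ne']; exact hZi) (by rwa [le_div_iff₀ hZ0, one_mul])
          (by rw [div_le_iff₀ hZ0]; linarith)
        have e1 : P / (1 / Z) = Z * P := by field_simp
        have e2 : Z ^ i / P / (1 / Z) = Z ^ (i + 1) / P := by
          rw [pow_succ]; field_simp
        rw [e1, e2] at h2
        simp only [lt_irrefl, if_false, Nat.lt_succ_self, if_true]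
        refine h1.trans ?_
        rw [hK, mul_assoc (_ * shrinkConst n), mul_assoc _ (shrinkConst n), ← mul_assoc (shrinkConst n)]
        exact mul_le_mul_of_nonneg_left h2 (by positivity)
  have h := main (k + 1) le_rfl
  have e : (fun j : Fin (k + 1) => if (j : ℕ) < k + 1 then Z * P else C * P) = fun _ => Z * P := by
    funext j; simp [j.2]
  rwa [e] at h

theorem sum_kap_le_slotSet {k : ℕ} (c : (Fin n →₀ ℕ) → ℤ) (α : ℝ) {P A : ℝ} (hP : 1 ≤ P)
    {C : ℕ} (hC : 2 ≤ C) (hA : 2 * A ≤ C * P) :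
    ∑ h ∈ Fintype.piFinset (fun _ : Fin (k + 1) => intBox n A),
      ∏ j, kap P (α * (polarForm (k + 1) c h (Finsupp.single j 1) : ℤ)) ≤
      6 ^ n * ((2 * C + 1) ^ (2 * n) * 3 ^ n) *
        (slotSet (k + 1) c α (fun _ => C * P) (1 / P)).card := by
  have hP0 : 0 < P := by linarith
  have hC' : (2 : ℝ) ≤ C := by exact_mod_cast hC
  have hA' : A ≤ C * P := by
    rcases le_total A 0 with h | h
    · exact h.trans (by positivity)
    · linarith
  have hbox : intBox n A ⊆ intBox n (C * P) := by
    intro u hu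
    rw [mem_intBox] at hu ⊢
    exact fun i => (hu i).trans hA'
  have hM : 0 < ⌊P⌋₊ := Nat.floor_pos.2 hP
  have hM1 : 1 / (⌊P⌋₊ : ℝ) ≤ C * (1 / P) := by
    have h1 := Nat.lt_floor_add_one P
    have h2 : (1 : ℝ) ≤ ⌊P⌋₊ := by exact_mod_cast hM
    rw [mul_one_div, div_le_div_iff₀ (by linarith) hP0]
    nlinarith
  rw [sum_piFinset_insertNth 0, slotSet_card_eq c α 0, Nat.cast_sum, Finset.mul_sum]
  refine (Finset.sum_le_sum fun h _ => ?_).trans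
    (Finset.sum_le_sum_of_subset_of_nonneg (Fintype.piFinset_subset _ _ fun _ => hbox)
      fun _ _ _ => by positivity)
  set γ := slotMatrix k c α h with hγ
  simp only [mul_polarForm_insertNth]
  have h4 := kap_sum_le (intBox n A) (fun u j => ∑ a, γ j a * u a) hM
    (formSet γ (2 * A) (1 / ⌊P⌋₊)).ncard ?_
  · have h5 := formSet_scale_real γ (X := P) (δ := 1 / P) (X' := 2 * A) (δ' := 1 / ⌊P⌋₊)
      hP0 (by positivity) (by rwa [div_le_one hP0]) C hA hM1
    calc ∑ u ∈ intBox n A, ∏ j, kap P (∑ a, γ j a * u a)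
        ≤ ∑ u ∈ intBox n A, ∏ j, kap ⌊P⌋₊ (∑ a, γ j a * u a) := by
          refine Finset.sum_le_sum fun u _ => Finset.prod_le_prod (fun j _ => kap_nonneg _ _)
            fun j _ => kap_anti (Nat.cast_nonneg _) (Nat.floor_le hP0.le) _
      _ ≤ 6 ^ n * (formSet γ (2 * A) (1 / ⌊P⌋₊)).ncard := h4
      _ ≤ 6 ^ n * ((2 * C + 1) ^ (2 * n) * 3 ^ n * (formSet γ P (1 / P)).ncard) := by gcongr
      _ ≤ _ := by
          rw [← mul_assoc]
          gcongr
          · exact formSet_finite _ _ _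
          · exact formSet_mono γ (le_mul_of_one_le_left hP0.le (by linarith)) le_rfl
  · intro e₀ he₀
    rw [formSet_ncard_eq]
    refine Finset.card_le_card_of_injOn (fun e => e - e₀) ?_ fun _ _ _ _ h => sub_left_injective h
    intro e he
    rw [Finset.mem_coe, Finset.mem_filter] at he ⊢
    refine ⟨?_, fun j => ?_⟩
    · rw [mem_intBox] at he₀ ⊢
      intro i
      have h1 := mem_intBox.1 he.1 i
      have h2 := he₀ i
      rw [abs_le] at *
      simp only [Pi.sub_apply, Int.cast_sub]
      constructor <;> linarith
    · have := he.2 j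
      simpa [mul_sub, Finset.sum_sub_distrib] using this

end Slots

section Weyl

variable {n : ℕ}

theorem phaseSum_add_const (F : (Fin n → ℤ) → ℝ) (t : ℝ) (ψ : (Fin n → ℤ) → ℝ) :
    ‖phaseSum F (fun x => t + ψ x)‖ = ‖phaseSum F ψ‖ := by
  have h : phaseSum F (fun x => t + ψ x) = eC t * phaseSum F ψ := by
    unfold phaseSum
    rw [← tsum_mul_left]
    refine tsum_congr fun x => ?_
    rw [eC_add]; ring
  rw [h, norm_mul, norm_eC, one_mul]

theorem norm_phaseSum_iterSub (k : ℕ) {f : MvPolynomial (Fin n) ℤ} (hf : f.totalDegree ≤ k + 2)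
    (α : ℝ) (h : Fin (k + 1) → Fin n → ℤ) (G : (Fin n → ℤ) → ℝ) :
    ‖phaseSum G (iterSub (k + 1) h fun x => α * (eval x f : ℝ))‖ =
      ‖linSum G fun j => α * (polarForm (k + 1) (facCoeff (homogeneousComponent (k + 2) f)) h
        (Finsupp.single j 1) : ℤ)‖ := by
  set F := homogeneousComponent (k + 2) f with hF
  have hF1 : F ∈ lowDeg n ℤ 0 (k + 2) := by
    rw [mem_lowDeg]
    intro m hm
    rw [hF, coeff_homogeneousComponent] at hm
    have : m.degree = k + 2 := by by_contra h; simp [h] at hm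
    omega
  have hg1 : f - F ∈ lowDeg n ℤ (0 + 1) (k + 2) := by
    rw [mem_lowDeg]
    intro m hm
    rw [coeff_sub, hF, coeff_homogeneousComponent] at hm
    have h1 : m.degree ≠ k + 2 := by intro h; simp [h] at hm
    rw [if_neg h1, sub_zero] at hm
    have h2 := le_totalDegree (mem_support_iff.2 hm)
    have h3 : m.degree ≤ k + 2 := h2.trans hf
    omega
  obtain ⟨g', hg', h1⟩ := iterSub_eval α (k + 2) (k + 1) h 0 F (f - F) hF1 hg1
  rw [add_sub_cancel] at h1
  have h2 : iterDer (k + 1) h F + g' ∈ lowDeg n ℤ (k + 1) (k + 1 + 1) := by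
    refine Submodule.add_mem _ ?_ ?_
    · simpa using iterDer_mem_lowDeg h hF1
    · exact lowDeg_mono (by omega) hg'
  have h3 : ∀ j, coeff (Finsupp.single j 1) (iterDer (k + 1) h F + g') =
      polarForm (k + 1) (facCoeff F) h (Finsupp.single j 1) := by
    intro j
    rw [coeff_add, coeff_iterDer_single, add_eq_left]
    by_contra h0
    have := mem_lowDeg.1 hg' _ h0
    simp only [Finsupp.degree_single] at this
    omega
  have h4 : iterSub (k + 1) h (fun x => α * (eval x f : ℝ)) =
      fun x => α * (coeff 0 (iterDer (k + 1) h F + g') : ℤ) + ∑ j,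
        (α * (polarForm (k + 1) (facCoeff F) h (Finsupp.single j 1) : ℤ)) * x j := by
    rw [h1]
    funext x
    rw [eval_eq_of_mem_lowDeg h2]
    simp only [h3]
    push_cast
    rw [mul_add, Finset.mul_sum]
    congr 1
    exact Finset.sum_congr rfl fun j _ => by ring
  rw [h4, phaseSum_add_const]
  rfl

theorem boxSupp_weight {c : ℝ} {cs : ℕ → ℝ} {ω : (Fin n → ℝ) → ℝ} (hω : SmoothWeight n c cs ω)
    {P : ℝ} (hP : 0 < P) : BoxSupp (c * P) fun x => ω fun i => (x i : ℝ) / P := by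
  intro x hx i
  have := hω.2.2.1 _ hx i
  rwa [abs_div, abs_of_pos hP, div_le_iff₀ hP] at this

theorem exists_norm_expSum_pow_le (n k : ℕ) {c : ℝ} {cs : ℕ → ℝ} (hc : SuperSeq c cs) :
    ∃ C : ℝ, 0 < C ∧ ∀ f : MvPolynomial (Fin n) ℤ, f.totalDegree ≤ k + 2 →
      ∀ ω, SmoothWeight n c cs ω → ∀ α P Z : ℝ, 1 ≤ P → Z ≤ 1 → 1 ≤ Z * P →
      ‖expSum n f ω α P‖ ^ (2 ^ (k + 1)) ≤
        C * (P ^ (n * (2 ^ (k + 1) - (k + 1))) * (1 / Z) ^ (n * (k + 1)) *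
          (slotSet (k + 1) (facCoeff (homogeneousComponent (k + 2) f)) α (fun _ => Z * P)
            (Z ^ (k + 1) / P)).card) := by
  have hc0 := hc.1
  have hcs : ∀ m, 0 < cs m := fun m => hc.1.trans_le (hc.2.1.trans (hc.2.2.1 (Nat.zero_le m)))
  set E := 2 ^ (k + 1) - (k + 1) - 1 with hE
  have hE1 : 2 ^ (k + 1) - (k + 1) = E + 1 := by
    have := Nat.lt_two_pow_self (n := k + 1)
    omega
  set I := iterConst (2 * n) (k + 1) (cs (2 * n)) with hI
  have hI0 : 0 < I := iterConst_pos _ _ (hcs _)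
  set N := ⌈4 * c⌉₊ + 2 with hN
  have hN1 : 4 * c ≤ N := by rw [hN]; push_cast; linarith [Nat.le_ceil (4 * c)]
  set K1 : ℝ := 6 ^ n * ((2 * N + 1) ^ (2 * n) * 3 ^ n) with hK1
  set K2 : ℝ := (2 * N + 1) ^ (2 * n) * 3 ^ n * shrinkConst n with hK2
  have hK20 : 0 < K2 := by have := shrinkConst_pos n; positivity
  refine ⟨((4 * c + 1) ^ n) ^ E * (2 ^ n * (I * (2 * c + 4 * n + 1) ^ n) * (K1 * K2 ^ (k + 1))),
    by positivity, fun f hf ω hω α P Z hP hZ1 hZP => ?_⟩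
  have hP0 : 0 < P := by linarith
  have hZ0 : 0 < Z := by
    by_contra h
    have := mul_nonpos_of_nonpos_of_nonneg (not_lt.1 h) hP0.le
    linarith
  set W : (Fin n → ℤ) → ℝ := fun x => ω (fun i => (x i : ℝ) / P) with hW
  have hWs : BoxSupp (c * P) W := boxSupp_weight hω hP0
  have hWd : DiffBd P (2 * n) (cs (2 * n)) W := hω.diffBd hc hP0 (2 * n)
  have hexp : expSum n f ω α P = phaseSum W fun x => α * (eval x f : ℝ) := rfl
  have hcP : 0 ≤ c * P := by positivity
  set cF := facCoeff (homogeneousComponent (k + 2) f) with hcF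
  set S := ((slotSet (k + 1) cF α (fun _ => Z * P) (Z ^ (k + 1) / P)).card : ℝ) with hS
  have hb1 : ((intBox n (2 * (c * P))).card : ℝ) ≤ (4 * c + 1) ^ n * P ^ n := by
    refine (intBox_card_le (by positivity)).trans ?_
    rw [← mul_pow]
    gcongr
    linarith
  have hb2 : ∀ h : Fin (k + 1) → Fin n → ℤ,
      ‖phaseSum (iterMul (k + 1) h W) (iterSub (k + 1) h fun x => α * (eval x f : ℝ))‖ ≤
        (2 ^ n * (I * (2 * c + 4 * n + 1) ^ n) * P ^ n) *
          ∏ j, kap P (α * (polarForm (k + 1) cF h (Finsupp.single j 1) : ℤ)) := by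
    intro h
    rw [norm_phaseSum_iterSub k hf]
    refine (norm_linSum_le_kap hP0.le hcP (hWs.iterMul _ h) (hWd.iterMul _ h) _).trans ?_
    refine mul_le_mul_of_nonneg_right ?_ (Finset.prod_nonneg fun j _ => kap_nonneg _ _)
    rw [mul_assoc (2 ^ n), mul_assoc I, ← mul_pow (_ + _)]
    gcongr
    nlinarith
  have hb3 : ∑ h ∈ Fintype.piFinset (fun _ : Fin (k + 1) => intBox n (2 * (c * P))),
      ∏ j, kap P (α * (polarForm (k + 1) cF h (Finsupp.single j 1) : ℤ)) ≤
        K1 * (K2 ^ (k + 1) * (1 / Z) ^ (n * (k + 1)) * S) := by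
    refine (sum_kap_le_slotSet cF α hP (C := N) (by omega) (by nlinarith)).trans ?_
    refine mul_le_mul_of_nonneg_left ?_ (by positivity)
    refine (slotSet_shrink cF α hP hZ1 hZP (C := N) (by omega)).trans ?_
    rw [mul_pow, ← pow_mul]
  rw [hexp, hE1]
  calc _ ≤ _ := weyl_differencing hWs _ (k + 1)
    _ ≤ ((4 * c + 1) ^ n * P ^ n) ^ E * ∑ h ∈ Fintype.piFinset
          (fun _ : Fin (k + 1) => intBox n (2 * (c * P))),
        (2 ^ n * (I * (2 * c + 4 * n + 1) ^ n) * P ^ n) *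
          ∏ j, kap P (α * (polarForm (k + 1) cF h (Finsupp.single j 1) : ℤ)) := by
        refine mul_le_mul (pow_le_pow_left₀ (Nat.cast_nonneg _) hb1 _)
          (Finset.sum_le_sum fun h _ => hb2 h) (Finset.sum_nonneg fun _ _ => norm_nonneg _)
          (by positivity)
    _ ≤ ((4 * c + 1) ^ n * P ^ n) ^ E * ((2 ^ n * (I * (2 * c + 4 * n + 1) ^ n) * P ^ n) *
          (K1 * (K2 ^ (k + 1) * (1 / Z) ^ (n * (k + 1)) * S))) := by
        rw [← Finset.mul_sum]
        gcongr
    _ = _ := by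
        rw [pow_mul P, pow_succ (P ^ n), mul_pow]
        ring

theorem norm_expSum_le {c : ℝ} {cs : ℕ → ℝ} (hc : SuperSeq c cs) (f : MvPolynomial (Fin n) ℤ)
    {ω : (Fin n → ℝ) → ℝ} (hω : SmoothWeight n c cs ω) (α : ℝ) {P : ℝ} (hP : 1 ≤ P) :
    ‖expSum n f ω α P‖ ≤ cs 0 * (2 * c + 1) ^ n * P ^ n := by
  have hP0 : 0 < P := by linarith
  have hc0 := hc.1
  have hcs : 0 < cs 0 := hc.1.trans_le hc.2.1
  have h := norm_tsum_mul_eC_le (by positivity) (boxSupp_weight hω hP0)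
    (hω.diffBd hc hP0 0) fun x => α * (eval x f : ℝ)
  refine h.trans ?_
  rw [mul_assoc, ← mul_pow]
  gcongr
  linarith

end Weyl

section Final

variable {n : ℕ}

theorem int_eq_zero_of_nint_mul_le {α : ℝ} {q : ℕ} (hq : 0 < q) (hαq : Primitive α q)
    {C H T D : ℝ} (hC : 0 ≤ C) (hT : 0 < T) (hD : 0 < D)
    (h1 : (C + 2) * (nint (q * α) * H) ≤ T) (h2 : (C + 2) * q ≤ T * D)
    (h3 : (C + 2) * H ≤ T * q ∨ C + 2 ≤ T * (nint (q * α) * D))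
    {B : ℤ} (hB : |(B : ℝ)| * T ≤ C * H) (hn : nint (α * B) * (T * D) ≤ 1) : B = 0 := by
  obtain ⟨a, ha, hβ⟩ := hαq
  set β := nint (q * α) with hβdef
  have hβ0 : 0 ≤ β := nint_nonneg _
  have hq0 : (0 : ℝ) < q := by exact_mod_cast hq
  have hTD : 0 < T * D := by positivity
  set m := round (α * B) with hm
  have hn' : |α * B - m| * (T * D) ≤ 1 := hn
  have e1 : ((a * B - m * q : ℤ) : ℝ) = -((q * α - a) * B) + q * (α * B - m) := by
    push_cast; ring
  have e2 : |((a * B - m * q : ℤ) : ℝ)| ≤ β * |(B : ℝ)| + q * |α * B - m| := by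
    rw [e1, hβ]
    refine (abs_add_le _ _).trans ?_
    rw [abs_neg, abs_mul, abs_mul, abs_of_pos hq0]
  have e3 : (C + 2) * (β * |(B : ℝ)|) ≤ C := by
    have : (C + 2) * (β * |(B : ℝ)|) * T ≤ C * T := by
      calc (C + 2) * (β * |(B : ℝ)|) * T = (C + 2) * β * (|(B : ℝ)| * T) := by ring
        _ ≤ (C + 2) * β * (C * H) := by gcongr
        _ = C * ((C + 2) * (β * H)) := by ring
        _ ≤ C * T := by gcongr
    exact le_of_mul_le_mul_right this hT
  have e4 : (C + 2) * (q * |α * B - m|) ≤ 1 := by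
    calc (C + 2) * (q * |α * B - m|) = |α * B - m| * ((C + 2) * q) := by ring
      _ ≤ |α * B - m| * (T * D) := by gcongr
      _ ≤ 1 := hn'
  have e5 : |((a * B - m * q : ℤ) : ℝ)| < 1 := by nlinarith
  have e6 : a * B - m * q = 0 := by
    rw [← Int.abs_lt_one_iff]
    exact_mod_cast e5
  have e7 : (q : ℤ) ∣ B := by
    have : (q : ℤ) ∣ a * B := ⟨m, by linarith⟩
    exact (Int.isCoprime_iff_gcd_eq_one.2 ha).symm.dvd_of_dvd_mul_left this
  by_contra hB0
  have e8 : (q : ℝ) ≤ |(B : ℝ)| := by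
    have := Int.le_of_dvd (abs_pos.2 hB0) ((dvd_abs _ _).2 e7)
    exact_mod_cast this
  rcases h3 with h3 | h3
  · have : (C + 2) * |(B : ℝ)| * T ≤ C * q * T := by nlinarith
    have := le_of_mul_le_mul_right this hT
    nlinarith
  · have e9 : β * |(B : ℝ)| = q * |α * B - m| := by
      rw [e6, Int.cast_zero] at e1
      have : (q * α - a) * B = q * (α * B - m) := by linarith
      rw [hβ, ← abs_mul, this, abs_mul, abs_of_pos hq0]
    have : (C + 2) * |(B : ℝ)| ≤ q := by
      calc (C + 2) * |(B : ℝ)| ≤ T * (β * D) * |(B : ℝ)| := by gcongr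
        _ = T * D * (β * |(B : ℝ)|) := by ring
        _ = q * (|α * B - m| * (T * D)) := by rw [e9]; ring
        _ ≤ q * 1 := by gcongr
        _ = q := mul_one _
    nlinarith

theorem abs_facCoeff_le {F : MvPolynomial (Fin n) ℤ} {d : ℕ} (hF : F.IsHomogeneous d) {H : ℝ}
    (hH : HeightLe n F H) (m : Fin n →₀ ℕ) : |((facCoeff F m : ℤ) : ℝ)| ≤ d.factorial * H := by
  have hH0 : 0 ≤ H := (abs_nonneg _).trans (hH 0)
  by_cases h0 : coeff m F = 0
  · simp only [facCoeff, h0, mul_zero, Int.cast_zero, abs_zero]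
    positivity
  · have h1 : ∏ i, (m i).factorial ≤ d.factorial := by
      have h2 := Nat.prod_factorial_dvd_factorial_sum Finset.univ fun i => m i
      have h3 : ∑ i, m i = d := by
        have := hF h0
        rw [← this, Finsupp.weight_apply, Finsupp.sum_fintype _ _ (by simp)]
        simp
      rw [h3] at h2
      exact Nat.le_of_dvd (Nat.factorial_pos _) h2
    rw [facCoeff, Int.cast_mul, abs_mul]
    refine mul_le_mul ?_ (hH m) (abs_nonneg _) (by positivity)
    rw [Int.cast_natCast, Nat.abs_cast]
    exact_mod_cast h1

theorem abs_polarForm_le {c : (Fin n →₀ ℕ) → ℤ} {M Y : ℝ} (hM : ∀ m, |(c m : ℝ)| ≤ M) {k : ℕ}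
    {h : Fin k → Fin n → ℤ} (hh : ∀ i a, |(h i a : ℝ)| ≤ Y) (m : Fin n →₀ ℕ) :
    |((polarForm k c h m : ℤ) : ℝ)| ≤ n ^ k * (Y ^ k * M) := by
  rw [polarForm, Int.cast_sum]
  refine (Finset.abs_sum_le_sum_abs _ _).trans ?_
  refine (Finset.sum_le_card_nsmul _ _ (Y ^ k * M) fun l _ => ?_).trans ?_
  · have h1 : ∏ i, |(h i (l i) : ℝ)| ≤ Y ^ k := by
      simpa using Finset.prod_le_prod (s := Finset.univ) (f := fun i => |(h i (l i) : ℝ)|)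
        (g := fun _ => Y) (fun _ _ => abs_nonneg _) fun i _ => hh i _
    rw [Int.cast_mul, abs_mul, Int.cast_prod, Finset.abs_prod]
    exact mul_le_mul h1 (hM _) (abs_nonneg _)
      ((Finset.prod_nonneg fun _ _ => abs_nonneg _).trans h1)
  · simp

theorem slotSet_card_le_polarZeros {k : ℕ} {F : MvPolynomial (Fin n) ℤ} {α W δ : ℝ}
    (h : ∀ h : Fin k → Fin n → ℤ, (∀ i a, |(h i a : ℝ)| ≤ W) → ∀ j,
      nint (α * (polarForm k (facCoeff F) h (Finsupp.single j 1) : ℤ)) ≤ δ →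
        polarForm k (facCoeff F) h (Finsupp.single j 1) = 0) :
    (slotSet k (facCoeff F) α (fun _ => W) δ).card ≤ (polarZeros k F W).ncard := by
  rw [← Set.ncard_coe_finset]
  refine Set.ncard_le_ncard (fun x hx => ?_) (polarZeros_finite k F W)
  rw [Finset.mem_coe, slotSet, Finset.mem_filter, Fintype.mem_piFinset] at hx
  have h1 : ∀ i a, |(x i a : ℝ)| ≤ W := fun i => mem_intBox.1 (hx.1 i)
  exact ⟨h1, fun j => h x h1 j (hx.2 j)⟩

/-- The bracket in the Weyl bound. -/
def weylBracket (d : ℕ) (α : ℝ) (q : ℕ) (H P : ℝ) : ℝ :=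
  P ^ ((1 : ℝ) - d) + nint (q * α) * H + q * P ^ (-(d : ℝ)) +
    min (H / q) (if nint (q * α) = 0 then H / q else (nint (q * α) * P ^ (d : ℝ))⁻¹)

theorem exists_norm_expSum_div_pow_le (n k : ℕ) {c : ℝ} {cs : ℕ → ℝ} (hc : SuperSeq c cs) :
    ∃ K : ℝ, 0 < K ∧ ∀ f : MvPolynomial (Fin n) ℤ, f.totalDegree ≤ k + 2 → ∀ σ : ℕ,
      singDim n ℚ (map (Int.castRingHom ℚ) (homogeneousComponent (k + 2) f)) =
        (σ : WithBot (WithTop ℕ)) →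
      ∀ H : ℝ, HeightLe n (homogeneousComponent (k + 2) f) H →
      ∀ ω, SmoothWeight n c cs ω → ∀ (α : ℝ) (q : ℕ), 0 < q → Primitive α q →
      ∀ P : ℝ, 1 ≤ P →
        ‖expSum n f ω α P / (P : ℂ) ^ n‖ ^ (2 ^ (k + 1)) ≤
          K * weylBracket (k + 2) α q H P ^ (((n : ℝ) - σ) / ((k : ℝ) + 1)) := by
  obtain ⟨C₁, hC₁, h₁⟩ := exists_norm_expSum_pow_le n k hc
  obtain ⟨C₂, hC₂, h₂⟩ := exists_ncard_polarZeros_le n k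
  have hc0 := hc.1
  have hcs : 0 < cs 0 := hc.1.trans_le hc.2.1
  set A : ℝ := n ^ (k + 1) * (k + 2).factorial with hA
  have hA0 : 0 ≤ A := by positivity
  refine ⟨(C₁ * C₂ + (cs 0 * (2 * c + 1) ^ n) ^ (2 ^ (k + 1))) * (A + 2) ^ (n : ℝ),
    by positivity, fun f hf σ hσ H hH ω hω α q hq hαq P hP => ?_⟩
  have hP0 : 0 < P := by linarith
  have hq0 : (0 : ℝ) < q := by exact_mod_cast hq
  have hH0 : 0 ≤ H := (abs_nonneg _).trans (hH 0)
  have hσn : σ ≤ n := singDim_le hσ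
  have hσn' : (σ : ℝ) ≤ n := by exact_mod_cast hσn
  set F := homogeneousComponent (k + 2) f with hF
  have hFh : F.IsHomogeneous (k + 2) := homogeneousComponent_isHomogeneous _ _
  set e := ((n : ℝ) - σ) / ((k : ℝ) + 1) with he
  have he0 : 0 ≤ e := div_nonneg (by linarith) (by positivity)
  have hen : e ≤ n := by
    rw [he, div_le_iff₀ (by positivity)]
    have : (0 : ℝ) ≤ n * k := by positivity
    have : (0 : ℝ) ≤ σ := by positivity
    linarith
  set β := nint (q * α) with hβ
  have hβ0 : 0 ≤ β := nint_nonneg _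
  set x₁ := P ^ ((1 : ℝ) - (k + 2 : ℕ)) with hx₁
  set x₃ := (q : ℝ) * P ^ (-((k + 2 : ℕ) : ℝ)) with hx₃
  set x₄ := min (H / q) (if β = 0 then H / q else (β * P ^ ((k + 2 : ℕ) : ℝ))⁻¹) with hx₄
  have hX : weylBracket (k + 2) α q H P = x₁ + β * H + x₃ + x₄ := rfl
  have y₁ : x₁ * P ^ (k + 1) = 1 := by
    rw [hx₁, ← Real.rpow_natCast P (k + 1), ← Real.rpow_add hP0]
    push_cast
    ring_nf
    exact Real.rpow_zero P
  have y₃ : x₃ * P ^ (k + 2) = q := by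
    rw [hx₃, ← Real.rpow_natCast P (k + 2), mul_assoc, ← Real.rpow_add hP0, neg_add_cancel,
      Real.rpow_zero, mul_one]
  have hx₁0 : 0 < x₁ := by positivity
  have hx₂0 : 0 ≤ β * H := by positivity
  have hx₃0 : 0 < x₃ := by positivity
  have hx₄0 : 0 ≤ x₄ := by
    rw [hx₄]
    refine le_min (by positivity) ?_
    split_ifs <;> positivity
  set X := weylBracket (k + 2) α q H P with hXdef
  have hX0 : 0 < X := by rw [hX]; positivity
  set T := (A + 2) * X with hT
  have hT0 : 0 < T := by positivity
  have hA2 : (1 : ℝ) ≤ A + 2 := by linarith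
  have hTe : T ^ e ≤ (A + 2) ^ (n : ℝ) * X ^ e := by
    rw [hT, Real.mul_rpow (by positivity) hX0.le]
    gcongr
  have hnorm : ‖expSum n f ω α P / (P : ℂ) ^ n‖ = ‖expSum n f ω α P‖ / P ^ n := by
    rw [norm_div, norm_pow, Complex.norm_real, Real.norm_of_nonneg hP0.le]
  rw [hnorm]
  suffices hmain : (‖expSum n f ω α P‖ / P ^ n) ^ (2 ^ (k + 1)) ≤
      (C₁ * C₂ + (cs 0 * (2 * c + 1) ^ n) ^ (2 ^ (k + 1))) * T ^ e by
    refine hmain.trans ?_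
    rw [mul_assoc]
    gcongr
  rcases le_or_gt 1 T with hT1 | hT1
  · have h3 : ‖expSum n f ω α P‖ / P ^ n ≤ cs 0 * (2 * c + 1) ^ n := by
      rw [div_le_iff₀ (by positivity)]
      exact norm_expSum_le hc f hω α hP
    calc (‖expSum n f ω α P‖ / P ^ n) ^ (2 ^ (k + 1))
        ≤ (cs 0 * (2 * c + 1) ^ n) ^ (2 ^ (k + 1)) := by gcongr
      _ ≤ (C₁ * C₂ + (cs 0 * (2 * c + 1) ^ n) ^ (2 ^ (k + 1))) * 1 := by
          rw [mul_one]; exact le_add_of_nonneg_left (by positivity)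
      _ ≤ _ := by
          gcongr
          exact Real.one_le_rpow hT1 he0
  · set W := T ^ (-(1 / ((k : ℝ) + 1))) with hW
    have hW0 : 0 < W := by positivity
    have hWk : W ^ (k + 1) * T = 1 := by
      rw [hW, ← Real.rpow_natCast, ← Real.rpow_mul hT0.le]
      push_cast
      rw [neg_mul, one_div_mul_cancel (by positivity), Real.rpow_neg_one, inv_mul_cancel₀ hT0.ne']
    have hW1 : 1 ≤ W := by
      by_contra hlt
      have : W ^ (k + 1) ≤ 1 := pow_le_one₀ hW0.le (not_le.1 hlt).le
      nlinarith
    have hWP : W ≤ P := by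
      refine le_of_pow_le_pow_left₀ (Nat.succ_ne_zero k) hP0.le ?_
      have hT2 : x₁ ≤ T := by
        rw [hT, hX]; nlinarith
      have h4 : W ^ (k + 1) * x₁ ≤ P ^ (k + 1) * x₁ := by
        calc W ^ (k + 1) * x₁ ≤ W ^ (k + 1) * T := by gcongr
          _ = P ^ (k + 1) * x₁ := by rw [hWk, mul_comm, y₁]
      exact le_of_mul_le_mul_right h4 hx₁0
    have hZP : W / P * P = W := div_mul_cancel₀ _ hP0.ne'
    have h3 := h₁ f hf ω hω α P (W / P) hP ((div_le_one hP0).2 hWP) (by rwa [hZP])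
    rw [hZP] at h3
    have hslot : ((slotSet (k + 1) (facCoeff F) α (fun _ => W) ((W / P) ^ (k + 1) / P)).card : ℝ) ≤
        C₂ * W ^ (k * n + σ) := by
      refine le_trans ?_ (h₂ F hFh σ hσ W hW1)
      refine Nat.cast_le.2 (slotSet_card_le_polarZeros fun h hh j hn => ?_)
      refine int_eq_zero_of_nint_mul_le hq hαq (C := A) (H := H) (T := T) (D := P ^ (k + 2))
        hA0 hT0 (by positivity) ?_ ?_ ?_ ?_ ?_
      · rw [hT]
        refine mul_le_mul_of_nonneg_left ?_ (by positivity)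
        rw [hX]; linarith
      · rw [hT, mul_assoc]
        refine mul_le_mul_of_nonneg_left ?_ (by positivity)
        rw [← y₃, hX]
        gcongr
        linarith
      · have hT4 : (A + 2) * x₄ ≤ T := by
          rw [hT, hX]
          refine mul_le_mul_of_nonneg_left ?_ (by positivity)
          linarith
        rcases min_choice (H / q) (if β = 0 then H / q else (β * P ^ ((k + 2 : ℕ) : ℝ))⁻¹)
          with hmin | hmin
        · left
          rw [← hx₄] at hmin
          rwa [hmin, ← mul_div_assoc, div_le_iff₀ hq0] at hT4
        · rw [← hx₄] at hmin
          by_cases hβz : β = 0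
          · left
            rw [if_pos hβz] at hmin
            rwa [hmin, ← mul_div_assoc, div_le_iff₀ hq0] at hT4
          · right
            rw [if_neg hβz, Real.rpow_natCast] at hmin
            have : 0 < β := lt_of_le_of_ne hβ0 (Ne.symm hβz)
            rwa [hmin, ← div_eq_mul_inv, div_le_iff₀ (by positivity)] at hT4
      · have h5 := abs_polarForm_le (abs_facCoeff_le hFh hH) hh (Finsupp.single j 1)
        calc _ ≤ n ^ (k + 1) * (W ^ (k + 1) * ((k + 2).factorial * H)) * T := by gcongr
          _ = A * H * (W ^ (k + 1) * T) := by rw [hA]; ring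
          _ = A * H := by rw [hWk, mul_one]
      · calc _ ≤ (W / P) ^ (k + 1) / P * (T * P ^ (k + 2)) := by gcongr
          _ = W ^ (k + 1) * T := by rw [div_pow]; field_simp; ring
          _ ≤ 1 := hWk.le
    have hWe : W ^ (n - σ) * T ^ e = 1 := by
      rw [hW, ← Real.rpow_natCast, ← Real.rpow_mul hT0.le, ← Real.rpow_add hT0, Nat.cast_sub hσn,
        he, show -(1 / ((k : ℝ) + 1)) * ((n : ℝ) - σ) + ((n : ℝ) - σ) / ((k : ℝ) + 1) = 0 by ring,
        Real.rpow_zero]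
    have hpow : 2 ^ (k + 1) - (k + 1) + (k + 1) = 2 ^ (k + 1) :=
      Nat.sub_add_cancel Nat.lt_two_pow_self.le
    have hWn : W ^ (n * (k + 1)) = W ^ (k * n + σ) * W ^ (n - σ) := by
      rw [← pow_add]
      congr 1
      have : k * n + n = n * (k + 1) := by ring
      omega
    have hPn : (P ^ n) ^ (2 ^ (k + 1)) = P ^ (n * (2 ^ (k + 1) - (k + 1))) * P ^ (n * (k + 1)) := by
      rw [← pow_mul, ← pow_add, ← mul_add, hpow]
    calc (‖expSum n f ω α P‖ / P ^ n) ^ (2 ^ (k + 1))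
        = ‖expSum n f ω α P‖ ^ (2 ^ (k + 1)) / (P ^ n) ^ (2 ^ (k + 1)) := div_pow _ _ _
      _ ≤ C₁ * (P ^ (n * (2 ^ (k + 1) - (k + 1))) * (1 / (W / P)) ^ (n * (k + 1)) *
            (C₂ * W ^ (k * n + σ))) / (P ^ n) ^ (2 ^ (k + 1)) := by
          gcongr
          refine h3.trans ?_
          gcongr
      _ = C₁ * C₂ * T ^ e := by
          rw [hPn, one_div_div, div_pow, hWn, div_eq_iff (by positivity)]
          field_simp
          exact hWe.symm
      _ ≤ _ := by
          gcongr
          exact le_add_of_nonneg_right (by positivity)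

end Final

/-- The Weyl bound (Lemma `weyl bound`). -/
theorem weyl_bound (d n : ℕ) (hd : 3 ≤ d) (c : ℝ) (cs : ℕ → ℝ) (hc : SuperSeq c cs) :
    ∃ K : ℝ, 0 < K ∧
      ∀ (f : MvPolynomial (Fin n) ℤ), f.totalDegree ≤ d →
      ∀ σ : ℕ,
        singDim n ℚ (MvPolynomial.map (Int.castRingHom ℚ)
          (MvPolynomial.homogeneousComponent d f)) = (σ : WithBot (WithTop ℕ)) →
      ∀ H : ℝ, HeightLe n (MvPolynomial.homogeneousComponent d f) H →
      ∀ ω : (Fin n → ℝ) → ℝ, SmoothWeight n c cs ω →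
      ∀ (α : ℝ) (q : ℕ), 0 < q → Primitive α q →
      ∀ P : ℝ, 2 ≤ P →
        ‖expSum n f ω α P / (P : ℂ) ^ n‖ ^ (2 ^ (d - 1)) ≤
          K * Real.log P ^ n *
            (P ^ ((1 : ℝ) - d) + nint (q * α) * H + q * P ^ (-(d : ℝ)) +
                min (H / q)
                  (if nint (q * α) = 0 then H / q else (nint (q * α) * P ^ (d : ℝ))⁻¹)) ^
              (((n : ℝ) - σ) / ((d : ℝ) - 1)) := by
  obtain ⟨k, rfl⟩ : ∃ k, d = k + 2 := ⟨d - 2, by omega⟩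
  obtain ⟨K, hK, h⟩ := exists_norm_expSum_div_pow_le n k hc
  have hlog : 0 < Real.log 2 := Real.log_pos one_lt_two
  refine ⟨K / Real.log 2 ^ n, by positivity,
    fun f hf σ hσ H hH ω hω α q hq hαq P hP => ?_⟩
  have h1 := h f hf σ hσ H hH ω hω α q hq hαq P (by linarith)
  have hd1 : ((k + 2 : ℕ) : ℝ) - 1 = (k : ℝ) + 1 := by push_cast; ring
  rw [hd1]
  refine h1.trans (mul_le_mul_of_nonneg_right ?_ (Real.rpow_nonneg ?_ _))
  · rw [div_mul_eq_mul_div, le_div_iff₀ (by positivity)]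
    gcongr
  · have hH0 : 0 ≤ H := (abs_nonneg _).trans (hH 0)
    have := nint_nonneg (q * α)
    refine add_nonneg (by positivity) (le_min (by positivity) ?_)
    split_ifs <;> positivity

end
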